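/- Let 𝕂 be a number field. There exist constants A₁ > 0, A₂ with 0 < A₂ < π/4, and T₀ > 2 such that: for every T ≥ T₀ with the property that |T − γ| > exp(−A₁ γ / log γ) for every ordinate γ > 1 of a non-trivial zero of ζ_𝕂, and for every σ ∈ [−1/2, 3/2], one has |ζ_𝕂(σ + iT)| ≥ e^{−A₂ T}. -/

import Mathlib

namespace LocalBound

open Complex Metric Set

/-- A lower bound for zero-free holomorphic functions on a disc (a form of Harnack's inequality). -/
lemma norm_ge_of_ne_zero {g : ℂ → ℂ} {r r₁ B : ℝ} (hr : 0 ≤ r) (hr₁ : r < r₁) (hB : 0 < B)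
    (hg : DifferentiableOn ℂ g (ball 0 r₁)) (h0 : ∀ z ∈ ball (0 : ℂ) r₁, g z ≠ 0)
    (hb : ∀ z ∈ ball (0 : ℂ) r₁, ‖g z‖ ≤ Real.exp B * ‖g 0‖) {z : ℂ} (hz : ‖z‖ ≤ r) :
    ‖g 0‖ * Real.exp (-(2 * B * r / (r₁ - r))) ≤ ‖g z‖ := by
  have hr₁0 : 0 < r₁ := lt_of_le_of_lt hr hr₁
  have hm0 : (0 : ℂ) ∈ ball (0 : ℂ) r₁ := mem_ball_self hr₁0
  have hg' : DifferentiableOn ℂ (fun z => deriv g z / g z) (ball 0 r₁) :=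
    (hg.deriv isOpen_ball).div hg h0
  obtain ⟨k, hk⟩ := hg'.isExactOn_ball
  set h : ℂ → ℂ := fun z => k z - k 0 with hh
  have hhd : ∀ z ∈ ball (0 : ℂ) r₁, HasDerivAt h (deriv g z / g z) z := fun z hz =>
    (hk z hz).sub_const _
  have hconst : ∀ z ∈ ball (0 : ℂ) r₁, g z * exp (-h z) = g 0 := by
    intro z hz
    have hd : ∀ w ∈ ball (0 : ℂ) r₁, HasDerivAt (fun z => g z * exp (-h z)) 0 w := by
      intro w hw
      have h1 := ((hg.differentiableAt (isOpen_ball.mem_nhds hw)).hasDerivAt).mul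
        ((hhd w hw).neg.cexp)
      convert! h1 using 1
      field_simp [h0 w hw]
      ring
    have h2 := isOpen_ball.is_const_of_deriv_eq_zero (convex_ball (0 : ℂ) r₁).isPreconnected
      (fun w hw => (hd w hw).differentiableAt.differentiableWithinAt)
      (fun w hw => (hd w hw).deriv) hz hm0
    simpa [hh] using h2
  have hgexp : ∀ z ∈ ball (0 : ℂ) r₁, ‖g z‖ = ‖g 0‖ * Real.exp (h z).re := by
    intro z hz
    rw [← hconst z hz, norm_mul, norm_exp, mul_assoc, ← Real.exp_add]
    simp
  have hg0 : 0 < ‖g 0‖ := norm_pos_iff.mpr (h0 0 hm0)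
  have hzb : z ∈ ball (0 : ℂ) r₁ := by simpa using lt_of_le_of_lt hz hr₁
  have hmaps : MapsTo h (ball 0 r₁) {z | z.re ≤ B} := by
    intro w hw
    have := hb w hw
    rw [hgexp w hw, mul_comm] at this
    exact Real.exp_le_exp.mp (le_of_mul_le_mul_right this hg0)
  have hbc := borelCaratheodory_zero hB
    (fun w hw => (hhd w hw).differentiableAt.differentiableWithinAt) hmaps hr₁0 hzb (by simp [hh])
  rw [hgexp z hzb]
  gcongr
  have h3 : 2 * B * ‖z‖ / (r₁ - ‖z‖) ≤ 2 * B * r / (r₁ - r) := by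
    have : 0 < r₁ - r := by linarith
    gcongr
  have h4 := (abs_le.mp (abs_re_le_norm (h z))).1
  linarith

/-- A lower bound for a bounded holomorphic function on a disc away from its zeros. -/
lemma norm_ge_of_dist_zeros {r r₁ R R' B d : ℝ} (hr : 0 ≤ r) (hr₁ : r < r₁) (hR : r₁ < R)
    (hR' : R < R') (hB : 0 < B) (hd : 0 ≤ d) (hdR : d ≤ 2 * R) {z : ℂ} (hz : ‖z‖ ≤ r) (N : ℕ) :
    ∀ f : ℂ → ℂ, DifferentiableOn ℂ f (ball 0 R') →
    (∀ w ∈ closedBall (0 : ℂ) R, ‖f w‖ ≤ 1) → Real.exp (-B) ≤ ‖f 0‖ →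
    (r₁ / R) ^ N < ‖f 0‖ →
    (∀ ρ ∈ closedBall (0 : ℂ) r₁, f ρ = 0 → d ≤ ‖z - ρ‖) →
    Real.exp (-(B * (1 + 2 * r / (r₁ - r)))) * (d / (2 * R)) ^ N ≤ ‖f z‖ := by
  have hr₁0 : 0 < r₁ := lt_of_le_of_lt hr hr₁
  have hR0 : 0 < R := hr₁0.trans hR
  have hd1 : d / (2 * R) ≤ 1 := div_le_one_of_le₀ hdR (by positivity)
  have hd0 : 0 ≤ d / (2 * R) := by positivity
  induction N with
  | zero =>
    intro f _ h1 _ h2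
    have := h1 0 (mem_closedBall_self hR0.le)
    simp at h2
    linarith
  | succ N ih =>
    intro f hf h1 hB0 hN hzero
    have hf0 : f 0 ≠ 0 := by
      rw [← norm_pos_iff]; exact (Real.exp_pos _).trans_le hB0
    by_cases hex : ∃ ρ ∈ closedBall (0 : ℂ) r₁, f ρ = 0
    · obtain ⟨ρ, hρ, hfρ⟩ := hex
      have hρ0 : ρ ≠ 0 := by rintro rfl; exact hf0 hfρ
      have hρr : ‖ρ‖ ≤ r₁ := by simpa using hρ
      have hρR : ‖ρ‖ < R := hρr.trans_lt hR
      have hρpos : 0 < ‖ρ‖ := norm_pos_iff.mpr hρ0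
      have hden : ∀ w ∈ closedBall (0 : ℂ) R, ((R : ℂ) ^ 2 - starRingEnd ℂ ρ * w) ≠ 0 := by
        intro w hw h
        have hw' : ‖w‖ ≤ R := by simpa using hw
        have h5 : ‖(R : ℂ) ^ 2‖ = ‖starRingEnd ℂ ρ * w‖ := by rw [sub_eq_zero.mp h]
        rw [norm_mul, RCLike.norm_conj, norm_pow, norm_real, Real.norm_of_nonneg hR0.le] at h5
        nlinarith [norm_nonneg w]
      set g : ℂ → ℂ := fun w => dslope f ρ w * ((R : ℂ) ^ 2 - starRingEnd ℂ ρ * w) / R with hgdef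
      have hfg : ∀ w, f w * ((R : ℂ) ^ 2 - starRingEnd ℂ ρ * w) = g w * (R * (w - ρ)) := by
        intro w
        have h6 := sub_smul_dslope f ρ w
        rw [hfρ, sub_zero, smul_eq_mul] at h6
        have : (R : ℂ) ≠ 0 := by exact_mod_cast hR0.ne'
        rw [hgdef, ← h6]
        field_simp
      have hρR' : ρ ∈ ball (0 : ℂ) R' := by simpa using hρR.trans hR'
      have hgd : DifferentiableOn ℂ g (ball 0 R') := by
        have h7 : DifferentiableOn ℂ (dslope f ρ) (ball 0 R') :=
          (differentiableOn_dslope (isOpen_ball.mem_nhds hρR')).mpr hf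
        exact (h7.mul (by fun_prop)).div_const _
      have hsphere : ∀ w : ℂ, ‖w‖ = R → ‖(R : ℂ) ^ 2 - starRingEnd ℂ ρ * w‖ = R * ‖w - ρ‖ := by
        intro w hw
        have h8 : (R : ℂ) ^ 2 = starRingEnd ℂ w * w := by
          rw [mul_comm, mul_conj, normSq_eq_norm_sq, hw]; norm_cast
        rw [h8, ← sub_mul, norm_mul, hw, ← map_sub, RCLike.norm_conj, mul_comm]
      have hg1 : ∀ w ∈ closedBall (0 : ℂ) R, ‖g w‖ ≤ 1 := by
        intro w hw
        have hcl : closure (ball (0 : ℂ) R) = closedBall 0 R := closure_ball _ hR0.ne'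
        refine norm_le_of_forall_mem_frontier_norm_le (U := ball (0 : ℂ) R) isBounded_ball ?_ ?_
          (hcl ▸ hw)
        · refine DifferentiableOn.diffContOnCl (hgd.mono ?_)
          rw [hcl]
          exact closedBall_subset_ball hR'
        · intro v hv
          rw [frontier_ball _ hR0.ne', mem_sphere_zero_iff_norm] at hv
          have hvρ : 0 < ‖v - ρ‖ := by
            rw [norm_pos_iff, sub_ne_zero]; rintro rfl; exact hρR.ne hv
          have h9 := congrArg norm (hfg v)
          rw [norm_mul, norm_mul, hsphere v hv, norm_mul, norm_real, Real.norm_of_nonneg hR0.le] at h9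
          have h10 : ‖f v‖ = ‖g v‖ := mul_right_cancel₀ (by positivity) h9
          rw [← h10]
          exact h1 v (by simp [hv])
      have hg0 : ‖g 0‖ = ‖f 0‖ * (R / ‖ρ‖) := by
        have h9 := congrArg norm (hfg 0)
        simp only [mul_zero, sub_zero, zero_sub, norm_mul, norm_pow, norm_real, norm_neg,
          Real.norm_of_nonneg hR0.le] at h9
        field_simp
        nlinarith
      have hratio : R / r₁ ≤ R / ‖ρ‖ := by gcongr
      have hratio1 : 1 ≤ R / ‖ρ‖ := by rw [le_div_iff₀ hρpos]; linarith
      have hfpos : 0 < ‖f 0‖ := norm_pos_iff.mpr hf0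
      have key := ih g hgd hg1 (by rw [hg0]; nlinarith) (by
        rw [hg0]
        calc (r₁ / R) ^ N = (r₁ / R) ^ (N + 1) * (R / r₁) := by rw [pow_succ]; field_simp
          _ < ‖f 0‖ * (R / r₁) := by gcongr
          _ ≤ _ := by gcongr) (by
        intro v hv hgv
        refine hzero v hv ?_
        have h11 := hfg v
        rw [hgv, zero_mul, mul_eq_zero] at h11
        exact h11.resolve_right (hden v (closedBall_subset_closedBall hR.le hv)))
      have hzR : z ∈ closedBall (0 : ℂ) R := by
        simp; linarith
      have hD : 0 < ‖(R : ℂ) ^ 2 - starRingEnd ℂ ρ * z‖ := norm_pos_iff.mpr (hden z hzR)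
      have hD2 : ‖(R : ℂ) ^ 2 - starRingEnd ℂ ρ * z‖ ≤ 2 * R ^ 2 := by
        refine (norm_sub_le _ _).trans ?_
        rw [norm_mul, RCLike.norm_conj, norm_pow, norm_real, Real.norm_of_nonneg hR0.le]
        nlinarith [norm_nonneg z]
      have h12 := congrArg norm (hfg z)
      rw [norm_mul, norm_mul, norm_mul, norm_real, Real.norm_of_nonneg hR0.le] at h12
      have h13 : ‖f z‖ = ‖g z‖ * (R * ‖z - ρ‖ / ‖(R : ℂ) ^ 2 - starRingEnd ℂ ρ * z‖) := by
        rw [mul_div_assoc', eq_div_iff hD.ne', h12]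
      rw [h13, pow_succ, ← mul_assoc]
      have h14 : d / (2 * R) ≤ R * ‖z - ρ‖ / ‖(R : ℂ) ^ 2 - starRingEnd ℂ ρ * z‖ := by
        calc d / (2 * R) = R * d / (2 * R ^ 2) := by field_simp
          _ ≤ R * ‖z - ρ‖ / ‖(R : ℂ) ^ 2 - starRingEnd ℂ ρ * z‖ := by
            have := hzero ρ hρ hfρ
            gcongr
      exact mul_le_mul key h14 hd0 (norm_nonneg _)
    · push Not at hex
      have hsub : ball (0 : ℂ) r₁ ⊆ ball 0 R' := ball_subset_ball (by linarith)
      have h15 := norm_ge_of_ne_zero hr hr₁ hB (hf.mono hsub)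
        (fun w hw => hex w (ball_subset_closedBall hw)) (by
          intro w hw
          have h16 := h1 w (ball_subset_closedBall.trans (closedBall_subset_closedBall hR.le) hw)
          have h17 : Real.exp B * Real.exp (-B) ≤ Real.exp B * ‖f 0‖ := by gcongr
          rw [← Real.exp_add] at h17
          simp at h17
          linarith) hz
      calc _ ≤ Real.exp (-(B * (1 + 2 * r / (r₁ - r)))) * 1 := by
            gcongr
            exact pow_le_one₀ hd0 hd1
        _ = Real.exp (-B) * Real.exp (-(2 * B * r / (r₁ - r))) := by
            rw [← Real.exp_add]; ring_nf
        _ ≤ ‖f 0‖ * Real.exp (-(2 * B * r / (r₁ - r))) := by gcongr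
        _ ≤ _ := h15

end LocalBound

namespace DedekindEuler

open Complex NumberField Filter Topology IsDedekindDomain

variable {K : Type*} [Field K] [NumberField K]

open scoped Classical in
/-- Removing finitely many Euler factors from a Dirichlet series over ideals. -/
lemma tsum_coprime_eq_mul_prod {f : Ideal (𝓞 K) → ℂ} (hf : ∀ I J, f (I * J) = f I * f J)
    (hs : Summable fun I : {I : Ideal (𝓞 K) // I ≠ ⊥} => f I.1)
    (S : Finset (HeightOneSpectrum (𝓞 K))) :
    ∑' I : {I : Ideal (𝓞 K) // I ≠ ⊥}, (if ∀ P ∈ S, ¬ P.asIdeal ∣ I.1 then f I.1 else 0) =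
      (∑' I : {I : Ideal (𝓞 K) // I ≠ ⊥}, f I.1) * ∏ P ∈ S, (1 - f P.asIdeal) := by
  induction S using Finset.induction_on with
  | empty => simp
  | insert P S hP ih =>
    have hsum : ∀ (p : Ideal (𝓞 K) → Prop) [DecidablePred p],
        Summable fun I : {I : Ideal (𝓞 K) // I ≠ ⊥} => if p I.1 then f I.1 else 0 := by
      intro p _
      refine hs.norm.of_norm_bounded (fun I => ?_)
      split_ifs <;> simp
    rw [Finset.prod_insert hP, mul_left_comm, ← ih, sub_mul, one_mul]
    have hsplit : ∑' I : {I : Ideal (𝓞 K) // I ≠ ⊥},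
        (if ∀ Q ∈ S, ¬ Q.asIdeal ∣ I.1 then f I.1 else 0) =
        ∑' I : {I : Ideal (𝓞 K) // I ≠ ⊥},
          (if ∀ Q ∈ insert P S, ¬ Q.asIdeal ∣ I.1 then f I.1 else 0) +
        ∑' I : {I : Ideal (𝓞 K) // I ≠ ⊥},
          (if (∀ Q ∈ S, ¬ Q.asIdeal ∣ I.1) ∧ P.asIdeal ∣ I.1 then f I.1 else 0) := by
      rw [← (hsum fun I => ∀ Q ∈ insert P S, ¬ Q.asIdeal ∣ I).tsum_add
        (hsum fun I => (∀ Q ∈ S, ¬ Q.asIdeal ∣ I) ∧ P.asIdeal ∣ I)]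
      refine tsum_congr fun I => ?_
      by_cases h1 : ∀ Q ∈ S, ¬ Q.asIdeal ∣ I.1 <;> by_cases h2 : P.asIdeal ∣ I.1 <;>
        simp [h1, h2]
    have hP0 : P.asIdeal ≠ ⊥ := P.ne_bot
    let e : {I : Ideal (𝓞 K) // I ≠ ⊥} → {I : Ideal (𝓞 K) // I ≠ ⊥} :=
      fun J => ⟨P.asIdeal * J.1, mul_ne_zero hP0 J.2⟩
    have he : Function.Injective e := by
      intro J J' h
      exact Subtype.ext (mul_left_cancel₀ hP0 (congrArg Subtype.val h))
    have hsecond : ∑' I : {I : Ideal (𝓞 K) // I ≠ ⊥},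
          (if (∀ Q ∈ S, ¬ Q.asIdeal ∣ I.1) ∧ P.asIdeal ∣ I.1 then f I.1 else 0) =
        f P.asIdeal * ∑' I : {I : Ideal (𝓞 K) // I ≠ ⊥},
          (if ∀ Q ∈ S, ¬ Q.asIdeal ∣ I.1 then f I.1 else 0) := by
      rw [← he.tsum_eq, ← tsum_mul_left]
      · refine tsum_congr fun J => ?_
        have hiff : (∀ Q ∈ S, ¬ Q.asIdeal ∣ P.asIdeal * J.1) ↔ ∀ Q ∈ S, ¬ Q.asIdeal ∣ J.1 := by
          refine forall₂_congr fun Q hQ => not_congr ?_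
          rw [Q.prime.dvd_mul]
          refine or_iff_right fun hd => hP ?_
          have hle : P.asIdeal ≤ Q.asIdeal := Ideal.dvd_iff_le.mp hd
          have := P.isMaximal.eq_of_le Q.isPrime.ne_top hle
          rwa [HeightOneSpectrum.ext this]
        simp only [e, hiff, dvd_mul_right, and_true, hf]
        split_ifs <;> simp
      · intro I hI
        simp only [Function.mem_support, ne_eq, ite_eq_right_iff, Classical.not_imp] at hI
        obtain ⟨J, hJ⟩ := hI.1.2
        exact ⟨⟨J, by rintro rfl; exact I.2 (by simpa using hJ)⟩, Subtype.ext hJ.symm⟩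
    linear_combination (-1 : ℂ) * hsplit - hsecond

/-- The partial Euler products of a completely multiplicative Dirichlet series over ideals. -/
lemma tendsto_mul_prod_one_sub {f : Ideal (𝓞 K) → ℂ} (hf : ∀ I J, f (I * J) = f I * f J)
    (hf1 : f ⊤ = 1) (hs : Summable fun I : {I : Ideal (𝓞 K) // I ≠ ⊥} => f I.1) :
    Tendsto (fun S : Finset (HeightOneSpectrum (𝓞 K)) =>
      (∑' I : {I : Ideal (𝓞 K) // I ≠ ⊥}, f I.1) * ∏ P ∈ S, (1 - f P.asIdeal)) atTop (𝓝 1) := by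
  classical
  simp_rw [← tsum_coprime_eq_mul_prod hf hs]
  have h1 : ∑' I : {I : Ideal (𝓞 K) // I ≠ ⊥}, (if I.1 = ⊤ then (1 : ℂ) else 0) = 1 := by
    rw [tsum_eq_single ⟨⊤, top_ne_bot⟩]
    · simp
    · rintro ⟨I, hI⟩ h
      rw [if_neg]
      intro h'
      exact h (Subtype.ext h')
  rw [← h1]
  refine tendsto_tsum_of_dominated_convergence hs.norm ?_ ?_
  · rintro ⟨I, hI⟩
    refine tendsto_const_nhds.congr' ?_
    by_cases hT : I = ⊤
    · refine Eventually.of_forall fun S => ?_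
      subst hT
      simp only [if_true]
      rw [if_pos, hf1]
      intro P _ hd
      exact P.isPrime.ne_top (top_le_iff.mp (Ideal.dvd_iff_le.mp hd))
    · obtain ⟨M, hM, hle⟩ := Ideal.exists_le_maximal I hT
      have hM0 : M ≠ ⊥ := by rintro rfl; exact hI (le_bot_iff.mp hle)
      let P : HeightOneSpectrum (𝓞 K) := ⟨M, hM.isPrime, hM0⟩
      filter_upwards [eventually_ge_atTop {P}] with S hS
      rw [if_neg hT, if_neg]
      intro h
      exact h P (Finset.singleton_subset_iff.mp hS) (Ideal.dvd_iff_le.mpr hle)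
  · refine Eventually.of_forall fun S I => ?_
    split_ifs <;> simp

/-- The 3-4-1 inequality for a single Euler factor. -/
lemma norm_one_sub_comb_le_one {a : ℝ} (ha₀ : 0 ≤ a) (ha₁ : a < 1) {z : ℂ} (hz : ‖z‖ = 1) :
    ‖(1 - (a : ℂ)) ^ 3 * (1 - a * z) ^ 4 * (1 - a * z ^ 2)‖ ≤ 1 := by
  have hac₀ : ‖(a : ℂ)‖ < 1 := by
    simp only [Complex.norm_of_nonneg ha₀, ha₁]
  have hac₁ : ‖a * z‖ < 1 := by rwa [norm_mul, hz, mul_one]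
  have hac₂ : ‖a * z ^ 2‖ < 1 := by rwa [norm_mul, norm_pow, hz, one_pow, mul_one]
  have hlog : 0 ≤ 3 * (-log (1 - a)).re + 4 * (-log (1 - a * z)).re
      + (-log (1 - a * z ^ 2)).re := by
    rw [← ((hasSum_re <| hasSum_taylorSeries_neg_log hac₀).mul_left 3).add
      ((hasSum_re <| hasSum_taylorSeries_neg_log hac₁).mul_left 4) |>.add
      (hasSum_re <| hasSum_taylorSeries_neg_log hac₂) |>.tsum_eq]
    refine tsum_nonneg fun n ↦ ?_
    simp only [← ofReal_pow, div_natCast_re, ofReal_re, mul_pow, mul_re, ofReal_im, zero_mul,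
      sub_zero]
    rcases n.eq_zero_or_pos with rfl | hn
    · simp
    · simp only [← mul_div_assoc, ← add_div]
      refine div_nonneg ?_ n.cast_nonneg
      rw [← pow_mul, pow_mul', sq, mul_re, ← sq, ← sq, ← sq_norm_sub_sq_re, norm_pow, hz]
      convert! (show 0 ≤ 2 * a ^ n * ((z ^ n).re + 1) ^ 2 by positivity) using 1
      ring
  have hpos : ∀ w : ℂ, ‖w‖ < 1 → 0 < ‖1 - w‖ := by
    intro w hw
    rw [norm_pos_iff, sub_ne_zero]
    rintro rfl
    simp at hw
  simp only [neg_re, log_re] at hlog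
  rw [norm_mul, norm_mul, norm_pow, norm_pow]
  have p0 := hpos _ hac₀
  have p1 := hpos _ hac₁
  have p2 := hpos _ hac₂
  rw [← Real.log_nonpos_iff (by positivity), Real.log_mul (by positivity) (by positivity),
    Real.log_mul (by positivity) (by positivity), Real.log_pow, Real.log_pow]
  push_cast
  linarith

variable {ζK : ℂ → ℂ}
  (hζ_an : ∀ s : ℂ, s ≠ 1 → DifferentiableAt ℂ ζK s)
  (hζ_ser : ∀ s : ℂ, 1 < s.re →
      HasSum (fun I : {I : Ideal (𝓞 K) // I ≠ ⊥} =>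
        ((Ideal.absNorm I.1 : ℕ) : ℂ) ^ (-s)) (ζK s))

include hζ_ser

lemma tendsto_mul_prod {s : ℂ} (hs : 1 < s.re) :
    Tendsto (fun S : Finset (HeightOneSpectrum (𝓞 K)) =>
      ζK s * ∏ P ∈ S, (1 - ((Ideal.absNorm P.asIdeal : ℕ) : ℂ) ^ (-s))) atTop (𝓝 1) := by
  rw [← (hζ_ser s hs).tsum_eq]
  refine tendsto_mul_prod_one_sub (f := fun I => ((Ideal.absNorm I : ℕ) : ℂ) ^ (-s)) ?_ ?_
    (hζ_ser s hs).summable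
  · intro I J
    simp only [map_mul, Nat.cast_mul]
    rw [natCast_mul_natCast_cpow]
  · simp

lemma ne_zero_of_one_lt_re {s : ℂ} (hs : 1 < s.re) : ζK s ≠ 0 := by
  intro h
  have := tendsto_mul_prod hζ_ser hs
  simp only [h, zero_mul] at this
  exact zero_ne_one (tendsto_nhds_unique tendsto_const_nhds this)

lemma one_le_norm_comb {x : ℝ} (hx : 1 < x) (t : ℝ) :
    1 ≤ ‖ζK x ^ 3 * ζK (x + t * I) ^ 4 * ζK (x + 2 * t * I)‖ := by
  have h0 := tendsto_mul_prod hζ_ser (s := x) (by simpa using hx)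
  have h1 := tendsto_mul_prod hζ_ser (s := x + t * I) (by simpa using hx)
  have h2 := tendsto_mul_prod hζ_ser (s := x + 2 * t * I) (by simpa using hx)
  have h := (((h0.pow 3).mul (h1.pow 4)).mul h2).norm
  simp only [one_pow, mul_one, norm_one] at h
  refine le_of_tendsto h (Eventually.of_forall fun S => ?_)
  have key : ‖∏ P ∈ S, ((1 - ((Ideal.absNorm P.asIdeal : ℕ) : ℂ) ^ (-(x : ℂ))) ^ 3 *
      (1 - ((Ideal.absNorm P.asIdeal : ℕ) : ℂ) ^ (-(x + t * I : ℂ))) ^ 4 *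
      (1 - ((Ideal.absNorm P.asIdeal : ℕ) : ℂ) ^ (-(x + 2 * t * I : ℂ))))‖ ≤ 1 := by
    rw [norm_prod]
    refine Finset.prod_le_one (fun _ _ => norm_nonneg _) fun P _ => ?_
    set n : ℕ := Ideal.absNorm P.asIdeal with hn
    have hn0 : n ≠ 0 := by rw [hn, Ne, Ideal.absNorm_eq_zero_iff]; exact P.ne_bot
    have hn1 : n ≠ 1 := by rw [hn, Ne, Ideal.absNorm_eq_one_iff]; exact P.isPrime.ne_top
    have hn2 : 1 < n := by omega
    have hnp : (0 : ℝ) < n := by positivity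
    have hnC : (n : ℂ) ≠ 0 := by exact_mod_cast hn0
    have hlt : (n : ℝ) ^ (-x) < 1 :=
      Real.rpow_lt_one_of_one_lt_of_neg (by exact_mod_cast hn2) (by linarith)
    have hz : ‖(n : ℂ) ^ (-(t * I : ℂ))‖ = 1 := by
      rw [← ofReal_natCast, norm_cpow_eq_rpow_re_of_pos hnp]
      simp
    have := norm_one_sub_comb_le_one (a := (n : ℝ) ^ (-x)) (by positivity) hlt hz
    have e0 : (((n : ℝ) ^ (-x) : ℝ) : ℂ) = (n : ℂ) ^ (-(x : ℂ)) := by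
      rw [ofReal_cpow hnp.le]; simp
    have e1 : (n : ℂ) ^ (-(x + t * I : ℂ)) = (n : ℂ) ^ (-(x : ℂ)) * (n : ℂ) ^ (-(t * I : ℂ)) := by
      rw [← cpow_add _ _ hnC]; congr 1; ring
    have e2 : (n : ℂ) ^ (-(x + 2 * t * I : ℂ)) =
        (n : ℂ) ^ (-(x : ℂ)) * ((n : ℂ) ^ (-(t * I : ℂ))) ^ 2 := by
      rw [sq, ← cpow_add _ _ hnC, ← cpow_add _ _ hnC]; congr 1; ring
    rw [e1, e2, ← e0]
    exact this
  rw [Finset.prod_mul_distrib, Finset.prod_mul_distrib, Finset.prod_pow, Finset.prod_pow] at key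
  refine le_trans (le_of_eq ?_) (mul_le_of_le_one_right
    (norm_nonneg (ζK x ^ 3 * ζK (x + t * I) ^ 4 * ζK (x + 2 * t * I))) key)
  rw [← norm_mul]
  congr 1
  ring

include hζ_an

/-- Non-vanishing on the line `re s = 1`. -/
lemma ne_zero_of_re_eq_one
    (hζ_pole : ∃ A : ℂ, A ≠ 0 ∧ Tendsto (fun s : ℂ => (s - 1) * ζK s) (𝓝[≠] (1 : ℂ)) (𝓝 A))
    {t : ℝ} (ht : t ≠ 0) : ζK (1 + t * I) ≠ 0 := by
  intro hz
  obtain ⟨A, -, hA⟩ := hζ_pole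
  have hne : ∀ u : ℝ, u ≠ 0 → (1 + u * I : ℂ) ≠ 1 := by
    intro u hu h
    apply hu
    have := congrArg im h
    simpa using this
  have hx : Tendsto (fun x : ℝ => (x : ℂ)) (𝓝[>] 1) (𝓝[≠] 1) := by
    refine tendsto_nhdsWithin_iff.mpr ⟨?_, ?_⟩
    · have := (continuous_ofReal.tendsto (1 : ℝ)).mono_left (nhdsWithin_le_nhds (s := Set.Ioi 1))
      simpa using this
    · filter_upwards [self_mem_nhdsWithin] with x hx
      have : (1 : ℝ) < x := hx
      simp only [Set.mem_compl_iff, Set.mem_singleton_iff, ofReal_eq_one]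
      exact this.ne'
  have hx0 : Tendsto (fun x : ℝ => (x : ℂ)) (𝓝[>] 1) (𝓝 1) := hx.mono_right nhdsWithin_le_nhds
  have h0 := hA.comp hx
  have h1 : Tendsto (fun x : ℝ => ζK (x + t * I) / ((x : ℂ) - 1)) (𝓝[>] 1)
      (𝓝 (deriv ζK (1 + t * I))) := by
    have hd := ((hζ_an _ (hne t ht)).hasDerivAt).tendsto_slope
    have hsh : Tendsto (fun x : ℝ => (x : ℂ) + t * I) (𝓝[>] 1) (𝓝[≠] (1 + t * I)) := by
      refine tendsto_nhdsWithin_iff.mpr ⟨hx0.add_const _, ?_⟩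
      filter_upwards [self_mem_nhdsWithin] with x hx
      have : (1 : ℝ) < x := hx
      simp only [Set.mem_compl_iff, Set.mem_singleton_iff, add_left_inj, ofReal_eq_one]
      exact this.ne'
    refine (hd.comp hsh).congr fun x => ?_
    simp [slope, hz]
    ring
  have h2 : Tendsto (fun x : ℝ => ζK (x + 2 * t * I)) (𝓝[>] 1) (𝓝 (ζK (1 + 2 * t * I))) := by
    have hc : ContinuousAt ζK (1 + 2 * t * I) := by
      have := (hζ_an _ (hne (2 * t) (by positivity))).continuousAt
      simpa using this
    exact hc.tendsto.comp (hx0.add_const _)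
  have h3 : Tendsto (fun x : ℝ => (x : ℂ) - 1) (𝓝[>] 1) (𝓝 0) := by
    simpa using hx0.sub_const 1
  have h := ((((h0.pow 3).mul (h1.pow 4)).mul h2).mul h3).norm
  simp only [mul_zero, norm_zero] at h
  have hle : (1 : ℝ) ≤ 0 := by
    refine ge_of_tendsto h ?_
    filter_upwards [self_mem_nhdsWithin] with x hx
    have hx' : (1 : ℝ) < x := hx
    have hx1 : (x : ℂ) - 1 ≠ 0 := by
      rw [sub_ne_zero, Ne, ofReal_eq_one]; exact hx'.ne'
    have := one_le_norm_comb hζ_ser hx' t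
    refine this.trans (le_of_eq (congrArg norm ?_))
    change _ = (((x : ℂ) - 1) * ζK x) ^ 3 * (ζK (x + t * I) / ((x : ℂ) - 1)) ^ 4 *
      ζK (x + 2 * t * I) * ((x : ℂ) - 1)
    field_simp
  linarith

end DedekindEuler

namespace GaussPoisson

open MeasureTheory Filter Topology Complex UnitAddTorus Matrix

variable {ι : Type*} [Fintype ι]

/-- The integer vector `m` seen as a real vector. -/
def toReal (m : ι → ℤ) : ι → ℝ := fun i => (m i : ℝ)

lemma norm_toReal (m : ι → ℤ) : ‖toReal m‖ = ‖m‖ := by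
  simp only [toReal, Pi.norm_def, nnnorm]
  congr 2

lemma summable_norm_inv_pow (n : ℕ) (hn : Fintype.card ι < n) :
    Summable fun m : ι → ℤ => ‖m‖⁻¹ ^ n := by
  classical
  set b := Pi.basisFun ℝ ι
  let L := Submodule.span ℤ (Set.range b)
  have hL : Summable fun z : L => ‖z‖⁻¹ ^ n := by
    refine ZLattice.summable_norm_pow_inv L n ?_
    have : Module.finrank ℤ L = Module.finrank ℝ (ι → ℝ) := ZLattice.rank ℝ L
    rw [this]
    simpa using hn
  let e : (ι → ℤ) → L := fun m => ⟨toReal m, by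
    refine (b.mem_span_iff_repr_mem ℤ _).2 fun i => ⟨m i, ?_⟩
    simp [b, toReal]⟩
  have he : Function.Injective e := by
    intro m m' h
    have h1 : toReal m = toReal m' := congrArg Subtype.val h
    ext i
    have := congrFun h1 i
    simpa [toReal] using this
  have := hL.comp_injective he
  refine this.congr fun m => ?_
  simp only [Function.comp, e]
  rw [← norm_toReal]
  rfl

lemma one_le_norm_of_ne_zero {m : ι → ℤ} (hm : m ≠ 0) : 1 ≤ ‖m‖ := by
  obtain ⟨i, hi⟩ := Function.ne_iff.1 hm
  refine le_trans ?_ (norm_le_pi_norm m i)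
  rw [Int.norm_eq_abs]
  have : 1 ≤ |m i| := Int.one_le_abs hi
  exact_mod_cast this

lemma summable_exp_neg_norm_sq {a : ℝ} (ha : 0 < a) :
    Summable fun m : ι → ℤ => Real.exp (-(a * ‖m‖ ^ 2)) := by
  set n := Fintype.card ι + 1
  have h := (summable_norm_inv_pow (ι := ι) (2 * n) (by omega)).mul_left (n.factorial / a ^ n : ℝ)
  refine Summable.of_norm_bounded_eventually h ?_
  rw [Filter.eventually_cofinite]
  refine Set.Finite.subset (Set.finite_singleton 0) fun m hm => ?_
  by_contra hm0
  refine hm ?_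
  have h1 := one_le_norm_of_ne_zero hm0
  have h2 := Real.pow_div_factorial_le_exp (a * ‖m‖ ^ 2) (by positivity) n
  rw [Real.norm_of_nonneg (Real.exp_nonneg _), Real.exp_neg]
  have h3 : 0 < (a * ‖m‖ ^ 2) ^ n / n.factorial := by positivity
  refine (inv_anti₀ h3 h2).trans (le_of_eq ?_)
  rw [inv_div, mul_pow, ← pow_mul, inv_pow]
  field_simp

/-- The half-open unit box with corner `m`. -/
def box (m : ι → ℤ) : Set (ι → ℝ) := {x | ∀ i, x i ∈ Set.Ioc (m i : ℝ) (m i + 1)}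

lemma mem_box_iff {m : ι → ℤ} {x : ι → ℝ} : x ∈ box m ↔ ∀ i, m i = ⌈x i⌉ - 1 := by
  refine forall_congr' fun i => ?_
  rw [eq_sub_iff_add_eq, eq_comm, Int.ceil_eq_iff]
  simp [Set.mem_Ioc]

lemma measurableSet_box (m : ι → ℤ) : MeasurableSet (box m) :=
  MeasurableSet.univ_pi' fun _ => measurableSet_Ioc

lemma iUnion_box : ⋃ m, box (ι := ι) m = Set.univ := by
  refine Set.eq_univ_of_forall fun x => Set.mem_iUnion.2 ⟨fun i => ⌈x i⌉ - 1, ?_⟩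
  rw [mem_box_iff]
  simp

lemma disjoint_box : Pairwise (Function.onFun Disjoint (box (ι := ι))) := by
  intro m m' h
  refine Set.disjoint_left.2 fun x hx hx' => h ?_
  rw [mem_box_iff] at hx hx'
  ext i
  rw [hx, hx']

lemma hasSum_integral_box {f : (ι → ℝ) → ℂ} (hf : Integrable f) :
    HasSum (fun m : ι → ℤ => ∫ x in box 0, f (x + toReal m)) (∫ x, f x) := by
  have h := hasSum_integral_iUnion (f := f) (μ := volume) (measurableSet_box (ι := ι))
    disjoint_box (by rw [iUnion_box]; exact hf.integrableOn)
  rw [iUnion_box, setIntegral_univ] at h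
  convert! h using 2
  rename_i m
  have h1 := (measurePreserving_add_right (volume : Measure (ι → ℝ)) (toReal m)).setIntegral_preimage_emb
    (measurableEmbedding_addRight _) f (box m)
  rw [← h1]
  congr 2
  ext x
  simp only [box, toReal, Set.mem_ofPred_eq, Set.mem_Ioc, Set.mem_preimage, Pi.add_apply,
    Pi.zero_apply, Int.cast_zero]
  refine forall_congr' fun i => and_congr ?_ ?_ <;> constructor <;> intro h <;> linarith

lemma mFourier_coe (n : ι → ℤ) (x : ι → ℝ) :
    mFourier n (fun i => (x i : UnitAddCircle)) = cexp (2 * Real.pi * I * ∑ i, (n i : ℂ) * (x i : ℂ)) := by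
  simp only [mFourier, ContinuousMap.coe_mk, fourier_coe_apply, ← Complex.exp_sum, Finset.mul_sum]
  congr 1
  refine Finset.sum_congr rfl fun i _ => ?_
  simp
  ring

/-- Poisson summation on `ℤ ^ ι`. -/
theorem poisson {f : (ι → ℝ) → ℂ} (hc : Continuous f) (hf : Integrable f)
    (hloc : ∀ R : ℝ, ∃ u : (ι → ℤ) → ℝ, Summable u ∧ ∀ x, ‖x‖ ≤ R → ∀ m, ‖f (x + toReal m)‖ ≤ u m)
    (hhat : Summable fun n : ι → ℤ => ∫ x, cexp (-(2 * Real.pi * I * ∑ i, (n i : ℂ) * (x i : ℂ))) * f x) :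
    ∑' m, f (toReal m) = ∑' n : ι → ℤ, ∫ x, cexp (-(2 * Real.pi * I * ∑ i, (n i : ℂ) * (x i : ℂ))) * f x := by
  set F : (ι → ℝ) → ℂ := fun x => ∑' m, f (x + toReal m) with hF
  have hFc : Continuous F := by
    rw [continuous_iff_continuousAt]
    intro x₀
    obtain ⟨u, hu, hub⟩ := hloc (‖x₀‖ + 1)
    have h : ContinuousOn F (Metric.closedBall 0 (‖x₀‖ + 1)) := by
      refine continuousOn_tsum (fun m => (hc.comp (by fun_prop)).continuousOn) hu ?_
      intro m x hx
      exact hub x (by simpa using hx) m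
    refine h.continuousAt (Metric.closedBall_mem_nhds_of_mem ?_)
    simp
  have hFper : ∀ x m, F (x + toReal m) = F x := by
    intro x m
    simp only [hF]
    rw [← (Equiv.addLeft m).tsum_eq (fun k => f (x + toReal k))]
    refine tsum_congr fun k => ?_
    congr 1
    ext i
    simp [toReal]
    ring
  let q : (ι → ℝ) → UnitAddTorus ι := Pi.map fun _ => (fun x : ℝ => (x : UnitAddCircle))
  have hq : IsOpenQuotientMap q := by
    refine IsOpenQuotientMap.piMap fun i => ?_
    exact QuotientAddGroup.isOpenQuotientMap_mk
  have hqF : ∀ x y, q x = q y → F x = F y := by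
    intro x y hxy
    have : ∀ i, ∃ k : ℤ, x i = y i + k := by
      intro i
      have h := congrFun hxy i
      simp only [q, Pi.map] at h
      have h2 : ((x i - y i : ℝ) : UnitAddCircle) = 0 := by
        rw [AddCircle.coe_sub, h, sub_self]
      obtain ⟨k, hk⟩ := (AddCircle.coe_eq_zero_iff (p := (1 : ℝ))).1 h2
      refine ⟨k, ?_⟩
      simp at hk
      linarith
    choose k hk using this
    rw [← hFper y k]
    congr 1
    ext i
    simp [toReal, hk]
  let Ft : C(UnitAddTorus ι, ℂ) := Topology.IsQuotientMap.lift (f := ⟨q, hq.continuous⟩)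
    hq.isQuotientMap ⟨F, hFc⟩ (fun x y h => hqF x y h)
  have hFt : ∀ x, Ft (q x) = F x := fun x => by
    have := Topology.IsQuotientMap.lift_comp (f := ⟨q, hq.continuous⟩) hq.isQuotientMap
      (⟨F, hFc⟩ : C(ι → ℝ, ℂ)) (fun x y h => hqF x y h)
    exact DFunLike.congr_fun this x
  have hcoeff : ∀ n, mFourierCoeff Ft n =
      ∫ x, cexp (-(2 * Real.pi * I * ∑ i, (n i : ℂ) * (x i : ℂ))) * f x := by
    intro n
    have h_int : Integrable fun x : ι → ℝ => cexp (-(2 * Real.pi * I * ∑ i, (n i : ℂ) * (x i : ℂ))) * f x := by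
      refine hf.bdd_mul (c := 1) (Continuous.aestronglyMeasurable (by fun_prop)) (Eventually.of_forall fun x => ?_)
      rw [Complex.norm_exp]
      apply le_of_eq
      rw [Real.exp_eq_one_iff]
      have : (-(2 * Real.pi * I * ∑ i, (n i : ℂ) * x i)) =
          ((-(2 * Real.pi * ∑ i, (n i : ℝ) * x i) : ℝ) : ℂ) * I := by push_cast; ring
      rw [this]; simp
    rw [mFourierCoeff_eq_integral _ n 0, ← (hasSum_integral_box h_int).tsum_eq]
    have hexp : ∀ (x : ι → ℝ) (m : ι → ℤ),
        cexp (-(2 * Real.pi * I * ∑ i, (n i : ℂ) * ((x + toReal m) i : ℂ))) =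
        mFourier (-n) (fun i => (x i : UnitAddCircle)) := by
      intro x m
      rw [mFourier_coe, Complex.exp_eq_exp_iff_exists_int]
      refine ⟨-∑ i, n i * m i, ?_⟩
      simp only [toReal, Pi.add_apply, Pi.neg_apply]
      push_cast
      simp only [mul_add, Finset.sum_add_distrib, neg_mul, Finset.sum_neg_distrib]
      ring
    obtain ⟨u, hu, hub⟩ := hloc 1
    have hbox : {x : ι → ℝ | ∀ i, x i ∈ Set.Ioc ((0 : ι → ℝ) i) ((0 : ι → ℝ) i + 1)} = box 0 := by
      ext x; simp [box]
    have hboxvol : volume (box (0 : ι → ℤ)) < ⊤ := by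
      have : box (0 : ι → ℤ) ⊆ Metric.closedBall 0 1 := by
        intro x hx
        simp only [box, Set.mem_ofPred_eq, Pi.zero_apply, Int.cast_zero, zero_add, Set.mem_Ioc] at hx
        simp only [mem_closedBall_zero_iff]
        refine (pi_norm_le_iff_of_nonneg zero_le_one).2 fun i => ?_
        rw [Real.norm_of_nonneg (hx i).1.le]
        exact (hx i).2
      exact (measure_mono this).trans_lt measure_closedBall_lt_top
    have hbox1 : ∀ x ∈ box (0 : ι → ℤ), ‖x‖ ≤ 1 := by
      intro x hx
      simp only [box, Set.mem_ofPred_eq, Pi.zero_apply, Int.cast_zero, zero_add, Set.mem_Ioc] at hx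
      refine (pi_norm_le_iff_of_nonneg zero_le_one).2 fun i => ?_
      rw [Real.norm_of_nonneg (hx i).1.le]
      exact (hx i).2
    rw [hbox]
    have hnorm : ∀ x : ι → ℝ, ‖mFourier (-n) (fun i => (x i : UnitAddCircle))‖ ≤ 1 := by
      intro x
      refine ((mFourier (-n)).norm_coe_le_norm _).trans ?_
      rw [mFourier_norm]
    have hsum : ∫ x in box (0 : ι → ℤ), ∑' m, mFourier (-n) (fun i => (x i : UnitAddCircle)) *
        f (x + toReal m) = ∑' m : ι → ℤ, ∫ x in box (0 : ι → ℤ),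
          mFourier (-n) (fun i => (x i : UnitAddCircle)) * f (x + toReal m) := by
      refine (hasSum_integral_of_dominated_convergence (μ := volume.restrict (box (0 : ι → ℤ)))
        (bound := fun m _ => u m) ?_ ?_ ?_ ?_ ?_).tsum_eq.symm
      · intro m
        refine Continuous.aestronglyMeasurable ?_
        refine Continuous.mul ?_ (hc.comp (by fun_prop))
        exact (mFourier (-n)).continuous.comp (continuous_pi fun i =>
          (AddCircle.continuous_mk' 1).comp (continuous_apply i))
      · intro m
        refine (ae_restrict_iff' (measurableSet_box _)).2 (Eventually.of_forall fun x hx => ?_)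
        rw [norm_mul]
        calc _ ≤ 1 * u m := mul_le_mul (hnorm x) (hub x (hbox1 x hx) m) (norm_nonneg _) zero_le_one
          _ = u m := one_mul _
      · exact Eventually.of_forall fun _ => hu
      · have : IsFiniteMeasure (volume.restrict (box (0 : ι → ℤ))) := ⟨by simpa using hboxvol⟩
        exact integrable_const _
      · refine (ae_restrict_iff' (measurableSet_box _)).2 (Eventually.of_forall fun x hx => ?_)
        refine Summable.hasSum ?_
        refine Summable.mul_left _ (Summable.of_norm_bounded hu fun m => hub x (hbox1 x hx) m)
    have e1 : ∫ x in box (0 : ι → ℤ), mFourier (-n) (fun i => (x i : UnitAddCircle)) •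
        Ft (fun i => (x i : UnitAddCircle)) = ∫ x in box (0 : ι → ℤ),
          ∑' m, mFourier (-n) (fun i => (x i : UnitAddCircle)) * f (x + toReal m) := by
      congr 1
      ext x
      rw [tsum_mul_left]
      congr 1
      exact hFt x
    rw [e1, hsum]
    refine tsum_congr fun m => ?_
    congr 1
    ext x
    rw [← hexp x m]
  have hsumm : Summable (mFourierCoeff Ft) := by
    simpa only [← hcoeff] using hhat
  have h := (hasSum_mFourier_series_apply_of_summable hsumm (q 0)).tsum_eq
  rw [hFt] at h
  have h0 : F 0 = ∑' m, f (toReal m) := by simp [hF]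
  rw [← h0, ← h]
  refine tsum_congr fun n => ?_
  have : mFourier n (q 0) = 1 := by
    have e : q 0 = fun i => ((0 : ι → ℝ) i : UnitAddCircle) := rfl
    rw [e, mFourier_coe]
    simp
  rw [this, hcoeff]
  simp

variable [DecidableEq ι]

lemma exists_factor {G : Matrix ι ι ℝ} (hG : G.PosDef) :
    ∃ B : Matrix ι ι ℝ, B.det ≠ 0 ∧ |B.det| = √G.det ∧ Bᵀ * B = G := by
  open scoped MatrixOrder in
  have h := CFC.sqrt_mul_sqrt_self G hG.posSemidef.nonneg
  have h2 : (CFC.sqrt G).PosSemidef := (CFC.sqrt_nonneg G).posSemidef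
  have h3 : (CFC.sqrt G)ᵀ = CFC.sqrt G := by
    have := h2.isHermitian
    simpa [Matrix.IsHermitian, Matrix.conjTranspose_eq_transpose_of_trivial] using this
  have h4 : (CFC.sqrt G).det * (CFC.sqrt G).det = G.det := by rw [← Matrix.det_mul, h]
  refine ⟨CFC.sqrt G, ?_, ?_, by rw [h3, h]⟩
  · intro h0
    rw [h0] at h4
    have := hG.det_pos
    simp at h4
    linarith
  · rw [← h4, Real.sqrt_mul_self_eq_abs]

lemma dot_factor (B : Matrix ι ι ℝ) (x : ι → ℝ) :
    x ⬝ᵥ ((Bᵀ * B) *ᵥ x) = ∑ i, (B *ᵥ x) i ^ 2 := by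
  rw [← Matrix.mulVec_mulVec, Matrix.dotProduct_mulVec, Matrix.vecMul_transpose, dotProduct]
  simp [sq]

lemma exists_lower {G : Matrix ι ι ℝ} (hG : G.PosDef) :
    ∃ c > 0, ∀ x : ι → ℝ, c * ‖x‖ ^ 2 ≤ x ⬝ᵥ (G *ᵥ x) := by
  obtain ⟨B, hB, -, rfl⟩ := exists_factor hG
  let L := LinearMap.toContinuousLinearMap (Matrix.toLin' B⁻¹)
  refine ⟨((‖L‖ + 1) ^ 2)⁻¹, by positivity, fun x => ?_⟩
  rw [dot_factor, inv_mul_le_iff₀ (by positivity)]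
  have h1 : ‖x‖ ≤ (‖L‖ + 1) * ‖B *ᵥ x‖ := by
    have h : L (B *ᵥ x) = x := by
      simp only [L, LinearMap.coe_toContinuousLinearMap', Matrix.toLin'_apply,
        Matrix.mulVec_mulVec]
      rw [Matrix.nonsing_inv_mul _ (Ne.isUnit hB), Matrix.one_mulVec]
    calc ‖x‖ = ‖L (B *ᵥ x)‖ := by rw [h]
      _ ≤ ‖L‖ * ‖B *ᵥ x‖ := L.le_opNorm _
      _ ≤ _ := by gcongr; linarith
  have h2 : ‖B *ᵥ x‖ ^ 2 ≤ ∑ i, (B *ᵥ x) i ^ 2 := by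
    rw [← Real.le_sqrt (norm_nonneg _) (Finset.sum_nonneg fun _ _ => sq_nonneg _)]
    refine (pi_norm_le_iff_of_nonneg (Real.sqrt_nonneg _)).2 fun i => ?_
    refine Real.le_sqrt_of_sq_le ?_
    rw [Real.norm_eq_abs, sq_abs]
    exact Finset.single_le_sum (f := fun i => (B *ᵥ x) i ^ 2) (fun _ _ => sq_nonneg _)
      (Finset.mem_univ i)
  calc ‖x‖ ^ 2 ≤ ((‖L‖ + 1) * ‖B *ᵥ x‖) ^ 2 := by gcongr
    _ = (‖L‖ + 1) ^ 2 * ‖B *ᵥ x‖ ^ 2 := by ring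
    _ ≤ _ := by gcongr

lemma integral_gauss {B : Matrix ι ι ℝ} (hB : B.det ≠ 0) (n : ι → ℤ) :
    ∫ x : ι → ℝ, cexp (-(2 * Real.pi * I * ∑ i, (n i : ℂ) * (x i : ℂ))) *
      (Real.exp (-(Real.pi * (x ⬝ᵥ ((Bᵀ * B) *ᵥ x)))) : ℝ) =
    ((|B.det|⁻¹ * Real.exp (-(Real.pi * (toReal n ⬝ᵥ ((B⁻¹ * B⁻¹ᵀ) *ᵥ toReal n)))) : ℝ) : ℂ) := by
  set c : ι → ℂ := fun i => -(2 * Real.pi * I) * ((B⁻¹ᵀ *ᵥ toReal n) i : ℝ) with hc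
  set g : (ι → ℝ) → ℂ := fun y => cexp (-(Real.pi : ℂ) * ∑ i, (y i : ℂ) ^ 2 + ∑ i, c i * y i)
    with hg
  have h1 : ∀ x : ι → ℝ, cexp (-(2 * Real.pi * I * ∑ i, (n i : ℂ) * (x i : ℂ))) *
      (Real.exp (-(Real.pi * (x ⬝ᵥ ((Bᵀ * B) *ᵥ x)))) : ℝ) = g (Matrix.toLin' B x) := by
    intro x
    simp only [hg, Matrix.toLin'_apply]
    rw [dot_factor, Complex.ofReal_exp, ← Complex.exp_add]
    congr 1
    have h2 : ∑ i, (n i : ℂ) * (x i : ℂ) =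
        ∑ i, (((B⁻¹ᵀ *ᵥ toReal n) i : ℝ) : ℂ) * ((B *ᵥ x) i : ℝ) := by
      have : toReal n ⬝ᵥ x = (B⁻¹ᵀ *ᵥ toReal n) ⬝ᵥ (B *ᵥ x) := by
        rw [Matrix.dotProduct_mulVec, Matrix.mulVec_transpose, Matrix.vecMul_vecMul,
          Matrix.nonsing_inv_mul _ (Ne.isUnit hB), Matrix.vecMul_one]
      simp only [dotProduct, toReal] at this
      exact_mod_cast this
    rw [h2, hc]
    simp only [mul_assoc, ← Finset.mul_sum]
    push_cast
    ring
  have hcont : Continuous g := by fun_prop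
  have hm : Measurable (Matrix.toLin' B) :=
    (LinearMap.continuous_of_finiteDimensional (Matrix.toLin' B)).measurable
  simp_rw [h1]
  rw [← integral_map hm.aemeasurable hcont.aestronglyMeasurable,
    Real.map_matrix_volume_pi_eq_smul_volume_pi hB, integral_smul_measure, hg,
    GaussianFourier.integral_cexp_neg_mul_sum_add (by simpa using Real.pi_pos)]
  have hpi : (Real.pi : ℂ) ≠ 0 := by exact_mod_cast Real.pi_ne_zero
  rw [div_self hpi, Complex.one_cpow, one_mul, ENNReal.toReal_ofReal (abs_nonneg _), abs_inv]
  have h3 : (∑ i, c i ^ 2) / (4 * Real.pi) =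
      ((-(Real.pi * (toReal n ⬝ᵥ ((B⁻¹ * B⁻¹ᵀ) *ᵥ toReal n))) : ℝ) : ℂ) := by
    have := dot_factor B⁻¹ᵀ (toReal n)
    rw [Matrix.transpose_transpose] at this
    rw [this, hc]
    simp only [mul_pow, ← Finset.mul_sum, neg_sq, I_sq]
    push_cast
    field_simp
    ring
  rw [h3]
  simp

lemma summable_of_lower {Q : (ι → ℝ) → ℝ} {c : ℝ} (hc : 0 < c) (h : ∀ x, c * ‖x‖ ^ 2 ≤ Q x) :
    Summable fun m : ι → ℤ => Real.exp (-(Real.pi * Q (toReal m))) := by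
  refine Summable.of_nonneg_of_le (fun _ => Real.exp_nonneg _) (fun m => ?_)
    (summable_exp_neg_norm_sq (ι := ι) (mul_pos Real.pi_pos hc))
  rw [Real.exp_le_exp, ← norm_toReal]
  nlinarith [h (toReal m), Real.pi_pos]

theorem gauss_poisson {G H : Matrix ι ι ℝ} (hG : G.PosDef) (hGH : G * H = 1) :
    ∑' m : ι → ℤ, Real.exp (-(Real.pi * (toReal m ⬝ᵥ (G *ᵥ toReal m)))) =
      (√G.det)⁻¹ * ∑' m : ι → ℤ, Real.exp (-(Real.pi * (toReal m ⬝ᵥ (H *ᵥ toReal m)))) := by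
  obtain ⟨c, hc, hlow⟩ := exists_lower hG
  obtain ⟨B, hB, hdet, hBG⟩ := exists_factor hG
  have hH : H = G⁻¹ := (Matrix.inv_eq_right_inv hGH).symm
  have hHB : H = B⁻¹ * B⁻¹ᵀ := by
    rw [hH, ← hBG, Matrix.mul_inv_rev, Matrix.transpose_nonsing_inv]
  have hHpos : H.PosDef := hH ▸ hG.inv
  obtain ⟨c', hc', hlow'⟩ := exists_lower hHpos
  have hsum' := summable_of_lower hc' hlow'
  set f : (ι → ℝ) → ℂ := fun x => (Real.exp (-(Real.pi * (x ⬝ᵥ (G *ᵥ x)))) : ℝ) with hf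
  have hcont : Continuous f := by
    refine Complex.continuous_ofReal.comp (Real.continuous_exp.comp (Continuous.neg
      (continuous_const.mul ?_)))
    exact Continuous.dotProduct continuous_id (Continuous.matrix_mulVec continuous_const
      continuous_id)
  have hfint : Integrable f := by
    have h := GaussianFourier.integrable_cexp_neg_mul_sum_add (ι := ι) (b := ((Real.pi * c /
      (Fintype.card ι + 1) : ℝ) : ℂ)) (by
        rw [Complex.ofReal_re]; exact div_pos (mul_pos Real.pi_pos hc) (by positivity)) 0
    refine h.mono hcont.aestronglyMeasurable (Eventually.of_forall fun x => ?_)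
    rw [hf, Complex.norm_real, Real.norm_of_nonneg (Real.exp_nonneg _), Complex.norm_exp]
    apply Real.exp_le_exp.2
    have e : (-((Real.pi * c / (Fintype.card ι + 1) : ℝ) : ℂ) * ∑ i, (x i : ℂ) ^ 2 +
        ∑ i, (0 : ι → ℂ) i * x i) = ((-(Real.pi * c / (Fintype.card ι + 1) * ∑ i, x i ^ 2) : ℝ) : ℂ) := by
      push_cast; simp
    rw [e, Complex.ofReal_re]
    have h1 : ∑ i, x i ^ 2 ≤ (Fintype.card ι + 1) * ‖x‖ ^ 2 := by
      calc ∑ i, x i ^ 2 ≤ ∑ _i : ι, ‖x‖ ^ 2 := by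
            refine Finset.sum_le_sum fun i _ => ?_
            rw [← sq_abs]
            gcongr
            exact norm_le_pi_norm x i
        _ = Fintype.card ι * ‖x‖ ^ 2 := by simp
        _ ≤ _ := by gcongr; linarith
    have h2 := hlow x
    have h3 : Real.pi * c / (Fintype.card ι + 1) * ∑ i, x i ^ 2 ≤ Real.pi * (c * ‖x‖ ^ 2) := by
      calc _ ≤ Real.pi * c / (Fintype.card ι + 1) * ((Fintype.card ι + 1) * ‖x‖ ^ 2) := by gcongr
        _ = _ := by field_simp
    nlinarith [Real.pi_pos]
  have h_int : ∀ n : ι → ℤ, ∫ x : ι → ℝ, cexp (-(2 * Real.pi * I * ∑ i, (n i : ℂ) * (x i : ℂ))) *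
      f x = (((√G.det)⁻¹ * Real.exp (-(Real.pi * (toReal n ⬝ᵥ (H *ᵥ toReal n)))) : ℝ) : ℂ) := by
    intro n
    rw [hHB, ← hdet, ← integral_gauss hB n, hf, hBG]
  have h := poisson hcont hfint (fun R => ?_) ?_
  · simp_rw [h_int, hf] at h
    rw [← Complex.ofReal_tsum, ← Complex.ofReal_tsum] at h
    rw [← tsum_mul_left]
    exact_mod_cast h
  · refine ⟨fun m => Real.exp (Real.pi * c * R ^ 2) * Real.exp (-(Real.pi * c / 2 * ‖m‖ ^ 2)),
      (summable_exp_neg_norm_sq (by have := Real.pi_pos; positivity)).mul_left _, fun x hx m => ?_⟩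
    rw [hf, Complex.norm_real, Real.norm_of_nonneg (Real.exp_nonneg _)]
    beta_reduce
    rw [← Real.exp_add]
    apply Real.exp_le_exp.2
    have h1 := hlow (x + toReal m)
    have h2 : ‖m‖ ≤ ‖x + toReal m‖ + R := by
      rw [← norm_toReal]
      calc ‖toReal m‖ = ‖(x + toReal m) - x‖ := by congr 1; abel
        _ ≤ ‖x + toReal m‖ + ‖x‖ := norm_sub_le _ _
        _ ≤ _ := by gcongr
    have h3 : ‖m‖ ^ 2 ≤ 2 * ‖x + toReal m‖ ^ 2 + 2 * R ^ 2 := by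
      nlinarith [sq_nonneg (‖x + toReal m‖ - R), norm_nonneg m, norm_nonneg (x + toReal m)]
    have hpc := mul_pos Real.pi_pos hc
    nlinarith [Real.pi_pos]
  · simp_rw [h_int]
    exact Complex.ofRealCLM.summable (hsum'.mul_left _)

end GaussPoisson

namespace NumberFieldTheta

open NumberField InfinitePlace GaussPoisson Matrix Module ComplexConjugate

open scoped Classical

variable {K : Type*} [Field K] [NumberField K] {ι : Type*} [Fintype ι]

/-- The weighted sum of squares of the conjugates of `x`. -/
noncomputable def q (c : InfinitePlace K → ℝ) (x : K) : ℝ :=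
  ∑ φ : K →+* ℂ, c (mk φ) * ‖φ x‖ ^ 2

lemma q_eq_sum_place (c : InfinitePlace K → ℝ) (x : K) :
    q c x = ∑ w : InfinitePlace K, mult w * (c w * w x ^ 2) := by
  classical
  rw [q, ← Finset.sum_fiberwise (s := Finset.univ) (g := fun φ : K →+* ℂ => mk φ)]
  refine Finset.sum_congr rfl fun w _ => ?_
  rw [← card_filter_mk_eq, ← nsmul_eq_mul]
  refine Finset.sum_eq_card_nsmul fun φ hφ => ?_
  rw [Finset.mem_filter] at hφ
  rw [← hφ.2, InfinitePlace.apply]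

/-- The element of `K` with integral coordinates `m` in the basis `b`. -/
noncomputable def elt (b : Basis ι ℚ K) (m : ι → ℤ) : K := ∑ i, m i • b i

lemma elt_injective (b : Basis ι ℚ K) : Function.Injective (elt b) := by
  intro m m' h
  have h1 : ∑ i, (m i : ℚ) • b i = ∑ i, (m' i : ℚ) • b i := by
    simpa [elt, Int.cast_smul_eq_zsmul] using h
  have h2 := (Fintype.linearIndependent_iff.1 b.linearIndependent) (fun i => (m i : ℚ) - m' i)
    (by simp [sub_smul, Finset.sum_sub_distrib, h1])
  ext i
  have := h2 i
  rw [sub_eq_zero] at this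
  exact_mod_cast this

lemma elt_zero (b : Basis ι ℚ K) : elt b 0 = 0 := by simp [elt]

lemma elt_ne_zero (b : Basis ι ℚ K) {m : ι → ℤ} (hm : m ≠ 0) : elt b m ≠ 0 := fun h =>
  hm (elt_injective b (by rw [h, elt_zero]))

/-- The Gram matrix of the form `q c` in the basis `b`. -/
noncomputable def gram (b : Basis ι ℚ K) (c : InfinitePlace K → ℝ) : Matrix ι ι ℝ :=
  Matrix.of fun i j => ∑ φ : K →+* ℂ, c (mk φ) * (conj (φ (b i)) * φ (b j)).re

/-- The matrix of conjugates of the basis `b`. -/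
noncomputable def conjMatrix (b : Basis ι ℚ K) : Matrix (K →+* ℂ) ι ℂ :=
  Matrix.of fun φ i => φ (b i)

lemma sum_im_eq_zero (c : InfinitePlace K → ℝ) (x y : K) :
    ∑ φ : K →+* ℂ, c (mk φ) * (conj (φ x) * φ y).im = 0 := by
  have h : ∑ φ : K →+* ℂ, c (mk φ) * (conj (φ x) * φ y).im =
      ∑ φ : K →+* ℂ, -(c (mk φ) * (conj (φ x) * φ y).im) := by
    refine Fintype.sum_equiv ((ComplexEmbedding.involutive_conjugate K).toPerm _) _ _
      fun φ => ?_
    rw [Function.Involutive.coe_toPerm, mk_conjugate_eq, ComplexEmbedding.conjugate_coe_eq,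
      ComplexEmbedding.conjugate_coe_eq, ← mul_neg, ← Complex.conj_im, map_mul]
    simp
  rw [Finset.sum_neg_distrib] at h
  linarith

omit [Fintype ι] in
lemma gram_map (b : Basis ι ℚ K) (c : InfinitePlace K → ℝ) :
    (gram b c).map (Complex.ofReal) =
      (conjMatrix b)ᴴ * Matrix.diagonal (fun φ => (c (mk φ) : ℂ)) * conjMatrix b := by
  ext i j
  rw [Matrix.mul_assoc, Matrix.mul_apply]
  simp only [Matrix.map_apply, gram, Matrix.of_apply, Matrix.conjTranspose_apply, conjMatrix,
    Matrix.diagonal_mul]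
  apply Complex.ext
  · rw [Complex.ofReal_re, Complex.re_sum]
    refine Finset.sum_congr rfl fun φ _ => ?_
    rw [mul_left_comm, Complex.re_ofReal_mul]
    rfl
  · rw [Complex.ofReal_im, Complex.im_sum, ← sum_im_eq_zero c (b i) (b j)]
    refine Finset.sum_congr rfl fun φ _ => ?_
    rw [mul_left_comm, Complex.im_ofReal_mul]
    rfl

lemma dot_gram (b : Basis ι ℚ K) (c : InfinitePlace K → ℝ) (x : ι → ℝ) :
    x ⬝ᵥ (gram b c *ᵥ x) = ∑ φ : K →+* ℂ, c (mk φ) * ‖∑ i, (x i : ℂ) * φ (b i)‖ ^ 2 := by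
  have h : ∀ z : ℂ, ‖z‖ ^ 2 = (conj z * z).re := by
    intro z
    rw [← Complex.normSq_eq_conj_mul_self, Complex.ofReal_re, Complex.normSq_eq_norm_sq]
  simp only [h, dotProduct, Matrix.mulVec, gram, Matrix.of_apply, map_sum, map_mul,
    Complex.conj_ofReal, Complex.re_sum, Finset.mul_sum, Finset.sum_mul]
  have e : ∀ i j : ι, ∀ φ : K →+* ℂ, x i * (c (mk φ) * (conj (φ (b i)) * φ (b j)).re * x j) =
      c (mk φ) * ((x i : ℂ) * conj (φ (b i)) * ((x j : ℂ) * φ (b j))).re := by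
    intro i j φ
    have : (x i : ℂ) * conj (φ (b i)) * ((x j : ℂ) * φ (b j)) =
        ((x i * x j : ℝ) : ℂ) * (conj (φ (b i)) * φ (b j)) := by push_cast; ring
    rw [this, Complex.re_ofReal_mul]
    ring
  simp only [e]
  rw [Finset.sum_congr rfl fun i _ => Finset.sum_comm, Finset.sum_comm]
  exact Finset.sum_congr rfl fun φ _ => Finset.sum_comm

lemma dot_gram_toReal (b : Basis ι ℚ K) (c : InfinitePlace K → ℝ) (m : ι → ℤ) :
    toReal m ⬝ᵥ (gram b c *ᵥ toReal m) = q c (elt b m) := by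
  rw [dot_gram, q]
  simp [toReal, elt]

/-- The dual basis for the trace form. -/
noncomputable def dualB (b : Basis ι ℚ K) : Basis ι ℚ K :=
  (Algebra.traceForm ℚ K).dualBasis (traceForm_nondegenerate ℚ K) b

lemma conjMatrix_dual (b : Basis ι ℚ K) : (conjMatrix b)ᵀ * conjMatrix (dualB b) = 1 := by
  ext i j
  have h := LinearMap.BilinForm.apply_dualBasis_right (traceForm_nondegenerate ℚ K)
    (Algebra.traceForm_isSymm ℚ) b i j
  rw [Algebra.traceForm_apply] at h
  have h2 := trace_eq_sum_embeddings (K := ℚ) (L := K) ℂ (x := b i * dualB b j)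
  rw [dualB, h] at h2
  rw [Matrix.mul_apply, Matrix.one_apply]
  simp only [Matrix.transpose_apply, conjMatrix, Matrix.of_apply]
  have h3 : ∑ φ : K →+* ℂ, φ (b i) * φ (dualB b j) = ∑ σ : K →ₐ[ℚ] ℂ, σ (b i * dualB b j) := by
    refine Fintype.sum_equiv (RingHom.equivRatAlgHom K ℂ) _ _ fun φ => ?_
    simp
  rw [h3]
  rw [dualB, ← h2]
  split_ifs <;> simp

lemma card_eq (b : Basis ι ℚ K) : Fintype.card ι = Fintype.card (K →+* ℂ) := by
  rw [Embeddings.card, Module.finrank_eq_card_basis b]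

lemma conjMatrix_dual' (b : Basis ι ℚ K) : conjMatrix (dualB b) * (conjMatrix b)ᵀ = 1 :=
  (Matrix.mul_eq_one_comm_of_card_eq _ _ _ (card_eq b)).1 (conjMatrix_dual b)

omit [Fintype ι] in
lemma ofReal_map_injective : Function.Injective
    (fun A : Matrix ι ι ℝ => A.map (Complex.ofReal)) := fun A B h => by
  ext i j
  exact Complex.ofReal_injective (congrFun (congrFun h i) j)

lemma gram_mul_gram_dual (b : Basis ι ℚ K) (c : InfinitePlace K → ℝ) (hc : ∀ w, 0 < c w) :
    gram b c * gram (dualB b) c⁻¹ = 1 := by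
  apply ofReal_map_injective
  have h1 : (gram (dualB b) c⁻¹).map Complex.ofReal = (conjMatrix (dualB b))ᵀ *
      Matrix.diagonal (fun φ => (c (mk φ) : ℂ)⁻¹) * (conjMatrix (dualB b)).map conj := by
    have h := gram_map (dualB b) c⁻¹
    have h2 := congrArg (fun A => A.map conj) h
    have e : ((gram (dualB b) c⁻¹).map Complex.ofReal).map conj =
        (gram (dualB b) c⁻¹).map Complex.ofReal := by
      ext i j; simp
    rw [e] at h2
    rw [h2, Matrix.map_mul, Matrix.map_mul]
    congr 2
    · ext i j; simp
    · ext i j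
      by_cases hij : i = j
      · subst hij; simp
      · simp [hij]
  have hm : (gram b c * gram (dualB b) c⁻¹).map Complex.ofReal =
      (gram b c).map Complex.ofReal * (gram (dualB b) c⁻¹).map Complex.ofReal :=
    Matrix.map_mul (f := Complex.ofRealHom)
  simp only [hm, h1, gram_map]
  have h3 : conjMatrix b * (conjMatrix (dualB b))ᵀ = 1 := by
    rw [← Matrix.transpose_inj, Matrix.transpose_mul, Matrix.transpose_transpose, conjMatrix_dual',
      Matrix.transpose_one]
  have h4 : Matrix.diagonal (fun φ : K →+* ℂ => (c (mk φ) : ℂ)) *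
      Matrix.diagonal (fun φ : K →+* ℂ => (c (mk φ) : ℂ)⁻¹) = 1 := by
    rw [Matrix.diagonal_mul_diagonal, ← Matrix.diagonal_one]
    congr 1
    ext φ
    exact mul_inv_cancel₀ (by exact_mod_cast (hc _).ne')
  have h5 : (conjMatrix b)ᴴ * (conjMatrix (dualB b)).map conj = 1 := by
    have := congrArg (fun A => A.map conj) (conjMatrix_dual b)
    simp only [Matrix.map_mul] at this
    have e : ((conjMatrix b)ᵀ).map conj = (conjMatrix b)ᴴ := by ext i j; simp
    rw [e] at this
    rw [this]
    ext i j
    by_cases hij : i = j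
    · subst hij; simp
    · simp [hij]
  calc _ = (conjMatrix b)ᴴ * (Matrix.diagonal (fun φ : K →+* ℂ => (c (mk φ) : ℂ)) *
        (conjMatrix b * (conjMatrix (dualB b))ᵀ) *
        Matrix.diagonal (fun φ : K →+* ℂ => (c (mk φ) : ℂ)⁻¹)) *
        (conjMatrix (dualB b)).map conj := by simp only [Matrix.mul_assoc]
    _ = 1 := by rw [h3, Matrix.mul_one, h4, Matrix.mul_one, h5]
    _ = _ := by
      ext i j
      by_cases hij : i = j
      · subst hij; simp
      · simp [hij]

lemma gram_posDef (b : Basis ι ℚ K) (c : InfinitePlace K → ℝ) (hc : ∀ w, 0 < c w) :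
    (gram b c).PosDef := by
  refine Matrix.PosDef.of_dotProduct_mulVec_pos ?_ fun x hx => ?_
  · ext i j
    simp only [Matrix.conjTranspose_apply, gram, Matrix.of_apply, star_trivial]
    refine Finset.sum_congr rfl fun φ _ => ?_
    congr 1
    rw [← Complex.conj_re, map_mul, Complex.conj_conj, mul_comm]
  · rw [star_trivial, dot_gram]
    have h0 : ∀ φ : K →+* ℂ, 0 ≤ c (mk φ) * ‖∑ i, (x i : ℂ) * φ (b i)‖ ^ 2 := fun φ =>
      mul_nonneg (hc _).le (sq_nonneg _)
    refine lt_of_le_of_ne (Finset.sum_nonneg fun φ _ => h0 φ) fun h => hx ?_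
    have h1 := (Finset.sum_eq_zero_iff_of_nonneg fun φ _ => h0 φ).1 h.symm
    have h2 : conjMatrix b *ᵥ (fun i => (x i : ℂ)) = 0 := by
      ext φ
      have := h1 φ (Finset.mem_univ _)
      rw [mul_eq_zero, or_iff_right (hc _).ne', sq_eq_zero_iff, norm_eq_zero] at this
      rw [Matrix.mulVec, dotProduct, Pi.zero_apply, ← this]
      exact Finset.sum_congr rfl fun i _ => mul_comm _ _
    have h3 : (conjMatrix (dualB b))ᵀ * conjMatrix b = 1 := by
      rw [← Matrix.transpose_inj, Matrix.transpose_mul, Matrix.transpose_transpose,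
        conjMatrix_dual, Matrix.transpose_one]
    have h4 : (fun i => (x i : ℂ)) = 0 := by
      rw [← Matrix.one_mulVec (fun i => (x i : ℂ)), ← h3, ← Matrix.mulVec_mulVec, h2,
        Matrix.mulVec_zero]
    ext i
    have := congrFun h4 i
    simpa using this

lemma gram_det (b : Basis ι ℚ K) (c : InfinitePlace K → ℝ) :
    (gram b c).det = |(Algebra.discr ℚ b : ℝ)| * ∏ φ : K →+* ℂ, c (mk φ) := by
  let e : ι ≃ (K →+* ℂ) := Fintype.equivOfCardEq (card_eq b)
  have h1 : (gram b c).map Complex.ofReal = ((conjMatrix b).submatrix e id)ᴴ *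
      Matrix.diagonal (fun i => (c (mk (e i)) : ℂ)) * (conjMatrix b).submatrix e id := by
    rw [gram_map, Matrix.conjTranspose_submatrix]
    have : Matrix.diagonal (fun i => (c (mk (e i)) : ℂ)) =
      (Matrix.diagonal (fun φ : K →+* ℂ => (c (mk φ) : ℂ))).submatrix e e := by
      rw [Matrix.submatrix_diagonal_equiv]; rfl
    rw [this, Matrix.submatrix_mul_equiv, Matrix.submatrix_mul_equiv, Matrix.submatrix_id_id]
  have h2 : (((gram b c).det : ℝ) : ℂ) = ((gram b c).map Complex.ofReal).det :=
    RingHom.map_det Complex.ofRealHom (gram b c)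
  have h3 := Algebra.discr_eq_det_embeddingsMatrixReindex_pow_two ℚ ℂ (⇑b)
    (e.trans (RingHom.equivRatAlgHom K ℂ))
  have h4 : Algebra.embeddingsMatrixReindex ℚ ℂ b (e.trans (RingHom.equivRatAlgHom K ℂ)) =
      ((conjMatrix b).submatrix e id)ᵀ := by
    ext i j
    simp [Algebra.embeddingsMatrixReindex, Algebra.embeddingsMatrix, conjMatrix]
  rw [h4, Matrix.det_transpose] at h3
  have h5 : |(Algebra.discr ℚ b : ℝ)| = ‖((conjMatrix b).submatrix e id).det‖ ^ 2 := by
    rw [← norm_pow, ← h3]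
    simp
  apply Complex.ofReal_injective
  rw [h2, h1, Matrix.det_mul, Matrix.det_mul, Matrix.det_diagonal, Matrix.det_conjTranspose, h5]
  rw [← Complex.normSq_eq_norm_sq]
  push_cast
  rw [← e.prod_comp, Complex.normSq_eq_conj_mul_self]
  simp only [RCLike.star_def]
  ring

/-- The theta series of the lattice spanned by `b`. -/
noncomputable def theta (b : Basis ι ℚ K) (c : InfinitePlace K → ℝ) : ℝ :=
  ∑' m : ι → ℤ, Real.exp (-(Real.pi * q c (elt b m)))

lemma theta_eq (b : Basis ι ℚ K) (c : InfinitePlace K → ℝ) (hc : ∀ w, 0 < c w) :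
    theta b c = (√(|(Algebra.discr ℚ b : ℝ)| * ∏ φ : K →+* ℂ, c (mk φ)))⁻¹ * theta (dualB b) c⁻¹ := by
  have h := gauss_poisson (gram_posDef b c hc) (gram_mul_gram_dual b c hc)
  simpa only [dot_gram_toReal, gram_det, theta] using h

lemma discr_mul_discr_dual (b : Basis ι ℚ K) :
    |(Algebra.discr ℚ b : ℝ)| * |(Algebra.discr ℚ (dualB b) : ℝ)| = 1 := by
  have h := congrArg Matrix.det (gram_mul_gram_dual b 1 (by simp))
  rw [Matrix.det_mul, gram_det, gram_det] at h
  simpa using h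

lemma exists_lower_q (b : Basis ι ℚ K) :
    ∃ c > 0, ∀ m : ι → ℤ, c * ‖m‖ ^ 2 ≤ q 1 (elt b m) := by
  obtain ⟨c, hc, h⟩ := exists_lower (gram_posDef b 1 (by simp))
  refine ⟨c, hc, fun m => ?_⟩
  rw [← dot_gram_toReal, ← norm_toReal]
  exact h _

end NumberFieldTheta

namespace NumberFieldTheta

open NumberField InfinitePlace GaussPoisson Module MeasureTheory Set Filter Topology Asymptotics
open NumberField.Units NumberField.Units.dirichletUnitTheorem
open scoped Classical

variable {K : Type*} [Field K] [NumberField K] {ι : Type*} [Fintype ι]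

/-- The logarithmic coordinates at all infinite places, of total weight zero, recovered from the
coordinates of the logarithmic space. -/
noncomputable def placeLog : logSpace K →ₗ[ℝ] (InfinitePlace K → ℝ) where
  toFun y w := (if h : w = w₀ then -∑ v, y v else y ⟨w, h⟩) / mult w
  map_add' y z := by
    ext w
    by_cases h : w = w₀
    · simp [h, Finset.sum_add_distrib]; ring
    · simp [h]; ring
  map_smul' r y := by
    ext w
    by_cases h : w = w₀
    · simp [h, ← Finset.mul_sum]; ring
    · simp [h]; ring

lemma mult_mul_placeLog (y : logSpace K) (w : InfinitePlace K) :
    mult w * placeLog y w = if h : w = w₀ then -∑ v, y v else y ⟨w, h⟩ :=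
  mul_div_cancel₀ _ (by exact_mod_cast mult_ne_zero)

lemma sum_mult_mul_placeLog (y : logSpace K) : ∑ w, mult w * placeLog y w = 0 := by
  simp only [mult_mul_placeLog]
  rw [Fintype.sum_eq_add_sum_subtype_ne _ (w₀ : InfinitePlace K), dif_pos rfl]
  have h : ∀ v : {w : InfinitePlace K // w ≠ w₀},
      (if h : v.1 = w₀ then -∑ v, y v else y ⟨v.1, h⟩) = y v := fun v => dif_neg v.2
  simp [h]

lemma placeLog_logEmbedding (u : (𝓞 K)ˣ) (w : InfinitePlace K) :
    placeLog (logEmbedding K (Additive.ofMul u)) w = Real.log (w (u : K)) := by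
  have hm : (mult w : ℝ) ≠ 0 := by exact_mod_cast mult_ne_zero
  apply mul_left_cancel₀ hm
  rw [mult_mul_placeLog]
  split_ifs with h
  · rw [sum_logEmbedding_component, h]; ring
  · rw [logEmbedding_component]

lemma exists_abs_placeLog_le {D : Set (logSpace K)} (hD : Bornology.IsBounded D) :
    ∃ A, ∀ y ∈ D, ∀ w, |placeLog y w| ≤ A := by
  obtain ⟨A, hA⟩ := (LinearMap.toContinuousLinearMap (placeLog (K := K))).lipschitz.isBounded_image
    hD |>.exists_norm_le
  refine ⟨A, fun y hy w => ?_⟩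
  exact (norm_le_pi_norm (placeLog y) w).trans (hA _ (mem_image_of_mem _ hy))

lemma continuous_placeLog : Continuous (placeLog (K := K)) :=
  LinearMap.continuous_of_finiteDimensional _

/-- The weights `t e^{2 y_w}`. -/
noncomputable def wt (t : ℝ) (y : logSpace K) (w : InfinitePlace K) : ℝ :=
  t * Real.exp (2 * placeLog y w)

lemma wt_pos {t : ℝ} (ht : 0 < t) (y : logSpace K) (w : InfinitePlace K) : 0 < wt t y w :=
  mul_pos ht (Real.exp_pos _)

lemma wt_inv (t : ℝ) (y : logSpace K) : (wt t y)⁻¹ = wt t⁻¹ (-y) := by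
  ext w
  simp [wt, ← Real.exp_neg, mul_comm]

lemma sum_mk (g : InfinitePlace K → ℝ) : ∑ φ : K →+* ℂ, g (mk φ) = ∑ w, mult w * g w := by
  rw [← Finset.sum_fiberwise (s := Finset.univ) (g := fun φ : K →+* ℂ => mk φ)]
  refine Finset.sum_congr rfl fun w _ => ?_
  rw [← card_filter_mk_eq, ← nsmul_eq_mul]
  refine Finset.sum_eq_card_nsmul fun φ hφ => ?_
  rw [(Finset.mem_filter.1 hφ).2]

lemma prod_wt (t : ℝ) (y : logSpace K) :
    ∏ φ : K →+* ℂ, wt t y (mk φ) = t ^ finrank ℚ K := by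
  simp only [wt]
  rw [Finset.prod_mul_distrib, Finset.prod_const, ← Real.exp_sum,
    sum_mk fun w => 2 * placeLog y w]
  have : ∑ w, (mult w : ℝ) * (2 * placeLog y w) = 2 * ∑ w, mult w * placeLog y w := by
    rw [Finset.mul_sum]; exact Finset.sum_congr rfl fun w _ => by ring
  rw [this, sum_mult_mul_placeLog, mul_zero, Real.exp_zero, mul_one, Finset.card_univ,
    Embeddings.card]

lemma q_wt (t : ℝ) (y : logSpace K) (x : K) : q (wt t y) x = t * q (wt 1 y) x := by
  rw [q, q, Finset.mul_sum]
  exact Finset.sum_congr rfl fun φ _ => by simp only [wt]; ring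

lemma exists_lower_q_wt (b : Basis ι ℚ K) {D : Set (logSpace K)} (hD : Bornology.IsBounded D) :
    ∃ c > 0, ∀ y ∈ D, ∀ m : ι → ℤ, c * ‖m‖ ^ 2 ≤ q (wt 1 y) (elt b m) := by
  obtain ⟨A, hA⟩ := exists_abs_placeLog_le hD
  obtain ⟨c, hc, h⟩ := exists_lower_q b
  refine ⟨Real.exp (2 * -A) * c, by positivity, fun y hy m => ?_⟩
  rw [mul_assoc]
  refine (mul_le_mul_of_nonneg_left (h m) (Real.exp_pos _).le).trans ?_
  rw [q, q, Finset.mul_sum]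
  refine Finset.sum_le_sum fun φ _ => ?_
  simp only [wt, Pi.one_apply, one_mul]
  gcongr
  exact (abs_le.1 (hA y hy _)).1

lemma continuous_q_wt (x : K) : Continuous fun p : ℝ × logSpace K => q (wt p.1 p.2) x := by
  simp only [q, wt]
  refine continuous_finsetSum _ fun φ _ => ?_
  have : Continuous fun p : ℝ × logSpace K => placeLog p.2 (mk φ) :=
    (continuous_apply _).comp (continuous_placeLog.comp continuous_snd)
  fun_prop

lemma exp_le_of_lower {c t₀ t : ℝ} (ht : t₀ ≤ t) (ht0 : 0 < t) {y : logSpace K} {x : K}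
    {M : ℝ} (hc : 0 < c) (h : c * M ^ 2 ≤ q (wt 1 y) x) :
    Real.exp (-(Real.pi * q (wt t y) x)) ≤ Real.exp (-(Real.pi * t₀ * c * M ^ 2)) := by
  rw [q_wt, Real.exp_le_exp, neg_le_neg_iff]
  have h1 : t₀ * (c * M ^ 2) ≤ t * q (wt 1 y) x :=
    (mul_le_mul_of_nonneg_right ht (by positivity)).trans (mul_le_mul_of_nonneg_left h ht0.le)
  nlinarith [Real.pi_pos]

lemma summable_theta (b : Basis ι ℚ K) {t : ℝ} (ht : 0 < t) (y : logSpace K) :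
    Summable fun m : ι → ℤ => Real.exp (-(Real.pi * q (wt t y) (elt b m))) := by
  obtain ⟨c, hc, h⟩ := exists_lower_q_wt b (Bornology.isBounded_singleton (x := y))
  refine Summable.of_nonneg_of_le (fun _ => (Real.exp_pos _).le)
    (fun m => exp_le_of_lower le_rfl ht hc (h y rfl m)) ?_
  exact summable_exp_neg_norm_sq (by positivity)

lemma continuousOn_theta (b : Basis ι ℚ K) {D : Set (logSpace K)} (hD : Bornology.IsBounded D)
    {t₀ : ℝ} (ht₀ : 0 < t₀) :
    ContinuousOn (fun p : ℝ × logSpace K => theta b (wt p.1 p.2)) (Ici t₀ ×ˢ D) := by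
  obtain ⟨c, hc, h⟩ := exists_lower_q_wt b hD
  refine continuousOn_tsum (u := fun m : ι → ℤ => Real.exp (-(Real.pi * t₀ * c * ‖m‖ ^ 2)))
    (fun m => ?_) (summable_exp_neg_norm_sq (by positivity)) fun m p hp => ?_
  · have := continuous_q_wt (elt b m)
    exact (Real.continuous_exp.comp (this.const_mul _).neg).continuousOn
  · rw [Real.norm_of_nonneg (Real.exp_pos _).le]
    exact exp_le_of_lower hp.1 (ht₀.trans_le hp.1) hc (h _ hp.2 m)

lemma theta_nonneg (b : Basis ι ℚ K) (c : InfinitePlace K → ℝ) : 0 ≤ theta b c :=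
  tsum_nonneg fun _ => (Real.exp_pos _).le

lemma exists_theta_le (b : Basis ι ℚ K) {D : Set (logSpace K)} (hD : Bornology.IsBounded D)
    {t₀ : ℝ} (ht₀ : 0 < t₀) : ∃ C, ∀ t ≥ t₀, ∀ y ∈ D, theta b (wt t y) ≤ C := by
  obtain ⟨c, hc, h⟩ := exists_lower_q_wt b hD
  refine ⟨_, fun t ht y hy => Summable.tsum_le_tsum (g := fun m : ι → ℤ =>
    Real.exp (-(Real.pi * t₀ * c * ‖m‖ ^ 2))) (fun m =>
    exp_le_of_lower ht (ht₀.trans_le ht) hc (h y hy m))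
    (summable_theta b (ht₀.trans_le ht) y) (summable_exp_neg_norm_sq (by positivity))⟩

/-- The theta series without its constant term. -/
lemma hasSum_theta_sub_one (b : Basis ι ℚ K) {t : ℝ} (ht : 0 < t) (y : logSpace K) :
    HasSum (fun m : {m : ι → ℤ // m ≠ 0} => Real.exp (-(Real.pi * q (wt t y) (elt b m))))
      (theta b (wt t y) - 1) := by
  have h := (hasSum_ite_sub_hasSum (summable_theta b ht y).hasSum 0)
  have e : Real.exp (-(Real.pi * q (wt t y) (elt b 0))) = 1 := by simp [elt_zero, q]
  rw [e] at h
  have h2 := (hasSum_subtype_iff_of_support_subset (s := {m : ι → ℤ | m ≠ 0}) (a := theta b (wt t y) - 1)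
    (f := fun m : ι → ℤ => if m = 0 then 0 else Real.exp (-(Real.pi * q (wt t y) (elt b m))))
    (by intro m hm; simp at hm; simpa using hm)).2 h
  refine h2.congr_fun fun m => ?_
  exact (if_neg m.2).symm

lemma exists_theta_sub_one_le (b : Basis ι ℚ K) {D : Set (logSpace K)}
    (hD : Bornology.IsBounded D) : ∃ C, ∃ a > 0, ∀ t ≥ 1, ∀ y ∈ D,
      |theta b (wt t y) - 1| ≤ C * Real.exp (-a * t) := by
  obtain ⟨c, hc, h⟩ := exists_lower_q_wt b hD
  have hs : Summable fun m : ι → ℤ => Real.exp (-(Real.pi * 1 * c * ‖m‖ ^ 2)) :=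
    summable_exp_neg_norm_sq (by positivity)
  refine ⟨(∑' m : {m : ι → ℤ // m ≠ 0}, Real.exp (-(Real.pi * 1 * c * ‖m.1‖ ^ 2))) *
    Real.exp (Real.pi * c), Real.pi * c, by positivity, fun t ht y hy => ?_⟩
  have ht0 : 0 < t := by linarith
  have h1 := hasSum_theta_sub_one b ht0 y
  rw [abs_of_nonneg (h1.nonneg fun _ => (Real.exp_pos _).le), ← h1.tsum_eq, mul_assoc,
    ← Real.exp_add, ← tsum_mul_right]
  refine Summable.tsum_le_tsum (fun m => ?_) h1.summable ((hs.subtype _).mul_right _)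
  refine (exp_le_of_lower le_rfl ht0 hc (h y hy m)).trans ?_
  rw [← Real.exp_add, Real.exp_le_exp]
  have h2 : 1 ≤ ‖m.1‖ := one_le_norm_of_ne_zero m.2
  have h3 : 1 ≤ ‖m.1‖ ^ 2 := one_le_pow₀ h2
  have h4 : 0 ≤ Real.pi * c * ((t - 1) * (‖m.1‖ ^ 2 - 1)) :=
    mul_nonneg (by positivity) (mul_nonneg (by linarith) (by linarith))
  nlinarith

/-- The theta series integrated over a region of the logarithmic space. -/
noncomputable def thetaInt (b : Basis ι ℚ K) (D : Set (logSpace K)) (t : ℝ) : ℝ :=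
  ∫ y in D, theta b (wt t y)

section

variable (b : Basis ι ℚ K) {D : Set (logSpace K)} (hD : Bornology.IsBounded D)
  (hDm : MeasurableSet D)

include hD hDm

lemma aestronglyMeasurable_theta {t : ℝ} (ht : 0 < t) :
    AEStronglyMeasurable (fun y => theta b (wt t y)) (volume.restrict D) := by
  refine ContinuousOn.aestronglyMeasurable ?_ hDm
  exact (continuousOn_theta b hD ht).comp (f := fun y => (t, y)) (by fun_prop)
    fun y hy => ⟨self_mem_Ici, hy⟩

lemma integrableOn_theta {t : ℝ} (ht : 0 < t) : IntegrableOn (fun y => theta b (wt t y)) D := by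
  obtain ⟨C, hC⟩ := exists_theta_le b hD ht
  have : IsFiniteMeasure (volume.restrict D) := ⟨by simpa using hD.measure_lt_top⟩
  refine Integrable.of_bound (aestronglyMeasurable_theta b hD hDm ht) C ?_
  filter_upwards [ae_restrict_mem hDm] with y hy
  rw [Real.norm_of_nonneg (theta_nonneg _ _)]
  exact hC t le_rfl y hy

lemma continuousOn_thetaInt : ContinuousOn (thetaInt b D) (Ioi 0) := by
  intro t ht
  have ht2 : 0 < t / 2 := half_pos ht
  have : ContinuousOn (thetaInt b D) (Ici (t / 2)) := by
    obtain ⟨C, hC⟩ := exists_theta_le b hD ht2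
    refine continuousOn_of_dominated (bound := fun _ => C)
      (fun x hx => aestronglyMeasurable_theta b hD hDm (ht2.trans_le hx)) (fun x hx => ?_) ?_ ?_
    · filter_upwards [ae_restrict_mem hDm] with y hy
      rw [Real.norm_of_nonneg (theta_nonneg _ _)]
      exact hC x hx y hy
    · exact integrableOn_const hD.measure_lt_top.ne
    · filter_upwards [ae_restrict_mem hDm] with y hy
      exact (continuousOn_theta b hD ht2).comp (f := fun x => (x, y)) (by fun_prop)
        fun x hx => ⟨hx, hy⟩
  exact (this.continuousAt (Ici_mem_nhds (half_lt_self ht))).continuousWithinAt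

lemma thetaInt_sub {t : ℝ} (ht : 0 < t) :
    thetaInt b D t - volume.real D = ∫ y in D, (theta b (wt t y) - 1) := by
  rw [integral_sub (integrableOn_theta b hD hDm ht) (integrableOn_const hD.measure_lt_top.ne),
    thetaInt]
  simp

lemma thetaInt_sub_isBigO (r : ℝ) :
    (fun t => ((thetaInt b D t : ℝ) : ℂ) - (volume.real D : ℂ)) =O[atTop] (fun t => t ^ r) := by
  obtain ⟨C, a, ha, h⟩ := exists_theta_sub_one_le b hD
  refine IsBigO.trans (g := fun t => Real.exp (-a * t)) ?_
    (isLittleO_exp_neg_mul_rpow_atTop ha r).isBigO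
  refine IsBigO.of_bound (C * volume.real D) ?_
  filter_upwards [eventually_ge_atTop 1] with t ht
  rw [← Complex.ofReal_sub, Complex.norm_real, thetaInt_sub b hD hDm (by linarith)]
  refine (norm_setIntegral_le_of_norm_le_const hD.measure_lt_top fun y hy => h t ht y hy).trans ?_
  rw [Real.norm_of_nonneg (Real.exp_pos _).le]
  exact le_of_eq (by ring)

lemma locallyIntegrableOn_thetaInt :
    LocallyIntegrableOn (fun t => ((thetaInt b D t : ℝ) : ℂ)) (Ioi 0) :=
  (Complex.continuous_ofReal.comp_continuousOn (continuousOn_thetaInt b hD hDm)).locallyIntegrableOn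
    measurableSet_Ioi

end

/-- Square root of the absolute discriminant of a basis. -/
noncomputable def covol (b : Basis ι ℚ K) : ℝ := √|(Algebra.discr ℚ b : ℝ)|

lemma covol_mul_covol_dual (b : Basis ι ℚ K) : covol b * covol (dualB b) = 1 := by
  rw [covol, covol, ← Real.sqrt_mul (abs_nonneg _), discr_mul_discr_dual, Real.sqrt_one]

lemma covol_pos (b : Basis ι ℚ K) : 0 < covol b :=
  lt_of_le_of_ne (Real.sqrt_nonneg _) fun h => by
    have := covol_mul_covol_dual b
    rw [← h] at this; simp at this

lemma theta_inv (b : Basis ι ℚ K) {t : ℝ} (ht : 0 < t) (y : logSpace K) :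
    theta b (wt (1 / t) y) = (covol b)⁻¹ * t ^ ((finrank ℚ K : ℝ) / 2) *
      theta (dualB b) (wt t (-y)) := by
  rw [theta_eq b _ (wt_pos (one_div_pos.2 ht) y), prod_wt, wt_inv, Real.sqrt_mul (abs_nonneg _),
    mul_inv, covol]
  congr 2
  · rw [one_div, Real.sqrt_eq_rpow, ← Real.rpow_natCast, Real.inv_rpow ht.le,
      Real.inv_rpow (by positivity), inv_inv, ← Real.rpow_mul ht.le]
    ring_nf
  · simp

lemma thetaInt_inv (b : Basis ι ℚ K) (D : Set (logSpace K)) {t : ℝ} (ht : 0 < t) :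
    thetaInt b D (1 / t) = (covol b)⁻¹ * t ^ ((finrank ℚ K : ℝ) / 2) *
      thetaInt (dualB b) (-D) t := by
  simp only [thetaInt, theta_inv b ht]
  rw [integral_const_mul]
  congr 1
  have h := (Measure.measurePreserving_neg (volume : Measure (logSpace K))).setIntegral_preimage_emb
    (MeasurableEquiv.neg _).measurableEmbedding (fun y => theta (dualB b) (wt t y)) (-D)
  simpa using h

/-- The functional equation pair attached to a basis of `K` and a region of the logarithmic
space. -/
noncomputable def thetaPair (b : Basis ι ℚ K) {D : Set (logSpace K)} (hD : Bornology.IsBounded D)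
    (hDm : MeasurableSet D) : WeakFEPair ℂ where
  f t := (thetaInt b D t : ℂ)
  g t := (thetaInt (dualB b) (-D) t : ℂ)
  k := (finrank ℚ K : ℝ) / 2
  ε := ((covol b)⁻¹ : ℝ)
  f₀ := volume.real D
  g₀ := volume.real (-D)
  hf_int := locallyIntegrableOn_thetaInt b hD hDm
  hg_int := locallyIntegrableOn_thetaInt _ hD.neg hDm.neg
  hk := by have := finrank_pos (R := ℚ) (M := K); positivity
  hε := by exact_mod_cast (inv_pos.2 (covol_pos b)).ne'
  h_feq t ht := by
    rw [thetaInt_inv b D ht]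
    push_cast
    rfl
  hf_top := thetaInt_sub_isBigO b hD hDm
  hg_top := thetaInt_sub_isBigO _ hD.neg hDm.neg

end NumberFieldTheta

namespace NumberFieldTheta

open NumberField InfinitePlace GaussPoisson Module MeasureTheory Set Filter Topology Asymptotics
open NumberField.Units NumberField.Units.dirichletUnitTheorem
open scoped Classical

lemma integral_exp_mul_exp_neg_exp {a : ℂ} (ha : 0 < a.re) {r : ℝ} (hr : 0 < r) :
    Integrable (fun z : ℝ => Complex.exp (a * z) * Complex.exp (-(r * Real.exp z))) ∧
    ∫ z : ℝ, Complex.exp (a * z) * Complex.exp (-(r * Real.exp z)) =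
      (1 / (r : ℂ)) ^ a * Complex.Gamma a := by
  have hd : ∀ x ∈ (univ : Set ℝ), HasDerivWithinAt Real.exp (Real.exp x) univ x := fun x _ =>
    (Real.hasDerivAt_exp x).hasDerivWithinAt
  have him : Set.image Real.exp univ = Ioi 0 := by rw [image_univ, Real.range_exp]
  have he : ∀ z : ℝ, |Real.exp z| • ((Real.exp z : ℂ) ^ (a - 1) *
      Complex.exp (-(r * (Real.exp z : ℂ)))) =
      Complex.exp (a * z) * Complex.exp (-(r * Real.exp z)) := by
    intro z
    rw [abs_of_pos (Real.exp_pos z), Complex.real_smul, ← mul_assoc]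
    congr 1
    rw [Complex.cpow_def_of_ne_zero (by exact_mod_cast (Real.exp_pos z).ne'),
      ← Complex.ofReal_log (Real.exp_pos z).le, Real.log_exp, Complex.ofReal_exp,
      ← Complex.exp_add]
    ring_nf
  have hval := Complex.integral_cpow_mul_exp_neg_mul_Ioi ha hr
  have hnz : (1 / (r : ℂ)) ^ a * Complex.Gamma a ≠ 0 := by
    refine mul_ne_zero ?_ (Complex.Gamma_ne_zero_of_re_pos ha)
    rw [Ne, Complex.cpow_eq_zero_iff]
    have : (r : ℂ) ≠ 0 := by exact_mod_cast hr.ne'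
    simp [this]
  have h_int : IntegrableOn (fun t : ℝ => (t : ℂ) ^ (a - 1) * Complex.exp (-(r * t))) (Ioi 0) := by
    by_contra h
    exact hnz (by rw [← hval, integral_undef h])
  have h1 := integrableOn_image_iff_integrableOn_abs_deriv_smul MeasurableSet.univ hd
    Real.exp_injective.injOn (fun t : ℝ => (t : ℂ) ^ (a - 1) * Complex.exp (-(r * t)))
  have h2 := integral_image_eq_integral_abs_deriv_smul MeasurableSet.univ hd
    Real.exp_injective.injOn (fun t : ℝ => (t : ℂ) ^ (a - 1) * Complex.exp (-(r * t)))
  rw [him] at h1 h2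
  simp only [he, Measure.restrict_univ, integrableOn_univ] at h1 h2
  exact ⟨h1.1 h_int, by rw [← h2, hval]⟩

variable {K : Type*} [Field K] [NumberField K]

/-- The linear isomorphism separating the scale from the logarithmic space. -/
noncomputable def logEquiv : (ℝ × logSpace K) ≃L[ℝ] (InfinitePlace K → ℝ) :=
  (LinearEquiv.ofInjectiveOfFinrankEq
    (LinearMap.coprod (LinearMap.toSpanSingleton ℝ (InfinitePlace K → ℝ) 1)
      ((2 : ℝ) • placeLog)) (by
    rw [← LinearMap.ker_eq_bot, LinearMap.ker_eq_bot']
    rintro ⟨τ, y⟩ h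
    have h1 : ∀ w, τ + 2 * placeLog y w = 0 := fun w => by simpa using congrFun h w
    have h2 : ∑ w : InfinitePlace K, mult w * (τ + 2 * placeLog y w) = 0 := by simp [h1]
    have h3 : τ = 0 := by
      simp only [mul_add, Finset.sum_add_distrib] at h2
      have h4 : ∑ w : InfinitePlace K, (mult w : ℝ) * (2 * placeLog y w) = 0 := by
        refine Eq.trans ?_ ((congrArg (2 * ·) (sum_mult_mul_placeLog y)).trans (mul_zero _))
        rw [Finset.mul_sum]
        exact Finset.sum_congr rfl fun w _ => by ring
      rw [h4, add_zero, ← Finset.sum_mul, mul_eq_zero] at h2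
      refine h2.resolve_left (Finset.sum_pos (fun w _ => ?_) Finset.univ_nonempty).ne'
      exact_mod_cast mult_pos
    refine Prod.ext h3 (funext fun v => ?_)
    have h5 := mult_mul_placeLog y v.1
    rw [dif_neg v.2] at h5
    have h6 := h1 v.1
    rw [h3, zero_add] at h6
    simp only [Prod.snd_zero, Pi.zero_apply]
    rw [← h5]
    have : placeLog y v.1 = 0 := by linarith
    rw [this, mul_zero]) (by
    have : Fintype.card {w : InfinitePlace K // ¬w = w₀} = Fintype.card (InfinitePlace K) - 1 := by
      simp [Fintype.card_subtype_compl]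
    have h1 : 0 < Fintype.card (InfinitePlace K) := Fintype.card_pos
    simp [this]
    omega)).toContinuousLinearEquiv

lemma logEquiv_apply (p : ℝ × logSpace K) (w : InfinitePlace K) :
    logEquiv p w = p.1 + 2 * placeLog p.2 w := by
  simp [logEquiv, LinearEquiv.ofInjectiveOfFinrankEq]

variable (K) in
lemma isAddHaarMeasure_map_logEquiv :
    (Measure.map (logEquiv (K := K)) volume).IsAddHaarMeasure := by
  have : (volume : Measure (ℝ × logSpace K)).IsAddHaarMeasure := by
    rw [Measure.volume_eq_prod]; infer_instance
  exact (logEquiv (K := K)).isAddHaarMeasure_map volume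

variable (K) in
/-- The Haar measure constant of `logEquiv`. -/
noncomputable def logScale : NNReal :=
  have := isAddHaarMeasure_map_logEquiv K
  Measure.addHaarScalarFactor (Measure.map (logEquiv (K := K)) volume) volume

variable (K) in
lemma logScale_pos : 0 < logScale K :=
  have := isAddHaarMeasure_map_logEquiv K
  Measure.addHaarScalarFactor_pos_of_isAddHaarMeasure _ _

lemma map_logEquiv : Measure.map (logEquiv (K := K)) volume = logScale K • volume :=
  have := isAddHaarMeasure_map_logEquiv K
  Measure.isAddLeftInvariant_eq_smul _ _

lemma integrable_comp_logEquiv {g : (InfinitePlace K → ℝ) → ℂ} (hg : Integrable g) :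
    Integrable (g ∘ logEquiv) := by
  have h := (MeasurableEmbedding.integrable_map_iff (μ := volume) (f := logEquiv (K := K))
    logEquiv.toHomeomorph.measurableEmbedding (g := g))
  rw [← h, map_logEquiv]
  exact hg.smul_measure_nnreal

lemma integral_comp_logEquiv (g : (InfinitePlace K → ℝ) → ℂ) :
    ∫ p, g (logEquiv p) = (logScale K : ℝ) * ∫ z, g z := by
  have h := (MeasurableEmbedding.integral_map (μ := volume) (f := logEquiv (K := K))
    logEquiv.toHomeomorph.measurableEmbedding g)
  rw [← h, map_logEquiv, integral_smul_nnreal_measure]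
  rfl

/-- The Mellin integrand, in logarithmic coordinates. -/
noncomputable def phi (s : ℂ) (x : K) (p : ℝ × logSpace K) : ℂ :=
  Complex.exp (s * p.1) * (Real.exp (-(Real.pi * q (wt (Real.exp p.1) p.2) x)) : ℂ)

/-- The local factor at `w` of `phi`. -/
noncomputable def phiLoc (s : ℂ) (x : K) (w : InfinitePlace K) (z : ℝ) : ℂ :=
  Complex.exp ((mult w * s / finrank ℚ K) * z) *
    Complex.exp (-(((Real.pi * mult w * w x ^ 2 : ℝ) : ℂ) * Real.exp z))

variable (K) in
lemma sum_mult : ∑ w : InfinitePlace K, mult w = finrank ℚ K := sum_mult_eq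

lemma phi_eq_prod (s : ℂ) (x : K) (p : ℝ × logSpace K) :
    phi s x p = ∏ w, phiLoc s x w (logEquiv p w) := by
  have hn : (finrank ℚ K : ℂ) ≠ 0 := by exact_mod_cast (finrank_pos (R := ℚ) (M := K)).ne'
  simp only [phi, phiLoc, Finset.prod_mul_distrib, ← Complex.exp_sum]
  rw [Complex.ofReal_exp]
  congr 2
  · simp only [logEquiv_apply]
    push_cast
    have e : ∀ w : InfinitePlace K, (mult w : ℂ) * s / finrank ℚ K * (p.1 + 2 * placeLog p.2 w) =
        (mult w : ℂ) * (s / finrank ℚ K * p.1) +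
          2 * s / finrank ℚ K * ((mult w * placeLog p.2 w : ℝ) : ℂ) := by
      intro w; push_cast; ring
    rw [Finset.sum_congr rfl fun w _ => e w, Finset.sum_add_distrib, ← Finset.sum_mul,
      ← Finset.mul_sum, ← Complex.ofReal_sum, sum_mult_mul_placeLog, ← Nat.cast_sum, sum_mult]
    field_simp
    simp [mul_assoc]
  · rw [q_eq_sum_place, Finset.mul_sum, ← Finset.sum_neg_distrib, Complex.ofReal_sum]
    refine Finset.sum_congr rfl fun w _ => ?_
    rw [logEquiv_apply, wt, Real.exp_add]
    push_cast
    ring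

/-- The Gamma factor. -/
noncomputable def gammaK (K : Type*) [Field K] [NumberField K] (s : ℂ) : ℂ :=
  ∏ w : InfinitePlace K, (1 / ((Real.pi * mult w : ℝ) : ℂ)) ^ (mult w * s / finrank ℚ K) *
    Complex.Gamma (mult w * s / finrank ℚ K)

lemma re_mult_mul_div {s : ℂ} (hs : 0 < s.re) (w : InfinitePlace K) :
    0 < (mult w * s / finrank ℚ K : ℂ).re := by
  have h1 : 0 < (mult w : ℝ) := by exact_mod_cast mult_pos
  have h2 : 0 < (finrank ℚ K : ℝ) := by exact_mod_cast finrank_pos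
  have : (mult w * s / finrank ℚ K : ℂ) = ((mult w / finrank ℚ K : ℝ) : ℂ) * s := by
    push_cast; ring
  rw [this, Complex.re_ofReal_mul]
  positivity

lemma integrable_phi {s : ℂ} (hs : 0 < s.re) {x : K} (hx : x ≠ 0) : Integrable (phi s x) := by
  have : Integrable (fun z : InfinitePlace K → ℝ => ∏ w, phiLoc s x w (z w)) := by
    refine Integrable.fintype_prod (μ := fun _ => volume) fun w => ?_
    refine (integral_exp_mul_exp_neg_exp (re_mult_mul_div hs w) ?_).1
    have h1 : 0 < (mult w : ℝ) := by exact_mod_cast mult_pos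
    have h2 : 0 < w x := pos_iff.2 hx
    positivity
  refine (integrable_comp_logEquiv this).congr (Eventually.of_forall fun p => ?_)
  exact (phi_eq_prod s x p).symm

lemma integral_phi {s : ℂ} (hs : 0 < s.re) {x : K} (hx : x ≠ 0) :
    ∫ p, phi s x p = (logScale K : ℝ) * (gammaK K s *
      ((|(Algebra.norm ℚ x : ℝ)| : ℝ) : ℂ) ^ (-(2 * s / finrank ℚ K))) := by
  simp only [phi_eq_prod]
  rw [integral_comp_logEquiv (fun z => ∏ w, phiLoc s x w (z w)),
    integral_fintype_prod_volume_eq_prod]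
  congr 1
  have hN : ((|(Algebra.norm ℚ x : ℝ)| : ℝ) : ℂ) ^ (-(2 * s / finrank ℚ K)) =
      ∏ w : InfinitePlace K, (1 / ((w x ^ 2 : ℝ) : ℂ)) ^ (mult w * s / finrank ℚ K) := by
    have h := prod_eq_abs_norm x
    have h0 : |(Algebra.norm ℚ x : ℝ)| = ∏ w : InfinitePlace K, w x ^ mult w := by
      rw [h]; push_cast; rfl
    have h1 : 0 < |(Algebra.norm ℚ x : ℝ)| := by
      rw [abs_pos]; exact_mod_cast Algebra.norm_ne_zero_iff.2 hx
    rw [Complex.cpow_def_of_ne_zero (by exact_mod_cast h1.ne'), ← Complex.ofReal_log h1.le, h0,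
      Real.log_prod fun w _ => pow_ne_zero _ (pos_iff.2 hx).ne', Complex.ofReal_sum,
      Finset.sum_mul, Complex.exp_sum]
    refine Finset.prod_congr rfl fun w _ => ?_
    have h2 : 0 < w x := pos_iff.2 hx
    have h3 : (1 / ((w x ^ 2 : ℝ) : ℂ)) = ((1 / w x ^ 2 : ℝ) : ℂ) := by push_cast; rfl
    rw [h3, Complex.cpow_def_of_ne_zero (by exact_mod_cast (by positivity : (1 / w x ^ 2) ≠ 0)),
      ← Complex.ofReal_log (by positivity), one_div, Real.log_inv, Real.log_pow, Real.log_pow]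
    push_cast
    ring_nf
  rw [hN, gammaK, ← Finset.prod_mul_distrib]
  refine Finset.prod_congr rfl fun w _ => ?_
  have h1 : 0 < (mult w : ℝ) := by exact_mod_cast mult_pos
  have h2 : 0 < w x := pos_iff.2 hx
  have := (integral_exp_mul_exp_neg_exp (re_mult_mul_div hs w)
    (r := Real.pi * mult w * w x ^ 2) (by positivity)).2
  simp only [phiLoc]
  rw [this]
  have e : (1 / ((Real.pi * mult w * w x ^ 2 : ℝ) : ℂ)) =
      ((1 / (Real.pi * mult w) : ℝ) : ℂ) * ((1 / w x ^ 2 : ℝ) : ℂ) := by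
    push_cast; field_simp
  rw [e, Complex.mul_cpow_ofReal_nonneg (by positivity) (by positivity)]
  push_cast
  ring

end NumberFieldTheta

namespace NumberFieldTheta

open NumberField InfinitePlace GaussPoisson Module MeasureTheory Set Filter Topology Asymptotics
open NumberField.Units NumberField.Units.dirichletUnitTheorem
open scoped Classical Pointwise

variable {K : Type*} [Field K] [NumberField K]

lemma q_unit_mul (t : ℝ) (y : logSpace K) (u : (𝓞 K)ˣ) (x : K) :
    q (wt t y) ((u : K) * x) = q (wt t (logEmbedding K (Additive.ofMul u) + y)) x := by
  rw [q_eq_sum_place, q_eq_sum_place]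
  refine Finset.sum_congr rfl fun w _ => ?_
  have h : 0 < w (u : K) := pos_iff.2 (coe_ne_zero u)
  rw [wt, wt, map_add, Pi.add_apply, placeLog_logEmbedding, mul_add, Real.exp_add, map_mul,
    two_mul (Real.log _), Real.exp_add, Real.exp_log h]
  ring

lemma phi_unit_mul (s : ℂ) (u : (𝓞 K)ˣ) (x : K) (p : ℝ × logSpace K) :
    phi s ((u : K) * x) p = phi s x (p.1, logEmbedding K (Additive.ofMul u) + p.2) := by
  rw [phi, phi, q_unit_mul]

lemma norm_phi (s : ℂ) (x : K) (p : ℝ × logSpace K) :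
    ((‖phi s x p‖ : ℝ) : ℂ) = phi (s.re : ℂ) x p := by
  rw [phi, phi, norm_mul, Complex.norm_exp, Complex.norm_real,
    Real.norm_of_nonneg (Real.exp_pos _).le]
  simp

instance : VAddInvariantMeasure (unitLattice K) (logSpace K) volume :=
  ⟨fun c s _ => measure_preimage_add volume (c : logSpace K) s⟩

lemma hasSum_unitLattice {D : Set (logSpace K)}
    (hD : IsAddFundamentalDomain (unitLattice K) D volume) {s : ℂ} (hs : 0 < s.re) {x : K}
    (hx : x ≠ 0) :
    HasSum (fun l : unitLattice K => ∫ y in D, ∫ τ : ℝ, phi s x (τ, (l : logSpace K) + y))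
      (∫ p, phi s x p) := by
  have hi := integrable_phi hs hx
  rw [Measure.volume_eq_prod] at hi ⊢
  rw [integral_prod_symm _ hi]
  have hi2 := hi.integral_prod_right
  have hsum := hD.sum_restrict
  rw [← hsum] at hi2
  have h := hasSum_integral_measure hi2
  rw [hsum] at h
  refine h.congr_fun fun l => ?_
  have := (measurePreserving_vadd l (volume : Measure (logSpace K))).setIntegral_image_emb
    (measurableEmbedding_const_vadd l) (fun y => ∫ τ : ℝ, phi s x (τ, y)) D
  rw [image_vadd] at this
  rw [this]
  rfl

lemma exists_unit_logEmbedding (l : unitLattice K) :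
    ∃ u : (𝓞 K)ˣ, logEmbedding K (Additive.ofMul u) = l := by
  obtain ⟨u, -, hu⟩ := l.2
  exact ⟨Additive.toMul u, hu⟩

/-- A unit with prescribed logarithms. -/
noncomputable def unitOfLog (l : unitLattice K) : (𝓞 K)ˣ := (exists_unit_logEmbedding l).choose

lemma logEmbedding_unitOfLog (l : unitLattice K) :
    logEmbedding K (Additive.ofMul (unitOfLog l)) = l := (exists_unit_logEmbedding l).choose_spec

lemma logEmbedding_torsion_mul (p : torsion K × unitLattice K) :
    logEmbedding K (Additive.ofMul ((p.1 : (𝓞 K)ˣ) * unitOfLog p.2)) = p.2 := by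
  rw [ofMul_mul, map_add, logEmbedding_eq_zero_iff.2 p.1.2, zero_add, logEmbedding_unitOfLog]

lemma bijective_torsion_mul : Function.Bijective
    (fun p : torsion K × unitLattice K => (p.1 : (𝓞 K)ˣ) * unitOfLog p.2) := by
  constructor
  · intro p p' h
    have h2 : p.2 = p'.2 := Subtype.ext (by
      rw [← logEmbedding_torsion_mul p, ← logEmbedding_torsion_mul p']
      exact congrArg (fun u => logEmbedding K (Additive.ofMul u)) h)
    simp only [h2] at h
    exact Prod.ext (Subtype.ext (mul_right_cancel h)) h2
  · intro u
    obtain ⟨l, hl⟩ : ∃ l : unitLattice K, (l : logSpace K) = logEmbedding K (Additive.ofMul u) :=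
      ⟨⟨_, ⟨Additive.ofMul u, trivial, rfl⟩⟩, rfl⟩
    refine ⟨⟨⟨u * (unitOfLog l)⁻¹, ?_⟩, l⟩, by simp⟩
    rw [← logEmbedding_eq_zero_iff, ofMul_mul, map_add, ofMul_inv, map_neg,
      logEmbedding_unitOfLog, hl, add_neg_cancel]

/-- The completed Gamma factor including unit constants. -/
noncomputable def gammaFull (K : Type*) [Field K] [NumberField K] (s : ℂ) : ℂ :=
  (Nat.card (torsion K) : ℂ) * ((logScale K : ℝ) * gammaK K s)

/-- The measure on `ℝ × logSpace K` restricted to a region of the logarithmic space. -/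
noncomputable abbrev regionMeasure (D : Set (logSpace K)) : Measure (ℝ × logSpace K) :=
  (volume : Measure ℝ).prod (volume.restrict D)

lemma integrable_phi_region (D : Set (logSpace K)) {s : ℂ} (hs : 0 < s.re) {x : K} (hx : x ≠ 0) :
    Integrable (phi s x) (regionMeasure D) := by
  have h := (integrable_phi hs hx).integrableOn (s := univ ×ˢ D)
  rw [IntegrableOn, Measure.volume_eq_prod, ← Measure.prod_restrict, Measure.restrict_univ] at h
  exact h

lemma hasSum_prod_snd {α β : Type*} [Finite α] {f : β → ℂ} {a : ℂ} (h : HasSum f a) :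
    HasSum (fun p : α × β => f p.2) (Nat.card α * a) := by
  have h1 : HasSum (fun _ : α => (1 : ℂ)) (Nat.card α) := by
    cases nonempty_fintype α
    have := hasSum_fintype (fun _ : α => (1 : ℂ))
    rwa [Finset.sum_const, Finset.card_univ, nsmul_one, ← Nat.card_eq_fintype_card] at this
  have h3 : Summable (fun x : α × β => (1 : ℂ) * f x.2) :=
    summable_mul_of_summable_norm (f := fun _ : α => (1 : ℂ)) h1.summable.norm h.summable.norm
  have h2 := h1.mul h h3
  simp only [one_mul] at h2
  exact h2

lemma integral_phi_torsion_mul (D : Set (logSpace K)) {s : ℂ} (hs : 0 < s.re) {x : K}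
    (hx : x ≠ 0) (p : torsion K × unitLattice K) :
    ∫ z, phi s ((((p.1 : (𝓞 K)ˣ) * unitOfLog p.2 : (𝓞 K)ˣ) : K) * x) z ∂(regionMeasure D) =
      ∫ y in D, ∫ τ : ℝ, phi s x (τ, ((p.2 : unitLattice K) : logSpace K) + y) := by
  rw [integral_prod_symm _ (integrable_phi_region D hs (mul_ne_zero (coe_ne_zero _) hx))]
  simp only [phi_unit_mul, logEmbedding_torsion_mul]

lemma hasSum_units {D : Set (logSpace K)}
    (hD : IsAddFundamentalDomain (unitLattice K) D volume) {s : ℂ} (hs : 0 < s.re) {x : K}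
    (hx : x ≠ 0) :
    HasSum (fun u : (𝓞 K)ˣ => ∫ p, phi s ((u : K) * x) p ∂(regionMeasure D))
      (gammaFull K s *
        ((|(Algebra.norm ℚ x : ℝ)| : ℝ) : ℂ) ^ (-(2 * s / finrank ℚ K))) := by
  have h2 := hasSum_prod_snd (α := torsion K) (hasSum_unitLattice hD hs hx)
  rw [integral_phi hs hx] at h2
  rw [gammaFull, mul_assoc, mul_assoc]
  rw [← (Equiv.ofBijective _ bijective_torsion_mul).hasSum_iff]
  simp only [← integral_phi_torsion_mul D hs hx] at h2
  exact h2

end NumberFieldTheta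

namespace NumberFieldTheta

open NumberField InfinitePlace GaussPoisson Module MeasureTheory Set Filter Topology Asymptotics
open NumberField.Units NumberField.Units.dirichletUnitTheorem
open scoped Classical Pointwise

variable {K : Type*} [Field K] [NumberField K]

lemma mellin_eq_integral_exp (f : ℝ → ℂ) (s : ℂ) :
    mellin f s = ∫ τ : ℝ, Complex.exp (s * τ) * f (Real.exp τ) := by
  have hd : ∀ x ∈ (univ : Set ℝ), HasDerivWithinAt Real.exp (Real.exp x) univ x := fun x _ =>
    (Real.hasDerivAt_exp x).hasDerivWithinAt
  have him : Set.image Real.exp univ = Ioi 0 := by rw [image_univ, Real.range_exp]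
  have h2 := integral_image_eq_integral_abs_deriv_smul MeasurableSet.univ hd
    Real.exp_injective.injOn (fun t : ℝ => (t : ℂ) ^ (s - 1) • f t)
  rw [him, Measure.restrict_univ] at h2
  rw [mellin, h2]
  congr 1
  ext z
  rw [abs_of_pos (Real.exp_pos z), Complex.real_smul, smul_eq_mul, ← mul_assoc]
  congr 1
  rw [Complex.cpow_def_of_ne_zero (by exact_mod_cast (Real.exp_pos z).ne'),
    ← Complex.ofReal_log (Real.exp_pos z).le, Real.log_exp, Complex.ofReal_exp,
    ← Complex.exp_add]
  ring_nf

lemma integrable_tsum_of_summable_integral_norm {α ι : Type*} [MeasurableSpace α] {μ : Measure α}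
    [Countable ι] {F : ι → α → ℂ} (hF : ∀ i, Integrable (F i) μ)
    (hs : Summable fun i => ∫ a, ‖F i a‖ ∂μ) {G : α → ℂ} (hG : ∀ a, HasSum (fun i => F i a) (G a)) :
    Integrable G μ := by
  have hm : AEStronglyMeasurable G μ := by
    have e : G = fun a => ∑' i, F i a := funext fun a => (hG a).tsum_eq.symm
    rw [e]
    exact (AEMeasurable.tsum fun i => (hF i).1.aemeasurable).aestronglyMeasurable
  refine ⟨hm, ?_⟩
  rw [hasFiniteIntegral_iff_enorm]
  have h1 : ∀ a, ‖G a‖ₑ ≤ ∑' i, ‖F i a‖ₑ := fun a => by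
    rw [← (hG a).tsum_eq]; exact enorm_tsum_le_tsum_enorm
  refine (lintegral_mono h1).trans_lt ?_
  rw [lintegral_tsum fun i => (hF i).1.enorm]
  have h2 : ∀ i, ∫⁻ a, ‖F i a‖ₑ ∂μ = ENNReal.ofReal (∫ a, ‖F i a‖ ∂μ) := fun i =>
    (ofReal_integral_norm_eq_lintegral_enorm (hF i)).symm
  simp only [h2]
  exact hs.tsum_ofReal_lt_top

variable {ι : Type*} [Fintype ι]

lemma hasSum_mellin (b : Basis ι ℚ K) {D : Set (logSpace K)} (hD : Bornology.IsBounded D)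
    (hDm : MeasurableSet D) {s : ℂ} (hs : 0 < s.re)
    (hsum : Summable fun m : {m : ι → ℤ // m ≠ 0} =>
      ∫ p, ‖phi s (elt b m) p‖ ∂(regionMeasure D)) :
    HasSum (fun m : {m : ι → ℤ // m ≠ 0} => ∫ p, phi s (elt b m) p ∂(regionMeasure D))
      (mellin (fun t => (thetaInt b D t : ℂ) - (volume.real D : ℂ)) s) := by
  have hi : ∀ m : {m : ι → ℤ // m ≠ 0}, Integrable (phi s (elt b m)) (regionMeasure D) := fun m =>
    integrable_phi_region D hs (elt_ne_zero b m.2)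
  have hG : ∀ p : ℝ × logSpace K, HasSum (fun m : {m : ι → ℤ // m ≠ 0} => phi s (elt b m) p)
      (Complex.exp (s * p.1) * ((theta b (wt (Real.exp p.1) p.2) - 1 : ℝ) : ℂ)) := fun p =>
    (Complex.hasSum_ofReal.2 (hasSum_theta_sub_one b (Real.exp_pos p.1) p.2)).mul_left _
  have h := hasSum_integral_of_summable_integral_norm hi hsum
  have hI := integrable_tsum_of_summable_integral_norm hi hsum hG
  simp only [fun p => (hG p).tsum_eq] at h
  have e : mellin (fun t => (thetaInt b D t : ℂ) - (volume.real D : ℂ)) s =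
      ∫ p, Complex.exp (s * p.1) * ((theta b (wt (Real.exp p.1) p.2) - 1 : ℝ) : ℂ)
        ∂(regionMeasure D) := by
    rw [mellin_eq_integral_exp, integral_prod _ hI]
    congr 1
    ext τ
    refine Eq.trans ?_ (integral_const_mul (Complex.exp (s * τ)) _).symm
    rw [← Complex.ofReal_sub, thetaInt_sub b hD hDm (Real.exp_pos τ),
      integral_complex_ofReal]
  rw [e]
  exact h

end NumberFieldTheta

namespace NumberFieldTheta

open NumberField InfinitePlace GaussPoisson Module MeasureTheory Set Filter Topology Asymptotics
open NumberField.Units NumberField.Units.dirichletUnitTheorem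
open scoped Classical Pointwise nonZeroDivisors

variable {K : Type*} [Field K] [NumberField K]

variable (K) in
/-- The type of non-zero integral ideals. -/
abbrev NZIdeal : Type _ := {I : Ideal (𝓞 K) // I ≠ ⊥}

/-- A non-zero integral ideal as an invertible fractional ideal. -/
noncomputable def fracUnit (I : NZIdeal K) : (FractionalIdeal (𝓞 K)⁰ K)ˣ :=
  Units.mk0 (I.1 : FractionalIdeal (𝓞 K)⁰ K) (FractionalIdeal.coeIdeal_ne_zero.2 I.2)

/-- The ideal class of a non-zero integral ideal. -/
noncomputable def cls (I : NZIdeal K) : ClassGroup (𝓞 K) := ClassGroup.mk K (fracUnit I)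

variable {ι : Type*} [Fintype ι]

/-- The basis `b` is a `ℤ`-basis of the fractional ideal `J`. -/
def IsBasisOf (b : Basis ι ℚ K) (J : (FractionalIdeal (𝓞 K)⁰ K)ˣ) : Prop :=
  ∀ x : K, (∃ m : ι → ℤ, elt b m = x) ↔ x ∈ (J : FractionalIdeal (𝓞 K)⁰ K)

lemma exists_generator {I : NZIdeal K} {J : (FractionalIdeal (𝓞 K)⁰ K)ˣ}
    (h : cls I = (ClassGroup.mk K J)⁻¹) :
    ∃ x : K, FractionalIdeal.spanSingleton (𝓞 K)⁰ x = I.1 * J := by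
  have h1 : ClassGroup.mk K (fracUnit I * J) = 1 := by
    rw [map_mul]; exact mul_eq_one_iff_eq_inv.2 h
  rw [ClassGroup.mk_eq_one_iff, FractionalIdeal.isPrincipal_iff] at h1
  obtain ⟨x, hx⟩ := h1
  exact ⟨x, by rw [← hx]; rfl⟩

lemma cls_eq_of_generator {I : NZIdeal K} {J : (FractionalIdeal (𝓞 K)⁰ K)ˣ} {x : K}
    (h : FractionalIdeal.spanSingleton (𝓞 K)⁰ x = I.1 * J) : cls I = (ClassGroup.mk K J)⁻¹ := by
  rw [← mul_eq_one_iff_eq_inv, cls, ← map_mul, ClassGroup.mk_eq_one_iff,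
    FractionalIdeal.isPrincipal_iff]
  exact ⟨x, by rw [h]; rfl⟩

/-- A generator of the principal ideal `I * J`. -/
noncomputable def gen {J : (FractionalIdeal (𝓞 K)⁰ K)ˣ}
    (I : {I : NZIdeal K // cls I = (ClassGroup.mk K J)⁻¹}) : K := (exists_generator I.2).choose

lemma span_gen {J : (FractionalIdeal (𝓞 K)⁰ K)ˣ}
    (I : {I : NZIdeal K // cls I = (ClassGroup.mk K J)⁻¹}) :
    FractionalIdeal.spanSingleton (𝓞 K)⁰ (gen I) = I.1.1 * J := (exists_generator I.2).choose_spec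

lemma gen_ne_zero {J : (FractionalIdeal (𝓞 K)⁰ K)ˣ}
    (I : {I : NZIdeal K // cls I = (ClassGroup.mk K J)⁻¹}) : gen I ≠ 0 := fun h => by
  have h1 := span_gen I
  rw [h, FractionalIdeal.spanSingleton_zero] at h1
  exact mul_ne_zero (FractionalIdeal.coeIdeal_ne_zero.2 I.1.2) J.ne_zero h1.symm

lemma span_unit_mul (u : (𝓞 K)ˣ) (x : K) :
    FractionalIdeal.spanSingleton (𝓞 K)⁰ ((u : K) * x) =
      FractionalIdeal.spanSingleton (𝓞 K)⁰ x :=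
  (FractionalIdeal.spanSingleton_eq_spanSingleton.2 ⟨u, by
    rw [Units.smul_def, Algebra.smul_def]⟩).symm

lemma coeIdeal_mul_le (I : Ideal (𝓞 K)) (J : FractionalIdeal (𝓞 K)⁰ K) :
    (I : FractionalIdeal (𝓞 K)⁰ K) * J ≤ J :=
  (mul_le_mul_left FractionalIdeal.coeIdeal_le_one J).trans_eq (one_mul J)

lemma unit_mul_gen_mem {J : (FractionalIdeal (𝓞 K)⁰ K)ˣ}
    (p : {I : NZIdeal K // cls I = (ClassGroup.mk K J)⁻¹} × (𝓞 K)ˣ) :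
    (p.2 : K) * gen p.1 ∈ (J : FractionalIdeal (𝓞 K)⁰ K) := by
  rw [← FractionalIdeal.spanSingleton_le_iff_mem, span_unit_mul, span_gen]
  exact coeIdeal_mul_le _ _

/-- Coordinates of the generators of the ideals in an ideal class. -/
noncomputable def genCoord {b : Basis ι ℚ K} {J : (FractionalIdeal (𝓞 K)⁰ K)ˣ}
    (hb : IsBasisOf b J) (p : {I : NZIdeal K // cls I = (ClassGroup.mk K J)⁻¹} × (𝓞 K)ˣ) :
    ι → ℤ := ((hb _).2 (unit_mul_gen_mem p)).choose

lemma elt_genCoord {b : Basis ι ℚ K} {J : (FractionalIdeal (𝓞 K)⁰ K)ˣ}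
    (hb : IsBasisOf b J) (p : {I : NZIdeal K // cls I = (ClassGroup.mk K J)⁻¹} × (𝓞 K)ˣ) :
    elt b (genCoord hb p) = (p.2 : K) * gen p.1 := ((hb _).2 (unit_mul_gen_mem p)).choose_spec

lemma genCoord_ne_zero {b : Basis ι ℚ K} {J : (FractionalIdeal (𝓞 K)⁰ K)ˣ}
    (hb : IsBasisOf b J) (p : {I : NZIdeal K // cls I = (ClassGroup.mk K J)⁻¹} × (𝓞 K)ˣ) :
    genCoord hb p ≠ 0 := fun h => by
  have h1 := elt_genCoord hb p
  rw [h, elt_zero] at h1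
  exact mul_ne_zero (coe_ne_zero p.2) (gen_ne_zero p.1) h1.symm

lemma bijective_genCoord {b : Basis ι ℚ K} {J : (FractionalIdeal (𝓞 K)⁰ K)ˣ}
    (hb : IsBasisOf b J) : Function.Bijective
      (fun p : {I : NZIdeal K // cls I = (ClassGroup.mk K J)⁻¹} × (𝓞 K)ˣ =>
        (⟨genCoord hb p, genCoord_ne_zero hb p⟩ : {m : ι → ℤ // m ≠ 0})) := by
  constructor
  · intro p p' h
    have h1 : (p.2 : K) * gen p.1 = (p'.2 : K) * gen p'.1 := by
      rw [← elt_genCoord hb, ← elt_genCoord hb]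
      exact congrArg (elt b) (Subtype.ext_iff.1 h)
    have h2 := congrArg (FractionalIdeal.spanSingleton (𝓞 K)⁰) h1
    rw [span_unit_mul, span_unit_mul, span_gen, span_gen] at h2
    have h3 := mul_right_cancel₀ J.ne_zero h2
    have h4 : p.1 = p'.1 := Subtype.ext (Subtype.ext (FractionalIdeal.coeIdeal_inj.1 h3))
    rw [h4] at h1
    have h5 := mul_right_cancel₀ (gen_ne_zero _) h1
    exact Prod.ext h4 (Units.coe_injective K h5)
  · intro m
    have hx := (hb (elt b m.1)).1 ⟨m.1, rfl⟩
    have hx0 := elt_ne_zero b m.2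
    have hle : FractionalIdeal.spanSingleton (𝓞 K)⁰ (elt b m.1) * (J⁻¹ : (FractionalIdeal (𝓞 K)⁰ K)ˣ) ≤ 1 := by
      have h := mul_le_mul_left (FractionalIdeal.spanSingleton_le_iff_mem.2 hx)
        ((J⁻¹ : (FractionalIdeal (𝓞 K)⁰ K)ˣ) : FractionalIdeal (𝓞 K)⁰ K)
      rwa [Units.mul_inv] at h
    obtain ⟨I, hI⟩ := FractionalIdeal.le_one_iff_exists_coeIdeal.1 hle
    have hspan : FractionalIdeal.spanSingleton (𝓞 K)⁰ (elt b m.1) = I * J := by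
      rw [hI, mul_assoc, Units.inv_mul, mul_one]
    have hI0 : I ≠ ⊥ := by
      rintro rfl
      rw [FractionalIdeal.coeIdeal_bot, zero_mul, FractionalIdeal.spanSingleton_eq_zero_iff]
        at hspan
      exact hx0 hspan
    let I' : {I : NZIdeal K // cls I = (ClassGroup.mk K J)⁻¹} :=
      ⟨⟨I, hI0⟩, cls_eq_of_generator hspan⟩
    have h6 : FractionalIdeal.spanSingleton (𝓞 K)⁰ (gen I') =
        FractionalIdeal.spanSingleton (𝓞 K)⁰ (elt b m.1) := by rw [span_gen, hspan]
    obtain ⟨u, hu⟩ := FractionalIdeal.spanSingleton_eq_spanSingleton.1 h6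
    refine ⟨(I', u), Subtype.ext (elt_injective b ?_)⟩
    rw [elt_genCoord, ← hu, Units.smul_def, Algebra.smul_def]

lemma abs_norm_gen {J : (FractionalIdeal (𝓞 K)⁰ K)ˣ}
    (I : {I : NZIdeal K // cls I = (ClassGroup.mk K J)⁻¹}) :
    |(Algebra.norm ℚ (gen I) : ℝ)| = (Ideal.absNorm I.1.1 : ℝ) *
      (FractionalIdeal.absNorm (J : FractionalIdeal (𝓞 K)⁰ K) : ℝ) := by
  have h := congrArg FractionalIdeal.absNorm (span_gen I)
  rw [FractionalIdeal.absNorm_span_singleton, map_mul, FractionalIdeal.coeIdeal_absNorm] at h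
  exact_mod_cast congrArg (fun r : ℚ => (r : ℝ)) h

lemma absNorm_unit_pos (J : (FractionalIdeal (𝓞 K)⁰ K)ˣ) :
    0 < (FractionalIdeal.absNorm (J : FractionalIdeal (𝓞 K)⁰ K) : ℝ) := by
  have h := lt_of_le_of_ne (FractionalIdeal.absNorm_nonneg (J : FractionalIdeal (𝓞 K)⁰ K))
    (fun h => J.ne_zero (FractionalIdeal.absNorm_eq_zero_iff.1 h.symm))
  exact_mod_cast h

/-- The term of the Dedekind zeta function at `2 s / n`. -/
noncomputable def zterm (s : ℂ) (I : NZIdeal K) : ℂ :=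
  ((Ideal.absNorm I.1 : ℕ) : ℂ) ^ (-(2 * s / finrank ℚ K))

lemma abs_norm_gen_cpow {J : (FractionalIdeal (𝓞 K)⁰ K)ˣ} (s : ℂ)
    (I : {I : NZIdeal K // cls I = (ClassGroup.mk K J)⁻¹}) :
    ((|(Algebra.norm ℚ (gen I) : ℝ)| : ℝ) : ℂ) ^ (-(2 * s / finrank ℚ K)) =
      zterm s I.1 * ((FractionalIdeal.absNorm (J : FractionalIdeal (𝓞 K)⁰ K) : ℝ) : ℂ) ^
        (-(2 * s / finrank ℚ K)) := by
  rw [abs_norm_gen, Complex.ofReal_mul, Complex.mul_cpow_ofReal_nonneg (Nat.cast_nonneg _)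
    (absNorm_unit_pos J).le, zterm, Complex.ofReal_natCast]

lemma summable_integral_norm {b : Basis ι ℚ K} {J : (FractionalIdeal (𝓞 K)⁰ K)ˣ}
    (hb : IsBasisOf b J) {D : Set (logSpace K)}
    (hDf : IsAddFundamentalDomain (unitLattice K) D volume) {s : ℂ} (hs : 0 < s.re)
    (hz : Summable (zterm (K := K) (s.re : ℂ))) :
    Summable fun m : {m : ι → ℤ // m ≠ 0} => ∫ p, ‖phi s (elt b m) p‖ ∂(regionMeasure D) := by
  rw [← (Equiv.ofBijective _ (bijective_genCoord hb)).summable_iff]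
  have hs' : 0 < ((s.re : ℝ) : ℂ).re := hs
  have key : ∀ I : {I : NZIdeal K // cls I = (ClassGroup.mk K J)⁻¹},
      HasSum (fun u : (𝓞 K)ˣ => ∫ p, ‖phi s ((u : K) * gen I) p‖ ∂(regionMeasure D))
        (gammaFull K (s.re : ℂ) * (zterm (s.re : ℂ) I.1 *
          ((FractionalIdeal.absNorm (J : FractionalIdeal (𝓞 K)⁰ K) : ℝ) : ℂ) ^
            (-(2 * (s.re : ℂ) / finrank ℚ K)))).re := fun I => by
    have h := hasSum_units hDf hs' (gen_ne_zero I)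
    rw [abs_norm_gen_cpow] at h
    refine (Complex.hasSum_re h).congr_fun fun u => ?_
    simp only [← norm_phi]
    rw [integral_complex_ofReal, Complex.ofReal_re]
  have e : (fun m : {m : ι → ℤ // m ≠ 0} => ∫ p, ‖phi s (elt b m) p‖ ∂(regionMeasure D)) ∘
      (Equiv.ofBijective _ (bijective_genCoord hb)) =
      fun p => ∫ z, ‖phi s ((p.2 : K) * gen p.1) z‖ ∂(regionMeasure D) := by
    ext p
    simp only [Function.comp_apply, Equiv.ofBijective_apply, elt_genCoord]
  rw [e, summable_prod_of_nonneg fun p => integral_nonneg fun _ => norm_nonneg _]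
  refine ⟨fun I => (key I).summable, ?_⟩
  simp only [fun I => (key I).tsum_eq]
  exact (Complex.hasSum_re (((hz.subtype _).mul_right _).mul_left _).hasSum).summable

lemma hasSum_class {b : Basis ι ℚ K} {J : (FractionalIdeal (𝓞 K)⁰ K)ˣ}
    (hb : IsBasisOf b J) {D : Set (logSpace K)} (hD : Bornology.IsBounded D)
    (hDm : MeasurableSet D) (hDf : IsAddFundamentalDomain (unitLattice K) D volume) {s : ℂ}
    (hs : 0 < s.re) (hz : Summable (zterm (K := K) (s.re : ℂ))) :
    HasSum (fun I : {I : NZIdeal K // cls I = (ClassGroup.mk K J)⁻¹} =>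
      gammaFull K s * (zterm s I.1 *
          ((FractionalIdeal.absNorm (J : FractionalIdeal (𝓞 K)⁰ K) : ℝ) : ℂ) ^
            (-(2 * s / finrank ℚ K))))
      (mellin (fun t => (thetaInt b D t : ℂ) - (volume.real D : ℂ)) s) := by
  have h := hasSum_mellin b hD hDm hs (summable_integral_norm hb hDf hs hz)
  rw [← (Equiv.ofBijective _ (bijective_genCoord hb)).hasSum_iff] at h
  refine h.prod_fiberwise fun I => ?_
  have h2 := hasSum_units hDf hs (gen_ne_zero I)
  rw [abs_norm_gen_cpow] at h2
  refine h2.congr_fun fun u => ?_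
  simp only [Function.comp_apply, Equiv.ofBijective_apply, elt_genCoord]

end NumberFieldTheta

namespace NumberFieldTheta

open NumberField InfinitePlace GaussPoisson Module MeasureTheory Set Filter Topology Asymptotics
open NumberField.Units NumberField.Units.dirichletUnitTheorem
open scoped Classical Pointwise nonZeroDivisors

variable {K : Type*} [Field K] [NumberField K] {ι : Type*} [Fintype ι]

lemma isBasisOf_iff (b : Basis ι ℚ K) (J : (FractionalIdeal (𝓞 K)⁰ K)ˣ) : IsBasisOf b J ↔
    Submodule.restrictScalars ℤ ((J : FractionalIdeal (𝓞 K)⁰ K) : Submodule (𝓞 K) K) =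
      Submodule.span ℤ (range b) := by
  rw [Submodule.ext_iff, IsBasisOf]
  refine forall_congr' fun x => ?_
  rw [Submodule.mem_span_range_iff_exists_fun, Submodule.restrictScalars_mem,
    FractionalIdeal.mem_coe]
  exact iff_comm

lemma isBasisOf_basisOfFractionalIdeal (J : (FractionalIdeal (𝓞 K)⁰ K)ˣ) :
    IsBasisOf (basisOfFractionalIdeal K J) J := by
  intro x
  rw [← FractionalIdeal.mem_coe, ← SetLike.mem_coe (p := ((J : FractionalIdeal (𝓞 K)⁰ K) : Submodule (𝓞 K) K))]
  have := mem_span_basisOfFractionalIdeal K (I := J) (x := x)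
  rw [Submodule.mem_span_range_iff_exists_fun] at this
  exact this

/-- The dual of an invertible fractional ideal for the trace form. -/
noncomputable def dualUnit (J : (FractionalIdeal (𝓞 K)⁰ K)ˣ) : (FractionalIdeal (𝓞 K)⁰ K)ˣ :=
  Units.mk0 (FractionalIdeal.dual ℤ ℚ (J : FractionalIdeal (𝓞 K)⁰ K))
    (FractionalIdeal.dual_ne_zero ℤ ℚ J.ne_zero)

lemma dualUnit_eq (J : (FractionalIdeal (𝓞 K)⁰ K)ˣ) : dualUnit J = dualUnit 1 * J⁻¹ := by
  ext1
  rw [Units.val_mul, Units.val_inv_eq_inv_val]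
  exact FractionalIdeal.dual_eq_mul_inv ℤ ℚ _

lemma IsBasisOf.dual {b : Basis ι ℚ K} {J : (FractionalIdeal (𝓞 K)⁰ K)ˣ} (hb : IsBasisOf b J) :
    IsBasisOf (dualB b) (dualUnit J) := by
  rw [isBasisOf_iff] at hb ⊢
  have h := Submodule.traceDual_span_of_basis ℤ (K := ℚ) _ b hb
  rw [dualUnit, Units.val_mk0, FractionalIdeal.coe_dual ℤ ℚ J.ne_zero, h]
  rfl

lemma toMatrix_isIntegral {ι' : Type*} [Fintype ι'] {b : Basis ι ℚ K} {b' : Basis ι' ℚ K}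
    {J : (FractionalIdeal (𝓞 K)⁰ K)ˣ} (hb : IsBasisOf b J) (hb' : IsBasisOf b' J) (i : ι) (j : ι') :
    IsIntegral ℤ (b.toMatrix b' i j) := by
  rw [isBasisOf_iff] at hb hb'
  have h : b' j ∈ Submodule.span ℤ (range b) := by
    rw [← hb, hb']; exact Submodule.subset_span ⟨j, rfl⟩
  obtain ⟨z, hz⟩ := (b.mem_span_iff_repr_mem ℤ (b' j)).1 h i
  rw [Basis.toMatrix_apply, ← hz]
  exact isIntegral_algebraMap

lemma covol_eq {b : Basis ι ℚ K} {J : (FractionalIdeal (𝓞 K)⁰ K)ˣ} (hb : IsBasisOf b J) :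
    covol b = (FractionalIdeal.absNorm (J : FractionalIdeal (𝓞 K)⁰ K) : ℝ) *
      √|(discr K : ℝ)| := by
  have h1 := Algebra.discr_eq_discr_of_toMatrix_coeff_isIntegral K
    (toMatrix_isIntegral hb (isBasisOf_basisOfFractionalIdeal J))
    (toMatrix_isIntegral (isBasisOf_basisOfFractionalIdeal J) hb)
  let e : Free.ChooseBasisIndex ℤ (𝓞 K) ≃ Free.ChooseBasisIndex ℤ
      ((J : FractionalIdeal (𝓞 K)⁰ K) : Submodule (𝓞 K) K) :=
    (integralBasis K).indexEquiv (basisOfFractionalIdeal K J)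
  have h2 := det_basisOfFractionalIdeal_eq_absNorm K J e
  have h3 := Algebra.discr_of_matrix_vecMul (integralBasis K)
    ((integralBasis K).toMatrix ((basisOfFractionalIdeal K J).reindex e.symm))
  rw [Basis.toMatrix_map_vecMul, Basis.coe_reindex, Algebra.discr_reindex, ← Basis.coe_reindex,
    ← Basis.det_apply] at h3
  rw [covol, h1]
  have h4 : (Algebra.discr ℚ (basisOfFractionalIdeal K J) : ℝ) =
      ((integralBasis K).det ((basisOfFractionalIdeal K J).reindex e.symm) : ℝ) ^ 2 *
        (discr K : ℝ) := by
    have h5 := congrArg (fun r : ℚ => (r : ℝ)) h3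
    rw [← coe_discr] at h5
    push_cast at h5
    exact_mod_cast h5
  rw [h4, abs_mul, abs_pow, ← Rat.cast_abs, h2, Real.sqrt_mul (by positivity),
    Real.sqrt_sq (absNorm_unit_pos J).le]

lemma absNorm_dual (J : (FractionalIdeal (𝓞 K)⁰ K)ˣ) :
    (FractionalIdeal.absNorm (J : FractionalIdeal (𝓞 K)⁰ K) : ℝ) * √|(discr K : ℝ)| *
    ((FractionalIdeal.absNorm (dualUnit J : FractionalIdeal (𝓞 K)⁰ K) : ℝ) * √|(discr K : ℝ)|) = 1 := by
  have hb := isBasisOf_basisOfFractionalIdeal J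
  rw [← covol_eq hb, ← covol_eq hb.dual, covol_mul_covol_dual]

variable (K) in
lemma mk_surjective : Function.Surjective (ClassGroup.mk K : _ →* ClassGroup (𝓞 K)) := by
  intro c
  obtain ⟨I, rfl⟩ := ClassGroup.mk0_surjective c
  exact ⟨FractionalIdeal.mk0 K I, ClassGroup.mk_mk0 K I⟩

variable (K) in
/-- A fundamental domain for the unit lattice. -/
noncomputable def unitDomain : Set (logSpace K) :=
  ZSpan.fundamentalDomain ((basisUnitLattice K).ofZLatticeBasis ℝ (unitLattice K))

variable (K) in
lemma isAddFundamentalDomain_unitDomain :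
    IsAddFundamentalDomain (unitLattice K) (unitDomain K) volume :=
  ZLattice.isAddFundamentalDomain (basisUnitLattice K) volume

variable (K) in
lemma isAddFundamentalDomain_neg_unitDomain :
    IsAddFundamentalDomain (unitLattice K) (-unitDomain K) volume := by
  have h := (isAddFundamentalDomain_unitDomain K).image_of_equiv (Equiv.neg (logSpace K))
    (Measure.measurePreserving_neg volume).quasiMeasurePreserving (Equiv.neg (unitLattice K))
    (fun g x => by
      change -((-(g : logSpace K)) + x) = (g : logSpace K) + -x
      abel)
  have e : Set.image (Equiv.neg (logSpace K)) (unitDomain K) = -unitDomain K := image_neg_eq_neg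
  rwa [e] at h

variable (K) in
lemma isBounded_unitDomain : Bornology.IsBounded (unitDomain K) :=
  ZSpan.fundamentalDomain_isBounded _

variable (K) in
lemma measurableSet_unitDomain : MeasurableSet (unitDomain K) :=
  ZSpan.fundamentalDomain_measurableSet _

end NumberFieldTheta

namespace NumberFieldTheta

open NumberField InfinitePlace GaussPoisson Module MeasureTheory Set Filter Topology Asymptotics
open NumberField.Units NumberField.Units.dirichletUnitTheorem
open scoped Classical Pointwise nonZeroDivisors

variable {K : Type*} [Field K] [NumberField K] {ι : Type*} [Fintype ι]

/-- The part of the Dedekind zeta series attached to an ideal class. -/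
noncomputable def zpart (s : ℂ) (c : ClassGroup (𝓞 K)) : ℂ :=
  ∑' I : {I : NZIdeal K // cls I = c}, zterm s I.1

lemma sum_zpart {s z : ℂ} (h : HasSum (zterm (K := K) s) z) : ∑ c : ClassGroup (𝓞 K), zpart s c = z := by
  have h1 : HasSum (fun p : (c : ClassGroup (𝓞 K)) × {I : NZIdeal K // cls I = c} =>
      zterm s p.2.1) z := (Equiv.sigmaFiberEquiv (cls (K := K))).hasSum_iff.2 h
  have h2 := h1.sigma (g := zpart s) fun c =>
    (h.summable.subtype (fun I => cls I = c)).hasSum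
  rw [← h2.tsum_eq, tsum_fintype]

/-- The absolute norm of an invertible fractional ideal. -/
noncomputable def nrm (J : (FractionalIdeal (𝓞 K)⁰ K)ˣ) : ℝ :=
  (FractionalIdeal.absNorm (J : FractionalIdeal (𝓞 K)⁰ K) : ℝ)

lemma mellin_eq_class {b : Basis ι ℚ K} {J : (FractionalIdeal (𝓞 K)⁰ K)ˣ}
    (hb : IsBasisOf b J) {D : Set (logSpace K)} (hD : Bornology.IsBounded D)
    (hDm : MeasurableSet D) (hDf : IsAddFundamentalDomain (unitLattice K) D volume) {s : ℂ}
    (hs : 0 < s.re) (hz : Summable (zterm (K := K) (s.re : ℂ))) :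
    mellin (fun t => (thetaInt b D t : ℂ) - (volume.real D : ℂ)) s =
      gammaFull K s * (zpart s (ClassGroup.mk K J)⁻¹ *
        (nrm J : ℂ) ^ (-(2 * s / finrank ℚ K))) := by
  rw [← (hasSum_class hb hD hDm hDf hs hz).tsum_eq, tsum_mul_left, tsum_mul_right]
  rfl

variable (K) in
/-- A fractional ideal in the inverse of a given class. -/
noncomputable def rep (c : ClassGroup (𝓞 K)) : (FractionalIdeal (𝓞 K)⁰ K)ˣ :=
  (mk_surjective K c⁻¹).choose

lemma mk_rep (c : ClassGroup (𝓞 K)) : (ClassGroup.mk K (rep K c))⁻¹ = c :=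
  inv_eq_iff_eq_inv.2 (mk_surjective K c⁻¹).choose_spec

/-- The theta functional equation of an ideal class. -/
noncomputable def clsPair (c : ClassGroup (𝓞 K)) : WeakFEPair ℂ :=
  thetaPair (basisOfFractionalIdeal K (rep K c)) (isBounded_unitDomain K) (measurableSet_unitDomain K)

lemma clsPair_Λ {c : ClassGroup (𝓞 K)} {s : ℂ} (hs : (finrank ℚ K : ℝ) / 2 < s.re)
    (hz : Summable (zterm (K := K) (s.re : ℂ))) :
    (clsPair c).Λ s = gammaFull K s * (zpart s c *
        (nrm (rep K c) : ℂ) ^ (-(2 * s / finrank ℚ K))) := by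
  have h0 : 0 < s.re := lt_of_le_of_lt (by positivity) hs
  rw [← ((clsPair c).hasMellin hs).2]
  have h := mellin_eq_class (isBasisOf_basisOfFractionalIdeal (rep K c)) (isBounded_unitDomain K)
    (measurableSet_unitDomain K) (isAddFundamentalDomain_unitDomain K) h0 hz
  rw [mk_rep] at h
  exact h

lemma clsPair_symm_Λ {c : ClassGroup (𝓞 K)} {s : ℂ} (hs : (finrank ℚ K : ℝ) / 2 < s.re)
    (hz : Summable (zterm (K := K) (s.re : ℂ))) :
    (clsPair c).symm.Λ s = gammaFull K s * (zpart s (ClassGroup.mk K (dualUnit (rep K c)))⁻¹ *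
        (nrm (dualUnit (rep K c)) : ℂ) ^ (-(2 * s / finrank ℚ K))) := by
  have h0 : 0 < s.re := lt_of_le_of_lt (by positivity) hs
  rw [← ((clsPair c).symm.hasMellin hs).2]
  exact mellin_eq_class (isBasisOf_basisOfFractionalIdeal (rep K c)).dual
    (isBounded_unitDomain K).neg (measurableSet_unitDomain K).neg
    (isAddFundamentalDomain_neg_unitDomain K) h0 hz

lemma bijective_dual_class :
    Function.Bijective fun c : ClassGroup (𝓞 K) => (ClassGroup.mk K (dualUnit (rep K c)))⁻¹ := by
  have e : (fun c : ClassGroup (𝓞 K) => (ClassGroup.mk K (dualUnit (rep K c)))⁻¹) =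
      fun c => ((ClassGroup.mk K (dualUnit (1 : (FractionalIdeal (𝓞 K)⁰ K)ˣ))) * c)⁻¹ := by
    ext1 c
    rw [dualUnit_eq, map_mul, map_inv, mk_rep]
  rw [e]
  exact (inv_involutive.bijective).comp (Group.mulLeft_bijective _)

variable (K) in
/-- The square root of the absolute discriminant. -/
noncomputable def rootDisc : ℝ := √|(discr K : ℝ)|

variable (K) in
lemma rootDisc_pos : 0 < rootDisc K :=
  Real.sqrt_pos.2 (abs_pos.2 (by exact_mod_cast discr_ne_zero K))

variable (K) in
/-- The completed zeta function built from the theta functions of the ideal classes. -/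
noncomputable def completed (s : ℂ) : ℂ :=
  (rootDisc K : ℂ) ^ (2 * s / finrank ℚ K) *
    ∑ c, (nrm (rep K c) : ℂ) ^ (2 * s / finrank ℚ K) * (clsPair c).Λ s

lemma nrm_pos (J : (FractionalIdeal (𝓞 K)⁰ K)ˣ) : 0 < nrm J := absNorm_unit_pos J

lemma completed_eq {s z : ℂ} (hs : (finrank ℚ K : ℝ) / 2 < s.re)
    (hz : Summable (zterm (K := K) (s.re : ℂ))) (h : HasSum (zterm (K := K) s) z) :
    completed K s = (rootDisc K : ℂ) ^ (2 * s / finrank ℚ K) * (gammaFull K s * z) := by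
  rw [completed, ← sum_zpart h, Finset.mul_sum (f := zpart s)]
  congr 1
  refine Finset.sum_congr rfl fun c _ => ?_
  have h0 : (nrm (rep K c) : ℂ) ≠ 0 := by exact_mod_cast (nrm_pos _).ne'
  rw [clsPair_Λ hs hz, Complex.cpow_neg]
  have h1 : (nrm (rep K c) : ℂ) ^ (2 * s / finrank ℚ K) ≠ 0 := by simp [Complex.cpow_eq_zero_iff, h0]
  field_simp

lemma completed_sub_eq {s z : ℂ} (hs : (finrank ℚ K : ℝ) / 2 < s.re)
    (hz : Summable (zterm (K := K) (s.re : ℂ))) (h : HasSum (zterm (K := K) s) z) :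
    completed K ((finrank ℚ K : ℝ) / 2 - s) =
      (rootDisc K : ℂ) ^ (2 * s / finrank ℚ K) * (gammaFull K s * z) := by
  have hn : (finrank ℚ K : ℂ) ≠ 0 := by exact_mod_cast finrank_pos.ne'
  have hr : (rootDisc K : ℂ) ≠ 0 := by exact_mod_cast (rootDisc_pos K).ne'
  rw [completed, ← sum_zpart h, ← bijective_dual_class.sum_comp (zpart s), Finset.mul_sum,
    Finset.mul_sum, Finset.mul_sum]
  refine Finset.sum_congr rfl fun c _ => ?_
  have hfe := (clsPair c).functional_equation s
  have hk : ((clsPair c).k : ℂ) = (finrank ℚ K : ℝ) / 2 := by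
    change ((((finrank ℚ K : ℝ) / 2 : ℝ)) : ℂ) = _
    push_cast; rfl
  have hε : (clsPair c).ε = ((nrm (rep K c) * rootDisc K : ℝ) : ℂ)⁻¹ := by
    change (((covol (basisOfFractionalIdeal K (rep K c)))⁻¹ : ℝ) : ℂ) = _
    rw [covol_eq (isBasisOf_basisOfFractionalIdeal _)]
    push_cast; rfl
  rw [hk] at hfe
  rw [hfe, clsPair_symm_Λ hs hz, hε, smul_eq_mul]
  have hN : (nrm (rep K c) : ℂ) ≠ 0 := by exact_mod_cast (nrm_pos _).ne'
  have hdual : (nrm (dualUnit (rep K c)) : ℂ) ^ (-(2 * s / finrank ℚ K)) =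
      (nrm (rep K c) : ℂ) ^ (2 * s / finrank ℚ K) * ((rootDisc K : ℂ) ^ (2 * s / finrank ℚ K) *
        (rootDisc K : ℂ) ^ (2 * s / finrank ℚ K)) := by
    have h1 : nrm (rep K c) * rootDisc K * (nrm (dualUnit (rep K c)) * rootDisc K) = 1 :=
      absNorm_dual _
    have h2 : (nrm (dualUnit (rep K c)) : ℝ) = (nrm (rep K c) * (rootDisc K * rootDisc K))⁻¹ :=
      eq_inv_of_mul_eq_one_left (by linarith)
    rw [h2, Complex.ofReal_inv, Complex.inv_cpow _ _ (by
      rw [Complex.arg_ofReal_of_nonneg (mul_nonneg (nrm_pos _).le (mul_self_nonneg _))]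
      exact Real.pi_pos.ne), Complex.cpow_neg, inv_inv, Complex.ofReal_mul,
      Complex.mul_cpow_ofReal_nonneg (nrm_pos _).le (mul_self_nonneg _), Complex.ofReal_mul,
      Complex.mul_cpow_ofReal_nonneg (rootDisc_pos K).le (rootDisc_pos K).le]
  have e : 2 * ((finrank ℚ K : ℝ) / 2 - s) / (finrank ℚ K : ℂ) = 1 - 2 * s / finrank ℚ K := by
    push_cast; field_simp
  rw [hdual, e, Complex.cpow_sub _ _ hr, Complex.cpow_sub _ _ hN, Complex.cpow_one,
    Complex.cpow_one, Complex.ofReal_mul]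
  have h1 : (nrm (rep K c) : ℂ) ^ (2 * s / finrank ℚ K) ≠ 0 := by simp [Complex.cpow_eq_zero_iff, hN]
  have h2 : (rootDisc K : ℂ) ^ (2 * s / finrank ℚ K) ≠ 0 := by simp [Complex.cpow_eq_zero_iff, hr]
  field_simp

end NumberFieldTheta

namespace NumberFieldTheta

open NumberField InfinitePlace GaussPoisson Module MeasureTheory Set Filter Topology Asymptotics
open NumberField.Units NumberField.Units.dirichletUnitTheorem
open scoped Classical Pointwise nonZeroDivisors

lemma norm_mellin_le {f : ℝ → ℂ} {a b : ℝ} (ha : MellinConvergent f a) (hb : MellinConvergent f b)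
    {s : ℂ} (h1 : a ≤ s.re) (h2 : s.re ≤ b) :
    ‖mellin f s‖ ≤ (∫ t in Ioi (0 : ℝ), ‖(t : ℂ) ^ ((a : ℂ) - 1) • f t‖) +
      ∫ t in Ioi (0 : ℝ), ‖(t : ℂ) ^ ((b : ℂ) - 1) • f t‖ := by
  rw [← integral_add ha.norm hb.norm]
  refine norm_integral_le_of_norm_le (ha.norm.add hb.norm) ?_
  filter_upwards [ae_restrict_mem measurableSet_Ioi] with t ht
  have ht0 : 0 < t := ht
  simp only [norm_smul, Complex.norm_cpow_eq_rpow_re_of_pos ht0, Complex.sub_re,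
    Complex.ofReal_re, Complex.one_re]
  rw [← add_mul]
  refine mul_le_mul_of_nonneg_right ?_ (norm_nonneg _)
  rcases le_total 1 t with h | h
  · exact (Real.rpow_le_rpow_of_exponent_le h (by linarith)).trans
      (le_add_of_nonneg_left (Real.rpow_nonneg ht0.le _))
  · exact (Real.rpow_le_rpow_of_exponent_ge ht0 h (by linarith)).trans
      (le_add_of_nonneg_right (Real.rpow_nonneg ht0.le _))

lemma exists_norm_Λ_le (P : WeakFEPair ℂ) (a b : ℝ) {δ : ℝ} (hδ : 0 < δ) :
    ∃ C, ∀ s : ℂ, a ≤ s.re → s.re ≤ b → δ ≤ |s.im| → ‖P.Λ s‖ ≤ C := by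
  have hconv : ∀ x : ℂ, MellinConvergent P.f_modif x := fun x =>
    (P.isStrongFEPair_toStrongFEPair.hasMellin x).1
  refine ⟨(∫ t in Ioi (0 : ℝ), ‖(t : ℂ) ^ ((a : ℂ) - 1) • P.f_modif t‖) +
      (∫ t in Ioi (0 : ℝ), ‖(t : ℂ) ^ ((b : ℂ) - 1) • P.f_modif t‖) + 1 / δ * ‖P.f₀‖ +
      ‖P.ε‖ / δ * ‖P.g₀‖, fun s h1 h2 h3 => ?_⟩
  have h4 : δ ≤ ‖s‖ := h3.trans (Complex.abs_im_le_norm s)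
  have h5 : δ ≤ ‖(P.k : ℂ) - s‖ := by
    refine h3.trans ?_
    have := Complex.abs_im_le_norm ((P.k : ℂ) - s)
    simpa using this
  rw [WeakFEPair.Λ]
  refine (norm_sub_le _ _).trans (add_le_add ((norm_sub_le _ _).trans (add_le_add
    (norm_mellin_le (hconv _) (hconv _) h1 h2) ?_)) ?_)
  · rw [norm_smul, norm_div, norm_one]; gcongr
  · rw [norm_smul, norm_div]; gcongr

lemma eqOn_of_eq_of_re_gt {U : Set ℂ} (hU : IsOpen U) (hc : Convex ℝ U) {f g : ℂ → ℂ} {A : ℝ}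
    (hf : DifferentiableOn ℂ f U) (hg : DifferentiableOn ℂ g U) {z : ℂ} (hz : z ∈ U)
    (hzA : A < z.re) (h : ∀ w, A < w.re → f w = g w) : EqOn f g U := by
  refine (hf.analyticOnNhd hU).eqOn_of_preconnected_of_eventuallyEq (hg.analyticOnNhd hU)
    hc.isPreconnected hz ?_
  filter_upwards [(isOpen_lt continuous_const Complex.continuous_re).mem_nhds hzA] with w hw
  exact h w hw

lemma eq_of_im_ne_zero {f g : ℂ → ℂ} {A : ℝ}
    (hf : ∀ s : ℂ, s.im ≠ 0 → DifferentiableAt ℂ f s) (hg : ∀ s : ℂ, s.im ≠ 0 → DifferentiableAt ℂ g s)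
    (h : ∀ w : ℂ, A < w.re → f w = g w) {s : ℂ} (hs : s.im ≠ 0) : f s = g s := by
  rcases lt_or_gt_of_ne hs with h1 | h1
  · refine eqOn_of_eq_of_re_gt (U := {z : ℂ | z.im < 0}) (z := ⟨A + 1, -1⟩)
      (isOpen_lt Complex.continuous_im continuous_const) (convex_halfSpace_im_lt 0)
      (fun z hz => (hf z (ne_of_lt hz)).differentiableWithinAt)
      (fun z hz => (hg z (ne_of_lt hz)).differentiableWithinAt) ?_ (lt_add_one A) h h1
    change (-1 : ℝ) < 0
    norm_num
  · refine eqOn_of_eq_of_re_gt (U := {z : ℂ | 0 < z.im}) (z := ⟨A + 1, 1⟩)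
      (isOpen_lt continuous_const Complex.continuous_im) (convex_halfSpace_im_gt 0)
      (fun z hz => (hf z (ne_of_gt hz)).differentiableWithinAt)
      (fun z hz => (hg z (ne_of_gt hz)).differentiableWithinAt) ?_ (lt_add_one A) h h1
    change (0 : ℝ) < 1
    norm_num

variable (K : Type*) [Field K] [NumberField K]

/-- The product of the local factors at the infinite places, at the argument `n w / 2`. -/
noncomputable def gammaInf (w : ℂ) : ℂ :=
  ∏ v : InfinitePlace K, Complex.Gamma (((mult v : ℝ) / 2 : ℝ) * w)

/-- The exponential base of the completed zeta function. -/
noncomputable def condBase : ℝ :=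
  rootDisc K * ∏ v : InfinitePlace K, (1 / (Real.pi * mult v)) ^ ((mult v : ℝ) / 2)

lemma condBase_pos : 0 < condBase K :=
  mul_pos (rootDisc_pos K) (Finset.prod_pos fun v _ => Real.rpow_pos_of_pos (by
    have := mult_pos (w := v); positivity) _)

/-- The constant of the completed zeta function. -/
noncomputable def condConst : ℝ := Nat.card (torsion K) * logScale K

lemma condConst_pos : 0 < condConst K :=
  mul_pos (by exact_mod_cast Nat.card_pos) (by exact_mod_cast logScale_pos K)

lemma rootDisc_mul_gammaFull (w : ℂ) :
    (rootDisc K : ℂ) ^ w * gammaFull K ((finrank ℚ K : ℂ) / 2 * w) =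
      condConst K * (condBase K : ℂ) ^ w * gammaInf K w := by
  have hn : (finrank ℚ K : ℂ) ≠ 0 := by exact_mod_cast finrank_pos.ne'
  have h1 : ∀ v : InfinitePlace K, 0 < 1 / (Real.pi * mult v) := fun v => by
    have := mult_pos (w := v); positivity
  have e : ∀ v : InfinitePlace K, (mult v : ℂ) * ((finrank ℚ K : ℂ) / 2 * w) / finrank ℚ K =
      (((mult v : ℝ) / 2 : ℝ) : ℂ) * w := fun v => by push_cast; field_simp
  have h2 : ∀ v : InfinitePlace K, (1 / ((Real.pi * mult v : ℝ) : ℂ)) ^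
      ((((mult v : ℝ) / 2 : ℝ) : ℂ) * w) = (((1 / (Real.pi * mult v)) ^ ((mult v : ℝ) / 2) : ℝ) : ℂ) ^ w := fun v => by
    rw [Complex.ofReal_cpow (h1 v).le]
    rw [Complex.cpow_mul _ (by
        rw [← Complex.ofReal_one, ← Complex.ofReal_div, ← Complex.ofReal_log (h1 v).le,
          ← Complex.ofReal_mul, Complex.ofReal_im]; linarith [Real.pi_pos]) (by
        rw [← Complex.ofReal_one, ← Complex.ofReal_div, ← Complex.ofReal_log (h1 v).le,
          ← Complex.ofReal_mul, Complex.ofReal_im]; exact Real.pi_pos.le)]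
    push_cast
    rfl
  have h3 : ((∏ v : InfinitePlace K, (1 / (Real.pi * mult v)) ^ ((mult v : ℝ) / 2) : ℝ) : ℂ) ^ w =
      ∏ v : InfinitePlace K, (((1 / (Real.pi * mult v)) ^ ((mult v : ℝ) / 2) : ℝ) : ℂ) ^ w := by
    induction (Finset.univ : Finset (InfinitePlace K)) using Finset.induction_on with
    | empty => simp
    | insert a s ha ih =>
      rw [Finset.prod_insert ha, Finset.prod_insert ha, Complex.ofReal_mul,
        Complex.mul_cpow_ofReal_nonneg (Real.rpow_nonneg (h1 a).le _)
          (Finset.prod_nonneg fun v _ => Real.rpow_nonneg (h1 v).le _), ih]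
  rw [gammaFull, gammaK, condBase, Complex.ofReal_mul, Complex.mul_cpow_ofReal_nonneg
    (rootDisc_pos K).le (Finset.prod_nonneg fun v _ => Real.rpow_nonneg (h1 v).le _), h3,
    gammaInf, condConst]
  simp only [e, h2, Finset.prod_mul_distrib]
  push_cast
  ring

lemma differentiableAt_gammaInf {w : ℂ} (hw : w.im ≠ 0) : DifferentiableAt ℂ (gammaInf K) w := by
  unfold gammaInf
  refine DifferentiableAt.fun_finsetProd fun v _ => ?_
  refine DifferentiableAt.comp w (Complex.differentiableAt_Gamma _ fun m h => ?_) (by fun_prop)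
  have := congrArg Complex.im h
  rw [Complex.im_ofReal_mul, Complex.neg_im, Complex.natCast_im, neg_zero] at this
  have h2 := mult_pos (w := v)
  rcases mul_eq_zero.1 this with h3 | h3
  · have : (0 : ℝ) < (mult v : ℝ) / 2 := by positivity
    exact this.ne' h3
  · exact hw h3

lemma gammaInf_ne_zero {w : ℂ} (hw : w.im ≠ 0) : gammaInf K w ≠ 0 := by
  refine Finset.prod_ne_zero_iff.2 fun v _ => Complex.Gamma_ne_zero fun m h => ?_
  have := congrArg Complex.im h
  rw [Complex.im_ofReal_mul, Complex.neg_im, Complex.natCast_im, neg_zero] at this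
  have h2 := mult_pos (w := v)
  rcases mul_eq_zero.1 this with h3 | h3
  · have : (0 : ℝ) < (mult v : ℝ) / 2 := by positivity
    exact this.ne' h3
  · exact hw h3

lemma differentiableAt_completed {s : ℂ} (hs : s.im ≠ 0) : DifferentiableAt ℂ (completed K) s := by
  unfold completed
  have hr : (rootDisc K : ℂ) ≠ 0 := by exact_mod_cast (rootDisc_pos K).ne'
  have hd : DifferentiableAt ℂ (fun s : ℂ => 2 * s / finrank ℚ K) s := by fun_prop
  refine (hd.const_cpow (Or.inl hr)).mul (DifferentiableAt.fun_sum fun c _ => ?_)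
  have hN : (nrm (rep K c) : ℂ) ≠ 0 := by exact_mod_cast (nrm_pos _).ne'
  refine (hd.const_cpow (Or.inl hN)).mul ((clsPair c).differentiableAt_Λ (Or.inl ?_) (Or.inl ?_))
  · rintro rfl; simp at hs
  · rintro rfl; simp at hs

lemma exists_norm_completed_le (a b : ℝ) {δ : ℝ} (hδ : 0 < δ) :
    ∃ C, ∀ s : ℂ, a ≤ s.re → s.re ≤ b → δ ≤ |s.im| → ‖completed K s‖ ≤ C := by
  choose C hC using fun c : ClassGroup (𝓞 K) => exists_norm_Λ_le (clsPair c) a b hδ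
  have hp : ∀ r : ℝ, 0 < r → ∃ M, ∀ s : ℂ, a ≤ s.re → s.re ≤ b →
      ‖(r : ℂ) ^ (2 * s / finrank ℚ K)‖ ≤ M := fun r hr => by
    have hcont : Continuous fun x : ℝ => r ^ (2 * x / (finrank ℚ K : ℝ)) := by
      refine Continuous.rpow continuous_const (by fun_prop) fun _ => Or.inl hr.ne'
    obtain ⟨M, hM⟩ := (isCompact_Icc (a := a) (b := b)).exists_bound_of_continuousOn hcont.continuousOn
    refine ⟨M, fun s h1 h2 => ?_⟩
    have e : (2 * s / finrank ℚ K) = ((2 / finrank ℚ K : ℝ) : ℂ) * s := by push_cast; ring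
    have h := hM s.re ⟨h1, h2⟩
    rw [Complex.norm_cpow_eq_rpow_re_of_pos hr, e, Complex.re_ofReal_mul, div_mul_eq_mul_div]
    exact (le_abs_self _).trans h
  obtain ⟨M₀, hM₀⟩ := hp _ (rootDisc_pos K)
  choose M hM using fun c : ClassGroup (𝓞 K) => hp (nrm (rep K c)) (nrm_pos _)
  refine ⟨M₀ * ∑ c, M c * C c, fun s h1 h2 h3 => ?_⟩
  have hs : ‖∑ c, (nrm (rep K c) : ℂ) ^ (2 * s / finrank ℚ K) * (clsPair c).Λ s‖ ≤ ∑ c, M c * C c := by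
    refine (norm_sum_le _ _).trans (Finset.sum_le_sum fun c _ => ?_)
    rw [norm_mul]
    exact mul_le_mul (hM c s h1 h2) (hC c s h1 h2 h3) (norm_nonneg _)
      ((norm_nonneg _).trans (hM c s h1 h2))
  rw [completed, norm_mul]
  exact mul_le_mul (hM₀ s h1 h2) hs (norm_nonneg _) ((norm_nonneg _).trans (hM₀ s h1 h2))

section

variable {K} {ζK : ℂ → ℂ} (hζ_an : ∀ s : ℂ, s ≠ 1 → DifferentiableAt ℂ ζK s)
  (hζ_ser : ∀ s : ℂ, 1 < s.re → HasSum (fun I : {I : Ideal (𝓞 K) // I ≠ ⊥} =>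
    ((Ideal.absNorm I.1 : ℕ) : ℂ) ^ (-s)) (ζK s))
include hζ_ser

lemma completed_eq_of_one_lt {w : ℂ} (hw : 1 < w.re) :
    completed K ((finrank ℚ K : ℂ) / 2 * w) =
        condConst K * (condBase K : ℂ) ^ w * gammaInf K w * ζK w ∧
      completed K ((finrank ℚ K : ℂ) / 2 * (1 - w)) =
        condConst K * (condBase K : ℂ) ^ w * gammaInf K w * ζK w := by
  have hn : (finrank ℚ K : ℂ) ≠ 0 := by exact_mod_cast finrank_pos.ne'
  have hn' : (0 : ℝ) < finrank ℚ K := by exact_mod_cast finrank_pos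
  have key : ∀ z : ℂ, 2 * ((finrank ℚ K : ℂ) / 2 * z) / finrank ℚ K = z := fun z => by field_simp
  have hre : ((finrank ℚ K : ℂ) / 2 * w).re = (finrank ℚ K : ℝ) / 2 * w.re := by
    rw [← Complex.re_ofReal_mul]; push_cast; rfl
  have hs : (finrank ℚ K : ℝ) / 2 < ((finrank ℚ K : ℂ) / 2 * w).re := by
    rw [hre]; nlinarith
  have h1 : HasSum (zterm (K := K) ((finrank ℚ K : ℂ) / 2 * w)) (ζK w) := by
    refine (hζ_ser w hw).congr_fun fun I => ?_
    rw [zterm, key]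
  have h2 : Summable (zterm (K := K) ((((finrank ℚ K : ℂ) / 2 * w).re : ℝ) : ℂ)) := by
    refine ((hζ_ser (w.re : ℂ) hw).congr_fun fun I => ?_).summable
    rw [zterm, hre]
    push_cast
    rw [key]
  rw [← rootDisc_mul_gammaFull]
  refine ⟨?_, ?_⟩
  · rw [completed_eq hs h2 h1, key, mul_assoc]
  · have e : (finrank ℚ K : ℂ) / 2 * (1 - w) = (finrank ℚ K : ℝ) / 2 - (finrank ℚ K : ℂ) / 2 * w := by
      push_cast; ring
    rw [e, completed_sub_eq hs h2 h1, key, mul_assoc]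

include hζ_an

lemma completed_eq_zeta {w : ℂ} (hw : w.im ≠ 0) :
    completed K ((finrank ℚ K : ℂ) / 2 * w) =
        condConst K * (condBase K : ℂ) ^ w * gammaInf K w * ζK w ∧
      completed K ((finrank ℚ K : ℂ) / 2 * (1 - w)) =
        condConst K * (condBase K : ℂ) ^ w * gammaInf K w * ζK w := by
  have hn' : (0 : ℝ) < finrank ℚ K := by exact_mod_cast finrank_pos
  have him : ∀ z : ℂ, ((finrank ℚ K : ℂ) / 2 * z).im = (finrank ℚ K : ℝ) / 2 * z.im := fun z => by
    rw [← Complex.im_ofReal_mul]; push_cast; rfl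
  have hc : (condBase K : ℂ) ≠ 0 := by exact_mod_cast (condBase_pos K).ne'
  have hd : ∀ s : ℂ, s.im ≠ 0 → DifferentiableAt ℂ
      (fun w => condConst K * (condBase K : ℂ) ^ w * gammaInf K w * ζK w) s := fun s hs => by
    refine ((DifferentiableAt.const_mul (differentiableAt_id.const_cpow (Or.inl hc)) _).mul
      (differentiableAt_gammaInf K hs)).mul (hζ_an s ?_)
    rintro rfl; simp at hs
  refine ⟨eq_of_im_ne_zero (A := 1) (f := fun w => completed K ((finrank ℚ K : ℂ) / 2 * w))
    (fun s hs => ?_) hd (fun z hz => (completed_eq_of_one_lt hζ_ser hz).1) hw,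
    eq_of_im_ne_zero (A := 1) (f := fun w => completed K ((finrank ℚ K : ℂ) / 2 * (1 - w)))
    (fun s hs => ?_) hd (fun z hz => (completed_eq_of_one_lt hζ_ser hz).2) hw⟩
  · refine DifferentiableAt.comp s (differentiableAt_completed K ?_) (by fun_prop)
    rw [him]; positivity
  · refine DifferentiableAt.comp s (differentiableAt_completed K ?_) (by fun_prop)
    rw [him]
    exact mul_ne_zero (by positivity) (by simpa using hs)

lemma zeta_functional_equation {w : ℂ} (hw : w.im ≠ 0) :
    (condBase K : ℂ) ^ (1 - w) * gammaInf K (1 - w) * ζK (1 - w) =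
      (condBase K : ℂ) ^ w * gammaInf K w * ζK w := by
  have h1 := (completed_eq_zeta hζ_an hζ_ser hw).2
  have hw' : (1 - w).im ≠ 0 := by simpa using hw
  rw [(completed_eq_zeta hζ_an hζ_ser hw').1] at h1
  have hc : (condConst K : ℂ) ≠ 0 := by exact_mod_cast (condConst_pos K).ne'
  refine mul_left_cancel₀ hc ?_
  simp only [mul_assoc] at h1 ⊢
  exact h1

lemma exists_completed_zeta_le (a b : ℝ) : ∃ C, ∀ w : ℂ, a ≤ w.re → w.re ≤ b → 1 ≤ |w.im| →
    ‖(condBase K : ℂ) ^ w * gammaInf K w * ζK w‖ ≤ C := by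
  have hn' : (0 : ℝ) < finrank ℚ K := by exact_mod_cast finrank_pos
  have hn1 : (0 : ℝ) < (finrank ℚ K : ℝ) / 2 := by positivity
  obtain ⟨C, hC⟩ := exists_norm_completed_le K ((finrank ℚ K : ℝ) / 2 * a)
    ((finrank ℚ K : ℝ) / 2 * b) hn1
  refine ⟨C / condConst K, fun w h1 h2 h3 => ?_⟩
  have e : (finrank ℚ K : ℂ) / 2 * w = (((finrank ℚ K : ℝ) / 2 : ℝ) : ℂ) * w := by push_cast; rfl
  have hw : w.im ≠ 0 := fun h => by rw [h, abs_zero] at h3; linarith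
  have h4 := hC ((finrank ℚ K : ℂ) / 2 * w)
  rw [(completed_eq_zeta hζ_an hζ_ser hw).1, e, Complex.re_ofReal_mul, Complex.im_ofReal_mul,
    abs_mul, abs_of_pos hn1] at h4
  have h5 := h4 (by gcongr) (by gcongr) (by nlinarith)
  rw [mul_assoc, mul_assoc, norm_mul, Complex.norm_real, Real.norm_of_nonneg (condConst_pos K).le,
    ← mul_assoc] at h5
  rw [le_div_iff₀ (condConst_pos K), mul_comm]
  exact h5

end

end NumberFieldTheta

namespace NumberFieldTheta

open NumberField InfinitePlace Module Set Filter Topology Asymptotics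

lemma norm_Gamma_le {s : ℂ} (hs : 0 < s.re) : ‖Complex.Gamma s‖ ≤ Real.Gamma s.re := by
  rw [Complex.Gamma_eq_integral hs, Complex.GammaIntegral, Real.Gamma_eq_integral hs]
  refine MeasureTheory.norm_integral_le_of_norm_le (Real.GammaIntegral_convergent hs) ?_
  filter_upwards [MeasureTheory.ae_restrict_mem measurableSet_Ioi] with x hx
  have hx0 : 0 < x := hx
  rw [norm_mul, Complex.norm_cpow_eq_rpow_re_of_pos hx0, Complex.norm_real,
    Real.norm_of_nonneg (Real.exp_pos _).le]
  simp

lemma exists_norm_Gamma_le {a : ℝ} (ha : 0 < a) (b : ℝ) :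
    ∃ C, ∀ s : ℂ, a ≤ s.re → s.re ≤ b → ‖Complex.Gamma s‖ ≤ C := by
  have hc : ContinuousOn Real.Gamma (Icc a b) := fun x hx =>
    (Real.differentiableAt_Gamma fun m h => by
      have h1 : 0 < x := ha.trans_le hx.1
      rw [h] at h1
      have : (0 : ℝ) ≤ m := Nat.cast_nonneg m
      linarith).continuousAt.continuousWithinAt
  obtain ⟨C, hC⟩ := isCompact_Icc.exists_bound_of_continuousOn hc
  exact ⟨C, fun s h1 h2 => (norm_Gamma_le (ha.trans_le h1)).trans
    ((le_abs_self _).trans (hC s.re ⟨h1, h2⟩))⟩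

lemma exists_norm_Gamma_le_of_im (b : ℝ) :
    ∃ C, ∀ s : ℂ, -1 ≤ s.re → s.re ≤ b → 1 / 2 ≤ |s.im| → ‖Complex.Gamma s‖ ≤ C := by
  obtain ⟨C, hC⟩ := exists_norm_Gamma_le one_pos (b + 2)
  refine ⟨4 * C, fun s h1 h2 h3 => ?_⟩
  have h4 : 1 / 2 ≤ ‖s‖ := h3.trans (Complex.abs_im_le_norm s)
  have h5 : 1 / 2 ≤ ‖s + 1‖ := h3.trans (by simpa using Complex.abs_im_le_norm (s + 1))
  have h0 : s ≠ 0 := fun h => by rw [h, norm_zero] at h4; linarith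
  have h0' : s + 1 ≠ 0 := fun h => by rw [h, norm_zero] at h5; linarith
  have h6 : Complex.Gamma (s + 1 + 1) = (s + 1) * (s * Complex.Gamma s) := by
    rw [Complex.Gamma_add_one _ h0', Complex.Gamma_add_one _ h0]
  have h7 := hC (s + 1 + 1) (by simp; linarith) (by simp; linarith)
  rw [h6, norm_mul, norm_mul] at h7
  have h8 : 1 / 2 * (1 / 2 * ‖Complex.Gamma s‖) ≤ ‖s + 1‖ * (‖s‖ * ‖Complex.Gamma s‖) := by
    gcongr
  linarith

lemma norm_sin_le (z : ℂ) : ‖Complex.sin z‖ ≤ Real.exp |z.im| := by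
  have h1 : ‖Complex.exp (-z * Complex.I)‖ ≤ Real.exp |z.im| := by
    rw [Complex.norm_exp]; gcongr; simpa using le_abs_self z.im
  have h2 : ‖Complex.exp (z * Complex.I)‖ ≤ Real.exp |z.im| := by
    rw [Complex.norm_exp]; gcongr; simpa using neg_le_abs z.im
  rw [Complex.sin, norm_div, norm_mul, Complex.norm_I, mul_one, Complex.norm_ofNat]
  have := norm_sub_le (Complex.exp (-z * Complex.I)) (Complex.exp (z * Complex.I))
  linarith

lemma exists_norm_inv_Gamma_le : ∃ C, 1 ≤ C ∧ ∀ s : ℂ, -(3 / 2) ≤ s.re → s.re ≤ 2 → 1 / 2 ≤ |s.im| →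
    ‖(Complex.Gamma s)⁻¹‖ ≤ C * Real.exp (Real.pi * |s.im|) := by
  obtain ⟨C, hC⟩ := exists_norm_Gamma_le_of_im (5 / 2)
  refine ⟨max C 1, le_max_right _ _, fun s h1 h2 h3 => ?_⟩
  have him : s.im ≠ 0 := fun h => by rw [h, abs_zero] at h3; linarith
  have hG : ∀ z : ℂ, z.im ≠ 0 → Complex.Gamma z ≠ 0 := fun z hz =>
    Complex.Gamma_ne_zero fun m h => hz (by rw [h]; simp)
  have h4 := Complex.Gamma_mul_Gamma_one_sub s
  have h5 : Complex.Gamma (1 - s) ≠ 0 := hG _ (by simpa using him)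
  have h6 : Complex.sin (Real.pi * s) ≠ 0 := fun h => by
    rw [h, div_zero] at h4
    exact mul_ne_zero (hG s him) h5 h4
  have hpi : (Real.pi : ℂ) ≠ 0 := by exact_mod_cast Real.pi_pos.ne'
  have h7 : (Complex.Gamma s)⁻¹ = Complex.Gamma (1 - s) * Complex.sin (Real.pi * s) / Real.pi := by
    rw [eq_div_iff h6] at h4
    rw [eq_div_iff hpi, inv_mul_eq_iff_eq_mul₀ (hG s him), ← mul_assoc, h4]
  rw [h7, norm_div, norm_mul, Complex.norm_real, Real.norm_of_nonneg Real.pi_pos.le]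
  have h8 := norm_sin_le (Real.pi * s)
  rw [Complex.im_ofReal_mul, abs_mul, abs_of_pos Real.pi_pos] at h8
  have h9 := (hC (1 - s) (by simp; linarith) (by simp; linarith) (by simpa using h3)).trans
    (le_max_left C 1)
  refine (div_le_self (by positivity) (by linarith [Real.pi_gt_three])).trans ?_
  exact mul_le_mul h9 h8 (norm_nonneg _) (by positivity)

lemma mult_div_two_cases (K : Type*) [Field K] (v : InfinitePlace K) : (1 : ℝ) / 2 ≤ (mult v : ℝ) / 2 ∧ (mult v : ℝ) / 2 ≤ 1 := by
  rw [mult]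
  split_ifs <;> norm_num

variable (K : Type*) [Field K] [NumberField K]

lemma exists_norm_inv_gammaInf_le : ∃ C c, 0 ≤ C ∧ 0 ≤ c ∧ ∀ w : ℂ, -(3 / 2) ≤ w.re → w.re ≤ 2 →
    1 ≤ |w.im| → ‖(gammaInf K w)⁻¹‖ ≤ C * Real.exp (c * |w.im|) := by
  obtain ⟨C, hC1, hC⟩ := exists_norm_inv_Gamma_le
  refine ⟨C ^ Fintype.card (InfinitePlace K), Fintype.card (InfinitePlace K) * Real.pi,
    by positivity, by positivity, fun w h1 h2 h3 => ?_⟩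
  rw [gammaInf, ← Finset.prod_inv_distrib, norm_prod]
  have h4 : ∀ v ∈ (Finset.univ : Finset (InfinitePlace K)),
      ‖(Complex.Gamma (((mult v : ℝ) / 2 : ℝ) * w))⁻¹‖ ≤ C * Real.exp (Real.pi * |w.im|) := by
    intro v _
    obtain ⟨h5, h6⟩ := mult_div_two_cases K v
    have h7 := hC (((mult v : ℝ) / 2 : ℝ) * w)
    rw [Complex.re_ofReal_mul, Complex.im_ofReal_mul, abs_mul, abs_of_pos (by linarith)] at h7
    refine (h7 (by nlinarith) (by nlinarith) (by nlinarith)).trans ?_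
    gcongr
    exact mul_le_of_le_one_left (abs_nonneg _) h6
  refine (Finset.prod_le_prod (fun _ _ => norm_nonneg _) h4).trans_eq ?_
  rw [Finset.prod_const, Finset.card_univ, mul_pow, ← Real.exp_nat_mul]
  ring_nf

lemma norm_Gamma_add_nat_le {z : ℂ} (hz : z.im ≠ 0) (n : ℕ) :
    ‖Complex.Gamma (z + n)‖ ≤ (‖z‖ + n) ^ n * ‖Complex.Gamma z‖ := by
  induction n with
  | zero => simp
  | succ n ih =>
    have h0 : z + n ≠ 0 := fun h => hz (by simpa using congrArg Complex.im h)
    rw [Nat.cast_succ, ← add_assoc, Complex.Gamma_add_one _ h0, norm_mul, pow_succ', mul_assoc]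
    have h1 : ‖z + n‖ ≤ ‖z‖ + ((n + 1 : ℕ) : ℝ) := by
      refine (norm_add_le _ _).trans ?_
      rw [Complex.norm_natCast]; push_cast; linarith
    refine mul_le_mul h1 (ih.trans ?_) (norm_nonneg _) (by positivity)
    gcongr
    linarith

lemma norm_gammaInf_one_sub_le {w : ℂ} (hre : w.re = -(3 / 2)) (him : w.im ≠ 0) :
    ‖gammaInf K (1 - w)‖ ≤ (‖w‖ + 4) ^ (4 * Fintype.card (InfinitePlace K)) * ‖gammaInf K w‖ := by
  rw [gammaInf, gammaInf, norm_prod, norm_prod, pow_mul]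
  have hk : ((‖w‖ + 4) ^ 4) ^ Fintype.card (InfinitePlace K) =
      ∏ _v : InfinitePlace K, (‖w‖ + 4) ^ 4 := by rw [Finset.prod_const, Finset.card_univ]
  rw [hk, ← Finset.prod_mul_distrib]
  refine Finset.prod_le_prod (fun _ _ => norm_nonneg _) fun v _ => ?_
  obtain ⟨h5, h6⟩ := mult_div_two_cases K v
  have e : (((mult v : ℝ) / 2 : ℝ) : ℂ) * (1 - w) =
      (starRingEnd ℂ) ((((mult v : ℝ) / 2 : ℝ) : ℂ) * w + ((2 * mult v : ℕ) : ℂ)) := by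
    refine Complex.ext ?_ ?_
    · rw [Complex.conj_re, Complex.re_ofReal_mul, Complex.add_re, Complex.re_ofReal_mul,
        Complex.sub_re, hre, Complex.natCast_re]
      push_cast
      norm_num
      ring
    · rw [Complex.conj_im, Complex.im_ofReal_mul, Complex.add_im, Complex.im_ofReal_mul,
        Complex.sub_im, Complex.natCast_im]
      simp
  rw [e, Complex.Gamma_conj, Complex.norm_conj]
  refine (norm_Gamma_add_nat_le (by
    rw [Complex.im_ofReal_mul]; exact mul_ne_zero (by linarith) him) _).trans ?_
  gcongr
  have h7 : ‖(((mult v : ℝ) / 2 : ℝ) : ℂ) * w‖ ≤ ‖w‖ := by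
    rw [norm_mul, Complex.norm_real, Real.norm_of_nonneg (by linarith)]
    exact mul_le_of_le_one_left (norm_nonneg _) h6
  have h8 : (2 * mult v : ℕ) ≤ 4 := by
    have : mult v ≤ 2 := by exact_mod_cast (by linarith : (mult v : ℝ) ≤ 2)
    omega
  have h9 : ((2 * mult v : ℕ) : ℝ) ≤ 4 := by exact_mod_cast h8
  calc (‖(((mult v : ℝ) / 2 : ℝ) : ℂ) * w‖ + ((2 * mult v : ℕ) : ℝ)) ^ (2 * mult v)
      ≤ (‖w‖ + 4) ^ (2 * mult v) := by gcongr
    _ ≤ (‖w‖ + 4) ^ 4 := pow_le_pow_right₀ (by linarith [norm_nonneg w]) h8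

end NumberFieldTheta

namespace NumberFieldTheta

open NumberField InfinitePlace Module Set Filter Topology Asymptotics

/-- A Phragmén–Lindelöf principle with polynomial bounds on the boundary of a strip. -/
lemma exists_norm_le_pow_of_strip {g : ℂ → ℂ} (hg : Differentiable ℂ g) {C c C' : ℝ} {N : ℕ}
    (hc : 0 ≤ c)
    (h1 : ∀ w : ℂ, -(3 / 2) ≤ w.re → w.re ≤ 2 → 1 ≤ |w.im| → ‖g w‖ ≤ C * Real.exp (c * |w.im|))
    (h2 : ∀ w : ℂ, w.re = -(3 / 2) ∨ w.re = 2 → 1 ≤ |w.im| → ‖g w‖ ≤ C' * (‖w‖ + 10) ^ N) :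
    ∃ C₀, ∀ w : ℂ, -(3 / 2) ≤ w.re → w.re ≤ 2 → ‖g w‖ ≤ C₀ * (‖w‖ + 10) ^ N := by
  obtain ⟨C₂, hC₂⟩ := (isCompact_Icc (a := -(3 / 2 : ℝ)) (b := 2)).reProdIm
    (isCompact_Icc (a := (-1 : ℝ)) (b := 1)) |>.exists_bound_of_continuousOn
      hg.continuous.continuousOn
  have hlow : ∀ w : ℂ, -(3 / 2) ≤ w.re → 5 ≤ ‖w + 10‖ := fun w hw => by
    refine le_trans ?_ (Complex.re_le_norm (w + 10))
    simp only [Complex.add_re, Complex.re_ofNat]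
    linarith
  have hne : ∀ w : ℂ, -(3 / 2) ≤ w.re → w + 10 ≠ 0 := fun w hw h => by
    have := hlow w hw
    rw [h, norm_zero] at this
    linarith
  have hpow : ∀ w : ℂ, -(3 / 2) ≤ w.re → 1 ≤ ‖w + 10‖ ^ N := fun w hw =>
    one_le_pow₀ (by linarith [hlow w hw])
  have hcmp : ∀ w : ℂ, -(3 / 2) ≤ w.re → ‖w‖ + 10 ≤ 5 * ‖w + 10‖ := fun w hw => by
    have := norm_sub_le (w + 10) 10
    rw [add_sub_cancel_right, Complex.norm_ofNat] at this
    linarith [hlow w hw]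
  set f : ℂ → ℂ := fun w => g w / (w + 10) ^ N with hf
  have hfn : ∀ w : ℂ, -(3 / 2) ≤ w.re → ‖f w‖ ≤ ‖g w‖ := fun w hw => by
    rw [hf, norm_div, norm_pow]
    exact div_le_self (norm_nonneg _) (hpow w hw)
  set M := max C₂ (|C'| * 5 ^ N)
  have hbd : ∀ w : ℂ, w.re = -(3 / 2) ∨ w.re = 2 → ‖f w‖ ≤ M := by
    intro w hw
    have hre : -(3 / 2) ≤ w.re ∧ w.re ≤ 2 := by rcases hw with h | h <;> rw [h] <;> norm_num
    rcases le_total 1 |w.im| with h | h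
    · refine le_trans ?_ (le_max_right _ _)
      rw [hf, norm_div, norm_pow, div_le_iff₀ (by linarith [hpow w hre.1])]
      calc ‖g w‖ ≤ C' * (‖w‖ + 10) ^ N := h2 w hw h
        _ ≤ |C'| * (5 * ‖w + 10‖) ^ N := by
          refine mul_le_mul (le_abs_self _) ?_ (by positivity) (abs_nonneg _)
          exact pow_le_pow_left₀ (by positivity) (hcmp w hre.1) N
        _ = _ := by rw [mul_pow]; ring
    · exact (hfn w hre.1).trans ((hC₂ w ⟨hre, abs_le.1 h⟩).trans (le_max_left _ _))
  have hfd : ∀ w : ℂ, -(3 / 2) ≤ w.re → DifferentiableAt ℂ f w := fun w hw =>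
    (hg w).fun_div (by fun_prop) (pow_ne_zero _ (hne w hw))
  have hcl : closure (Complex.re ⁻¹' Ioo (-(3 / 2) : ℝ) 2) ⊆ {w : ℂ | -(3 / 2) ≤ w.re} :=
    closure_minimal (fun w hw => hw.1.le) (isClosed_le continuous_const Complex.continuous_re)
  have hdc : DiffContOnCl ℂ f (Complex.re ⁻¹' Ioo (-(3 / 2) : ℝ) 2) :=
    DifferentiableOn.diffContOnCl fun w hw => (hfd w (hcl hw)).differentiableWithinAt
  have hO : ∃ c < Real.pi / (2 - -(3 / 2)), ∃ B, f =O[comap (_root_.abs ∘ Complex.im) atTop ⊓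
      𝓟 (Complex.re ⁻¹' Ioo (-(3 / 2) : ℝ) 2)] fun z ↦ Real.exp (B * Real.exp (c * |z.im|)) := by
    refine ⟨1 / 2, ?_, 2 * c, IsBigO.of_bound |C| ?_⟩
    · rw [lt_div_iff₀ (by norm_num)]
      linarith [Real.pi_gt_three]
    · have hev : ∀ᶠ w : ℂ in comap (_root_.abs ∘ Complex.im) atTop ⊓
          𝓟 (Complex.re ⁻¹' Ioo (-(3 / 2) : ℝ) 2), 1 ≤ |w.im| :=
        (tendsto_comap.eventually (eventually_ge_atTop (1 : ℝ))).filter_mono inf_le_left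
      filter_upwards [hev, mem_inf_of_right (mem_principal_self _)] with w hw1 hw2
      rw [Real.norm_of_nonneg (Real.exp_pos _).le]
      refine (hfn w hw2.1.le).trans ((h1 w hw2.1.le hw2.2.le hw1).trans ?_)
      refine mul_le_mul (le_abs_self _) (Real.exp_le_exp.2 ?_) (Real.exp_pos _).le (abs_nonneg _)
      have := Real.add_one_le_exp (1 / 2 * |w.im|)
      nlinarith
  refine ⟨|M|, fun w ha hb => ?_⟩
  have := PhragmenLindelof.vertical_strip hdc hO (fun z hz => hbd z (Or.inl hz))
    (fun z hz => hbd z (Or.inr hz)) ha hb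
  rw [hf, norm_div, norm_pow, div_le_iff₀ (by linarith [hpow w ha])] at this
  refine this.trans (mul_le_mul (le_abs_self _) ?_ (by positivity) (abs_nonneg _))
  refine pow_le_pow_left₀ (norm_nonneg _) ?_ N
  simpa using norm_add_le w 10

variable {K : Type*} [Field K] [NumberField K] {ζK : ℂ → ℂ}

section Series

variable (hζ_ser : ∀ s : ℂ, 1 < s.re →
      HasSum (fun I : {I : Ideal (𝓞 K) // I ≠ ⊥} =>
        ((Ideal.absNorm I.1 : ℕ) : ℂ) ^ (-s)) (ζK s))

lemma one_le_absNorm (I : {I : Ideal (𝓞 K) // I ≠ ⊥}) : 1 ≤ Ideal.absNorm I.1 :=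
  Nat.one_le_iff_ne_zero.2 fun h => I.2 (Ideal.absNorm_eq_zero_iff.1 h)

lemma norm_absNorm_cpow (I : {I : Ideal (𝓞 K) // I ≠ ⊥}) (s : ℂ) :
    ‖((Ideal.absNorm I.1 : ℕ) : ℂ) ^ (-s)‖ = (Ideal.absNorm I.1 : ℝ) ^ (-s.re) := by
  rw [Complex.norm_natCast_cpow_of_pos (one_le_absNorm I), Complex.neg_re]

include hζ_ser

lemma summable_absNorm_rpow {x : ℝ} (hx : 1 < x) :
    Summable fun I : {I : Ideal (𝓞 K) // I ≠ ⊥} => (Ideal.absNorm I.1 : ℝ) ^ (-x) := by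
  have := (hζ_ser x (by simpa using hx)).summable.norm
  simpa only [norm_absNorm_cpow, Complex.ofReal_re] using this

lemma exists_norm_zeta_le_of_two_le_re : ∃ C, ∀ w : ℂ, 2 ≤ w.re → ‖ζK w‖ ≤ C := by
  refine ⟨∑' I : {I : Ideal (𝓞 K) // I ≠ ⊥}, (Ideal.absNorm I.1 : ℝ) ^ (-2 : ℝ), fun w hw => ?_⟩
  rw [← (hζ_ser w (by linarith)).tsum_eq]
  refine tsum_of_norm_bounded (summable_absNorm_rpow hζ_ser one_lt_two).hasSum fun I => ?_
  rw [norm_absNorm_cpow]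
  exact Real.rpow_le_rpow_of_exponent_le (by exact_mod_cast one_le_absNorm I) (by linarith)

lemma exists_half_le_norm_zeta : ∃ σ₀ : ℝ, 2 ≤ σ₀ ∧ ∀ w : ℂ, w.re = σ₀ → 1 / 2 ≤ ‖ζK w‖ := by
  classical
  set S := ∑' I : {I : Ideal (𝓞 K) // I ≠ ⊥}, (Ideal.absNorm I.1 : ℝ) ^ (-2 : ℝ) with hS
  have hsum := summable_absNorm_rpow hζ_ser one_lt_two
  have hS0 : 0 ≤ S := tsum_nonneg fun I => by positivity
  obtain ⟨n, hn⟩ := pow_unbounded_of_one_lt (2 * S) one_lt_two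
  refine ⟨n + 2, by linarith [(Nat.cast_nonneg n : (0 : ℝ) ≤ n)], fun w hw => ?_⟩
  have hw1 : 1 < w.re := by rw [hw]; linarith [(Nat.cast_nonneg n : (0 : ℝ) ≤ n)]
  set t : {I : Ideal (𝓞 K) // I ≠ ⊥} := ⟨⊤, top_ne_bot⟩ with ht
  have h1 := hasSum_ite_sub_hasSum (hζ_ser w hw1) t
  have h2 : ((Ideal.absNorm t.1 : ℕ) : ℂ) ^ (-w) = 1 := by simp [ht]
  rw [h2] at h1
  have h3 : ‖ζK w - 1‖ ≤ ((1 / 2 : ℝ) ^ n) * S := by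
    rw [← h1.tsum_eq]
    refine tsum_of_norm_bounded (hsum.hasSum.mul_left ((1 / 2 : ℝ) ^ n)) fun I => ?_
    split_ifs with hI
    · rw [norm_zero]; positivity
    · have hN : 2 ≤ Ideal.absNorm I.1 := by
        have h4 := one_le_absNorm I
        have h5 : Ideal.absNorm I.1 ≠ 1 := fun h =>
          hI (Subtype.ext (Ideal.absNorm_eq_one_iff.1 h))
        omega
      have hN' : (2 : ℝ) ≤ Ideal.absNorm I.1 := by exact_mod_cast hN
      have hN0 : (0 : ℝ) < Ideal.absNorm I.1 := by linarith
      rw [norm_absNorm_cpow, hw, neg_add, Real.rpow_add hN0, Real.rpow_neg hN0.le,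
        Real.rpow_natCast, one_div, inv_pow]
      gcongr
  have h6 : ((1 / 2 : ℝ) ^ n) * S ≤ 1 / 2 := by
    rw [one_div_pow, one_div_mul_eq_div, div_le_iff₀ (by positivity)]
    linarith
  have h7 := norm_sub_norm_le (1 : ℂ) (1 - ζK w)
  rw [sub_sub_cancel, norm_one, norm_sub_rev] at h7
  linarith

end Series

variable (hζ_an : ∀ s : ℂ, s ≠ 1 → DifferentiableAt ℂ ζK s)
  (hζ_ser : ∀ s : ℂ, 1 < s.re →
      HasSum (fun I : {I : Ideal (𝓞 K) // I ≠ ⊥} =>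
        ((Ideal.absNorm I.1 : ℕ) : ℂ) ^ (-s)) (ζK s))

include hζ_an hζ_ser

lemma exists_norm_zeta_le_of_re_eq : ∃ C, 0 ≤ C ∧ ∃ N : ℕ, ∀ w : ℂ, w.re = -(3 / 2) → w.im ≠ 0 →
    ‖ζK w‖ ≤ C * (‖w‖ + 10) ^ N := by
  obtain ⟨C, hC⟩ := exists_norm_zeta_le_of_two_le_re hζ_ser
  have hb := condBase_pos K
  refine ⟨condBase K ^ (4 : ℝ) * |C|, by positivity, 4 * Fintype.card (InfinitePlace K),
    fun w hre him => ?_⟩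
  have h1 := congrArg norm (zeta_functional_equation hζ_an hζ_ser him)
  rw [norm_mul, norm_mul, norm_mul, norm_mul, Complex.norm_cpow_eq_rpow_re_of_pos hb,
    Complex.norm_cpow_eq_rpow_re_of_pos hb, Complex.sub_re, hre, Complex.one_re,
    show (1 : ℝ) - -(3 / 2) = 4 + -(3 / 2) by norm_num, Real.rpow_add hb, mul_assoc, mul_assoc,
    mul_assoc, mul_comm (condBase K ^ (4 : ℝ)), mul_assoc, mul_assoc] at h1
  have h2 := mul_left_cancel₀ (Real.rpow_pos_of_pos hb _).ne' h1
  have h3 : 0 < ‖gammaInf K w‖ := norm_pos_iff.2 (gammaInf_ne_zero K him)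
  have h4 := norm_gammaInf_one_sub_le K hre him
  have h5 := (hC (1 - w) (by rw [Complex.sub_re, hre]; norm_num)).trans (le_abs_self C)
  have h6 : ‖gammaInf K w‖ * ‖ζK w‖ ≤ ‖gammaInf K w‖ * (condBase K ^ (4 : ℝ) * |C| *
      (‖w‖ + 4) ^ (4 * Fintype.card (InfinitePlace K))) := by
    rw [← h2]
    calc ‖gammaInf K (1 - w)‖ * (‖ζK (1 - w)‖ * condBase K ^ (4 : ℝ))
        ≤ ((‖w‖ + 4) ^ (4 * Fintype.card (InfinitePlace K)) * ‖gammaInf K w‖) *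
          (|C| * condBase K ^ (4 : ℝ)) := by gcongr
      _ = _ := by ring
  refine (le_of_mul_le_mul_left h6 h3).trans ?_
  gcongr
  norm_num

lemma exists_norm_zeta_le_exp : ∃ C c, 0 ≤ C ∧ 0 ≤ c ∧ ∀ w : ℂ, -(3 / 2) ≤ w.re → w.re ≤ 2 →
    1 ≤ |w.im| → ‖ζK w‖ ≤ C * Real.exp (c * |w.im|) := by
  obtain ⟨C, hC⟩ := exists_completed_zeta_le hζ_an hζ_ser (-(3 / 2)) 2
  obtain ⟨C', c, hC', hc, h⟩ := exists_norm_inv_gammaInf_le K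
  have hb := condBase_pos K
  refine ⟨|C| * (condBase K ^ (3 / 2 : ℝ) + condBase K ^ (-2 : ℝ)) * C', c, by positivity, hc,
    fun w h1 h2 h3 => ?_⟩
  have him : w.im ≠ 0 := fun h => by rw [h, abs_zero] at h3; linarith
  have hb0 : (condBase K : ℂ) ≠ 0 := by exact_mod_cast hb.ne'
  have h4 : ζK w = ((condBase K : ℂ) ^ w * gammaInf K w * ζK w) *
      (condBase K : ℂ) ^ (-w) * (gammaInf K w)⁻¹ := by
    have := gammaInf_ne_zero K him
    have h5 : (condBase K : ℂ) ^ w ≠ 0 := by simp [Complex.cpow_eq_zero_iff, hb0]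
    rw [Complex.cpow_neg]
    field_simp
  have h5 : ‖(condBase K : ℂ) ^ (-w)‖ ≤ condBase K ^ (3 / 2 : ℝ) + condBase K ^ (-2 : ℝ) := by
    rw [Complex.norm_cpow_eq_rpow_re_of_pos hb, Complex.neg_re]
    rcases le_total 1 (condBase K) with h | h
    · exact (Real.rpow_le_rpow_of_exponent_le h (by linarith)).trans
        (le_add_of_nonneg_right (by positivity))
    · exact (Real.rpow_le_rpow_of_exponent_ge hb h (by linarith)).trans
        (le_add_of_nonneg_left (by positivity))
  rw [h4, norm_mul, norm_mul, mul_assoc _ C']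
  have h6 := (hC w h1 h2 h3).trans (le_abs_self C)
  have h7 := h w h1 h2 h3
  gcongr

theorem exists_norm_zeta_le_pow
    (hζ_pole : ∃ A : ℂ, A ≠ 0 ∧ Tendsto (fun s : ℂ => (s - 1) * ζK s) (𝓝[≠] (1 : ℂ)) (𝓝 A)) :
    ∃ C, ∃ N : ℕ, ∀ w : ℂ, -(3 / 2) ≤ w.re → 1 ≤ |w.im| → ‖ζK w‖ ≤ C * (‖w‖ + 10) ^ N := by
  obtain ⟨A, -, hA⟩ := hζ_pole
  obtain ⟨C₁, hC₁⟩ := exists_norm_zeta_le_of_two_le_re hζ_ser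
  obtain ⟨C₂, hC₂, N, h₂⟩ := exists_norm_zeta_le_of_re_eq hζ_an hζ_ser
  obtain ⟨C₃, c, hC₃, hc, h₃⟩ := exists_norm_zeta_le_exp hζ_an hζ_ser
  set g : ℂ → ℂ := Function.update (fun s => (s - 1) * ζK s) 1 A with hg_def
  have hne : ∀ w : ℂ, 1 ≤ |w.im| → w ≠ 1 := fun w hw h => by
    rw [h, Complex.one_im, abs_zero] at hw
    linarith
  have hgv : ∀ w : ℂ, w ≠ 1 → g w = (w - 1) * ζK w := fun w hw => Function.update_of_ne hw _ _
  have hdiff : ∀ w : ℂ, w ≠ 1 → DifferentiableAt ℂ g w := fun w hw => by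
    have h1 : DifferentiableAt ℂ (fun s => (s - 1) * ζK s) w :=
      (differentiableAt_id.sub_const 1).mul (hζ_an w hw)
    refine h1.congr_of_eventuallyEq ?_
    filter_upwards [isOpen_ne.mem_nhds hw] with z hz using hgv z hz
  have hg : Differentiable ℂ g := fun w => by
    by_cases hw : w = 1
    · rw [hw]
      refine (Complex.analyticAt_of_differentiable_on_punctured_nhds_of_continuousAt ?_
        (continuousAt_update_same.2 hA)).differentiableAt
      filter_upwards [self_mem_nhdsWithin] with z hz using hdiff z hz
    · exact hdiff w hw
  have hw1 : ∀ w : ℂ, ‖w - 1‖ ≤ ‖w‖ + 10 := fun w => by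
    have := norm_sub_le w 1
    rw [norm_one] at this
    linarith
  obtain ⟨C, hC⟩ := exists_norm_le_pow_of_strip hg (C := 3 * C₃) (c := c + 1)
    (C' := C₂ + |C₁|) (N := N + 1) (by linarith)
    (fun w h1 h2 h3 => by
      rw [hgv w (hne w h3), norm_mul, add_mul, one_mul, Real.exp_add]
      have h4 : ‖w - 1‖ ≤ 3 * Real.exp |w.im| := by
        have h5 := Complex.norm_le_abs_re_add_abs_im (w - 1)
        rw [Complex.sub_re, Complex.sub_im, Complex.one_re, Complex.one_im, sub_zero] at h5
        have h6 : |w.re - 1| ≤ 3 := abs_le.2 ⟨by linarith, by linarith⟩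
        have h7 := Real.add_one_le_exp |w.im|
        linarith
      calc ‖w - 1‖ * ‖ζK w‖ ≤ (3 * Real.exp |w.im|) * (C₃ * Real.exp (c * |w.im|)) := by
            gcongr
            exact h₃ w h1 h2 h3
        _ = _ := by ring)
    (fun w h1 h3 => by
      rw [hgv w (hne w h3), norm_mul, pow_succ', mul_left_comm]
      refine mul_le_mul (hw1 w) ?_ (norm_nonneg _) (by positivity)
      rcases h1 with h | h
      · refine (h₂ w h fun h => by rw [h, abs_zero] at h3; linarith).trans ?_
        gcongr
        exact le_add_of_nonneg_right (abs_nonneg _)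
      · refine (hC₁ w h.ge).trans ?_
        have h4 : 1 ≤ (‖w‖ + 10) ^ N := one_le_pow₀ (by linarith [norm_nonneg w])
        nlinarith [le_abs_self C₁, abs_nonneg C₁])
  refine ⟨|C| + |C₁|, N + 1, fun w h1 h3 => ?_⟩
  have h4 : 1 ≤ (‖w‖ + 10) ^ (N + 1) := one_le_pow₀ (by linarith [norm_nonneg w])
  rcases le_total w.re 2 with h | h
  · have h5 := hC w h1 h
    rw [hgv w (hne w h3), norm_mul] at h5
    have h6 : 1 ≤ ‖w - 1‖ := h3.trans (by simpa using Complex.abs_im_le_norm (w - 1))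
    nlinarith [le_abs_self C, abs_nonneg C₁, norm_nonneg (ζK w)]
  · calc ‖ζK w‖ ≤ (|C| + |C₁|) * 1 := by linarith [hC₁ w h, le_abs_self C₁, abs_nonneg C]
      _ ≤ _ := by gcongr

lemma zeta_zero_re_mem
    (hζ_pole : ∃ A : ℂ, A ≠ 0 ∧ Tendsto (fun s : ℂ => (s - 1) * ζK s) (𝓝[≠] (1 : ℂ)) (𝓝 A))
    {w : ℂ} (him : w.im ≠ 0) (hw : ζK w = 0) : 0 < w.re ∧ w.re < 1 := by
  have key : ∀ z : ℂ, z.im ≠ 0 → ζK z = 0 → z.re < 1 := fun z hz h => by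
    by_contra! h1
    rcases h1.lt_or_eq with h2 | h2
    · exact DedekindEuler.ne_zero_of_one_lt_re hζ_ser h2 h
    · refine DedekindEuler.ne_zero_of_re_eq_one hζ_an hζ_ser hζ_pole hz ?_
      rwa [show (1 + z.im * Complex.I : ℂ) = z by
        apply Complex.ext <;> simp [← h2]]
  refine ⟨?_, key w him hw⟩
  have h1 := zeta_functional_equation hζ_an hζ_ser him
  have him' : (1 - w).im ≠ 0 := by simpa using him
  rw [hw, mul_zero] at h1
  have hb0 : (condBase K : ℂ) ≠ 0 := by exact_mod_cast (condBase_pos K).ne'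
  have h2 : (condBase K : ℂ) ^ (1 - w) ≠ 0 := by simp [Complex.cpow_eq_zero_iff, hb0]
  have h3 := (mul_eq_zero.1 h1).resolve_left (mul_ne_zero h2 (gammaInf_ne_zero K him'))
  have := key _ him' h3
  rw [Complex.sub_re, Complex.one_re] at this
  linarith

end NumberFieldTheta

namespace LocalBound

lemma div_log_le_div_log {x y : ℝ} (hx : 3 ≤ x) (hxy : x ≤ y) :
    x / Real.log x ≤ y / Real.log y := by
  have he : Real.exp 1 ≤ 3 := by linarith [Real.exp_one_lt_d9]
  have h1 := Real.log_div_self_antitoneOn (show Real.exp 1 ≤ x by linarith)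
    (show Real.exp 1 ≤ y by linarith) hxy
  have h2 : 0 < Real.log y := Real.log_pos (by linarith)
  have h3 := inv_anti₀ (div_pos h2 (by linarith)) h1
  rwa [inv_div, inv_div] at h3

/-- Lower bound at height `T` for a function of polynomial growth that is bounded below on a
vertical line, provided `T` is not too close to the ordinate of a zero. -/
theorem exists_lower_bound {Z : ℂ → ℂ} {C σ₀ : ℝ} {N : ℕ}
    (hZ : ∀ s : ℂ, s ≠ 1 → DifferentiableAt ℂ Z s)
    (hσ₀ : 2 ≤ σ₀) (hlow : ∀ w : ℂ, w.re = σ₀ → 1 / 2 ≤ ‖Z w‖) (hC : 1 ≤ C)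
    (hgrow : ∀ w : ℂ, -(3 / 2) ≤ w.re → 1 ≤ |w.im| → ‖Z w‖ ≤ C * (‖w‖ + 10) ^ N) :
    ∃ A₁ T₀ : ℝ, 0 < A₁ ∧ 2 < T₀ ∧ ∀ T : ℝ, T₀ ≤ T →
      (∀ ρ : ℂ, Z ρ = 0 → 1 < ρ.im →
        |T - ρ.im| > Real.exp (-A₁ * ρ.im / Real.log ρ.im)) →
      ∀ σ : ℝ, -(1 / 2) ≤ σ → σ ≤ 3 / 2 →
        Real.exp (-(1 / 2) * T) ≤ ‖Z (σ + T * Complex.I)‖ := by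
  set r := σ₀ + 1 / 2 with hr
  set r₁ := σ₀ + 3 / 4 with hr₁
  set R := σ₀ + 1 with hR
  set R' := σ₀ + 5 / 4 with hR'
  set L := Real.log (R / r₁) with hL
  have hL0 : 0 < L := Real.log_pos ((one_lt_div (by linarith)).2 (by linarith))
  set c₀ := 1 + 2 * r / (r₁ - r) with hc₀
  have hc₀0 : 0 < c₀ := by
    have : 0 < 2 * r / (r₁ - r) := div_pos (by linarith) (by linarith)
    linarith
  set c₁ := (N + 1) / L + 1 with hc₁
  have hc₁0 : 0 < c₁ := by positivity
  set c₂ := (N + 1) * c₀ + c₁ * Real.log (2 * R) with hc₂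
  have hlog2R : 0 < Real.log (2 * R) := Real.log_pos (by linarith)
  have hc₂0 : 0 < c₂ := by positivity
  obtain ⟨T₁, hT₁⟩ := Filter.eventually_atTop.1
    (Real.isLittleO_log_id_atTop.bound (show (0 : ℝ) < 1 / (8 * c₂) by positivity))
  set κ := 2 * σ₀ + 11 with hκ
  refine ⟨1 / (8 * c₁), max (max (R' + 4) κ) (max T₁ (2 ^ (N + 1) * C)), by positivity,
    lt_of_lt_of_le (by linarith) ((le_max_left _ _).trans (le_max_left _ _)), ?_⟩
  intro T hT hzero σ hσ1 hσ2
  obtain ⟨⟨hTa, hTb⟩, hTc, hTd⟩ := by simpa only [max_le_iff] using hT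
  set X := T + r₁ with hX
  set ℓ := Real.log X with hℓ
  have hX3 : 3 ≤ X := by linarith
  have hX2T : X ≤ 2 * T := by linarith
  have hℓ1 : 1 ≤ ℓ := by
    rw [hℓ, Real.le_log_iff_exp_le (by linarith)]
    linarith [Real.exp_one_lt_d9]
  have hc₂X : c₂ * ℓ ≤ X / 8 := by
    have h1 := hT₁ X (by linarith)
    rw [id, Real.norm_of_nonneg (by linarith), Real.norm_of_nonneg (by linarith), ← hℓ] at h1
    calc c₂ * ℓ ≤ c₂ * (1 / (8 * c₂) * X) := by gcongr
      _ = X / 8 := by field_simp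
  set M := C * (T + κ) ^ N with hM
  have hM1 : 1 ≤ M := one_le_mul_of_one_le_of_one_le hC (one_le_pow₀ (by linarith))
  set B := Real.log (2 * M) with hB
  have hB0 : 0 < B := Real.log_pos (by linarith)
  have hexpB : Real.exp (-B) = 1 / (2 * M) := by
    rw [Real.exp_neg, hB, Real.exp_log (by linarith), one_div]
  have hBℓ : B ≤ (N + 1) * ℓ := by
    have h1 : 2 * M ≤ X ^ (N + 1) := by
      calc 2 * M ≤ 2 * (C * (2 * X) ^ N) := by
            rw [hM]
            have : 0 ≤ T + κ := by linarith
            gcongr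
            linarith
        _ = (2 ^ (N + 1) * C) * X ^ N := by rw [mul_pow]; ring
        _ ≤ X * X ^ N := by
          have : 0 ≤ X := by linarith
          gcongr
          linarith
        _ = X ^ (N + 1) := by ring
    calc B ≤ Real.log (X ^ (N + 1)) := Real.log_le_log (by linarith) h1
      _ = (N + 1) * ℓ := by rw [Real.log_pow]; push_cast; rfl
  set n := ⌊B / L⌋₊ + 1 with hn
  have hn1 : B < n * L := by
    rw [← div_lt_iff₀ hL0]
    exact_mod_cast Nat.lt_floor_add_one (B / L)
  have hnℓ : (n : ℝ) ≤ c₁ * ℓ := by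
    have h1 := Nat.floor_le (div_nonneg hB0.le hL0.le)
    have h2 : B / L ≤ (N + 1) * ℓ / L := by gcongr
    calc (n : ℝ) ≤ (N + 1) * ℓ / L + 1 := by rw [hn]; push_cast; linarith
      _ ≤ (N + 1) * ℓ / L + 1 * ℓ := by linarith
      _ = c₁ * ℓ := by rw [hc₁]; ring
  set A₁ := 1 / (8 * c₁) with hA₁
  have hA₁0 : 0 < A₁ := by positivity
  set d := Real.exp (-(A₁ * (X / ℓ))) with hd
  have hd1 : d ≤ 1 := Real.exp_le_one_iff.2 (neg_nonpos.2 (by positivity))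
  set z₀ : ℂ := σ₀ + T * Complex.I with hz₀
  have hz₀re : z₀.re = σ₀ := by simp [hz₀]
  have hz₀im : z₀.im = T := by simp [hz₀]
  have him : ∀ w : ℂ, T - ‖w‖ ≤ (z₀ + w).im := fun w => by
    rw [Complex.add_im, hz₀im]
    linarith [neg_le_of_abs_le (Complex.abs_im_le_norm w)]
  set f : ℂ → ℂ := fun w => Z (z₀ + w) / M with hf
  have hfn : ∀ w, ‖f w‖ = ‖Z (z₀ + w)‖ / M := fun w => by
    rw [hf, norm_div, Complex.norm_real, Real.norm_of_nonneg (by linarith)]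
  have hf0 : 1 / (2 * M) ≤ ‖f 0‖ := by
    rw [hfn, add_zero, ← div_div]
    gcongr
    exact hlow z₀ hz₀re
  have hmain := norm_ge_of_dist_zeros (r := r) (r₁ := r₁) (R := R) (R' := R') (B := B) (d := d)
    (by linarith) (by linarith) (by linarith) (by linarith) hB0 (Real.exp_pos _).le
    (by linarith) (z := ((σ - σ₀ : ℝ) : ℂ))
    (by rw [Complex.norm_real, Real.norm_eq_abs, abs_le]; constructor <;> linarith) n f
    (fun w hw => by
      rw [mem_ball_zero_iff] at hw
      have hne : z₀ + w ≠ 1 := fun h => by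
        have := him w
        rw [h, Complex.one_im] at this
        linarith
      have h1 : DifferentiableAt ℂ (fun w => Z (z₀ + w)) w :=
        (hZ _ hne).comp w (differentiableAt_id.const_add z₀)
      exact (h1.div_const _).differentiableWithinAt)
    (fun w hw => by
      rw [mem_closedBall_zero_iff] at hw
      rw [hfn, div_le_one (by linarith)]
      have hre : -(3 / 2) ≤ (z₀ + w).re := by
        rw [Complex.add_re, hz₀re]
        linarith [neg_le_of_abs_le (Complex.abs_re_le_norm w)]
      refine (hgrow _ hre ((by linarith [him w] : 1 ≤ (z₀ + w).im).trans (le_abs_self _))).trans ?_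
      rw [hM]
      have h1 : ‖z₀‖ ≤ σ₀ + T := by
        refine (norm_add_le _ _).trans ?_
        rw [norm_mul, Complex.norm_I, mul_one, Complex.norm_real, Complex.norm_real,
          Real.norm_of_nonneg (by linarith), Real.norm_of_nonneg (by linarith)]
      have h2 := norm_add_le z₀ w
      exact mul_le_mul_of_nonneg_left (pow_le_pow_left₀ (by positivity) (by linarith) N)
        (by linarith))
    (hexpB.trans_le hf0)
    (by
      refine lt_of_lt_of_le ?_ hf0
      rw [← hexpB, ← Real.exp_log (show 0 < r₁ / R from div_pos (by linarith) (by linarith)),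
        ← Real.exp_nat_mul, Real.exp_lt_exp, ← inv_div, Real.log_inv, ← hL]
      linarith)
    (fun ρ hρ hρ0 => by
      rw [mem_closedBall_zero_iff] at hρ
      have h1 : Z (z₀ + ρ) = 0 := by
        have h2 := hfn ρ
        rw [hρ0, norm_zero, eq_comm, div_eq_zero_iff] at h2
        exact norm_eq_zero.1 (h2.resolve_right (by linarith))
      have h3 : 3 ≤ (z₀ + ρ).im := by linarith [him ρ]
      have h4 := hzero _ h1 (by linarith)
      rw [Complex.add_im, hz₀im] at h4 h3
      have h5 : T + ρ.im ≤ X := by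
        linarith [le_of_abs_le (Complex.abs_im_le_norm ρ)]
      have h6 := div_log_le_div_log h3 h5
      calc d ≤ Real.exp (-A₁ * (T + ρ.im) / Real.log (T + ρ.im)) := by
            rw [hd, neg_mul, neg_div, mul_div_assoc]
            gcongr
        _ ≤ |T - (T + ρ.im)| := h4.le
        _ = |(((σ - σ₀ : ℝ) : ℂ) - ρ).im| := by
          rw [Complex.sub_im, Complex.ofReal_im]
          congr 1
          ring
        _ ≤ _ := Complex.abs_im_le_norm _)
  have hfz : ‖f ((σ - σ₀ : ℝ) : ℂ)‖ ≤ ‖Z (σ + T * Complex.I)‖ := by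
    rw [hfn]
    refine (div_le_self (norm_nonneg _) hM1).trans_eq ?_
    congr 2
    rw [hz₀]
    push_cast
    ring
  refine le_trans ?_ (hmain.trans hfz)
  have hdR : d / (2 * R) = Real.exp (-(A₁ * (X / ℓ) + Real.log (2 * R))) := by
    rw [neg_add, Real.exp_add, Real.exp_neg (Real.log _), Real.exp_log (by linarith), hd,
      div_eq_mul_inv]
  rw [hdR, ← Real.exp_nat_mul, ← Real.exp_add, Real.exp_le_exp]
  have h1 : n * (A₁ * (X / ℓ)) ≤ X / 8 := by
    calc n * (A₁ * (X / ℓ)) ≤ c₁ * ℓ * (A₁ * (X / ℓ)) := by gcongr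
      _ = X / 8 := by rw [hA₁]; field_simp
  have h2 : n * Real.log (2 * R) ≤ c₁ * ℓ * Real.log (2 * R) := by gcongr
  have h3 : B * c₀ ≤ (N + 1) * ℓ * c₀ := by gcongr
  have h4 : (N + 1) * ℓ * c₀ + c₁ * ℓ * Real.log (2 * R) = c₂ * ℓ := by rw [hc₂]; ring
  linarith

end LocalBound

open Complex NumberField Filter Topology

/-- Lemma 3.1 of Dixit–Gupta–Vatwani: there are constants `A₁ > 0`, `0 < A₂ < π/4`
(and a threshold `T₀ > 2`) such that whenever `T ≥ T₀` keeps a distance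
`> exp(-A₁ γ / log γ)` from every ordinate `γ > 1` of a non-trivial zero of the
Dedekind zeta function `ζK`, one has `|ζK(σ + iT)| ≥ e^{-A₂ T}` for all
`σ ∈ [-1/2, 3/2]`. -/
theorem dedekind_zeta_lower_bound
    (K : Type*) [Field K] [NumberField K] (ζK : ℂ → ℂ)
    (hζ_an : ∀ s : ℂ, s ≠ 1 → DifferentiableAt ℂ ζK s)
    (hζ_ser : ∀ s : ℂ, 1 < s.re →
      HasSum (fun I : {I : Ideal (𝓞 K) // I ≠ ⊥} =>
        ((Ideal.absNorm I.1 : ℕ) : ℂ) ^ (-s)) (ζK s))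
    (hζ_pole : ∃ A : ℂ, A ≠ 0 ∧
      Tendsto (fun s : ℂ => (s - 1) * ζK s) (𝓝[≠] (1 : ℂ)) (𝓝 A)) :
    ∃ A₁ A₂ T₀ : ℝ, 0 < A₁ ∧ 0 < A₂ ∧ A₂ < Real.pi / 4 ∧ 2 < T₀ ∧
      ∀ T : ℝ, T₀ ≤ T →
        (∀ ρ : ℂ, ζK ρ = 0 → 0 < ρ.re → ρ.re < 1 → 1 < ρ.im →
          |T - ρ.im| > Real.exp (-A₁ * ρ.im / Real.log ρ.im)) →
        ∀ σ : ℝ, σ ∈ Set.Icc (-(1/2) : ℝ) (3/2) →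
          Real.exp (-A₂ * T) ≤ ‖ζK (σ + T * I)‖ := by
  obtain ⟨σ₀, hσ₀, hlow⟩ := NumberFieldTheta.exists_half_le_norm_zeta hζ_ser
  obtain ⟨C, N, hgrow⟩ := NumberFieldTheta.exists_norm_zeta_le_pow hζ_an hζ_ser hζ_pole
  obtain ⟨A₁, T₀, hA₁, hT₀, h⟩ := LocalBound.exists_lower_bound hζ_an hσ₀ hlow
    (le_max_right C 1) (fun w h1 h2 => (hgrow w h1 h2).trans
      (mul_le_mul_of_nonneg_right (le_max_left C 1) (by positivity)))
  refine ⟨A₁, 1 / 2, T₀, hA₁, by norm_num, by linarith [Real.pi_gt_three], hT₀,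
    fun T hT hzero σ hσ => h T hT (fun ρ hρ him => ?_) σ hσ.1 hσ.2⟩
  obtain ⟨h1, h2⟩ := NumberFieldTheta.zeta_zero_re_mem hζ_an hζ_ser hζ_pole (by linarith) hρ
  exact hzero ρ hρ h1 h2 him
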